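/- There exists a polynomial P such that for every set S of N points in the plane in general position, the number of connected plane graphs on S is at most P(N) · 186.46^N; that is, this number is O*(186.46^N). -/

import Mathlib

open scoped Classical

noncomputable section

/-- A point in the plane. -/
abbrev Pt : Type := ℝ × ℝ

/-- `S` is in general position: no three distinct points of `S` are collinear. -/
def GenPos (S : Finset Pt) : Prop :=
  ∀ p ∈ S, ∀ q ∈ S, ∀ r ∈ S, p ≠ q → p ≠ r → q ≠ r →
    ¬ Collinear ℝ ({p, q, r} : Set Pt)

/-- Two straight edges cross if their relative interiors (open segments) meet. -/
def EdgesCross (e f : Sym2 Pt) : Prop :=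
  ∃ a b c d : Pt, e = s(a, b) ∧ f = s(c, d) ∧
    (openSegment ℝ a b ∩ openSegment ℝ c d).Nonempty

/-- `G` is a crossing-free straight-edge (plane) graph on the point set `S`:
its edges are nondegenerate straight segments between points of `S`,
and no two distinct edges cross. -/
def IsPlaneGraph (S : Finset Pt) (G : Finset (Sym2 Pt)) : Prop :=
  (∀ e ∈ G, ¬ e.IsDiag ∧ ∀ p ∈ e, p ∈ S) ∧
    ∀ e ∈ G, ∀ f ∈ G, e ≠ f → ¬ EdgesCross e f

/-- The (finite) collection of all plane graphs on `S`. -/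
def planeGraphs (S : Finset Pt) : Finset (Finset (Sym2 Pt)) :=
  S.sym2.powerset.filter (IsPlaneGraph S)

/-- The degree of the point `p` in the graph `G`. -/
def vingDeg (G : Finset (Sym2 Pt)) (p : Pt) : ℕ :=
  (G.filter fun e => p ∈ e).card

/-- The ving `(p, G)` is an x-ving: no straight edge from `p` to another point
of `S` can be added to `G` while keeping the graph plane. -/
def IsXVing (S : Finset Pt) (G : Finset (Sym2 Pt)) (p : Pt) : Prop :=
  ∀ q ∈ S, q ≠ p → s(p, q) ∉ G → ¬ IsPlaneGraph S (insert s(p, q) G)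

/-- `v_x(G)`: the number of x-vings of `G`. -/
def vx (S : Finset Pt) (G : Finset (Sym2 Pt)) : ℕ :=
  (S.filter (IsXVing S G)).card

/-- `v_i(G)`: the number of vertices of degree exactly `i` in `G`. -/
def vdeg (S : Finset Pt) (G : Finset (Sym2 Pt)) (i : ℕ) : ℕ :=
  (S.filter fun p => vingDeg G p = i).card

/-- `ĥv_x(S)`: the average of `v_x(G)` over a uniformly random plane graph on `S`. -/
def hvx (S : Finset Pt) : ℝ :=
  (∑ G ∈ planeGraphs S, (vx S G : ℝ)) / (planeGraphs S).card

/-- `ĥv_i(S)`: the average of `v_i(G)` over a uniformly random plane graph on `S`. -/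
def hvdeg (S : Finset Pt) (i : ℕ) : ℝ :=
  (∑ G ∈ planeGraphs S, (vdeg S G i : ℝ)) / (planeGraphs S).card

/-- `pg(N)`: the maximum number of plane graphs over all sets of `N` points in
general position. -/
def pgMax (N : ℕ) : ℕ :=
  sSup {n : ℕ | ∃ S : Finset Pt, S.card = N ∧ GenPos S ∧ (planeGraphs S).card = n}

/-- The plane graphs on `S` with at most `m` edges. -/
def planeGraphsLE (S : Finset Pt) (m : ℝ) : Finset (Finset (Sym2 Pt)) :=
  (planeGraphs S).filter fun G => (G.card : ℝ) ≤ m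

/-- `ĥv_{x,m}(S)`: the average of `v_x(G)` over a uniformly random plane graph
on `S` with at most `m` edges. -/
def hvxLE (S : Finset Pt) (m : ℝ) : ℝ :=
  (∑ G ∈ planeGraphsLE S m, (vx S G : ℝ)) / (planeGraphsLE S m).card

/-- `G` has no vertex (point of `S`) of degree smaller than `i`. -/
def MinDegGe (S : Finset Pt) (G : Finset (Sym2 Pt)) (i : ℕ) : Prop :=
  ∀ p ∈ S, i ≤ vingDeg G p

/-- The plane graphs on `S` with no vertex of degree smaller than `i`. -/
def planeGraphsDeg (S : Finset Pt) (i : ℕ) : Finset (Finset (Sym2 Pt)) :=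
  (planeGraphs S).filter fun G => MinDegGe S G i

/-- The plane graphs on `S` with at most `m` edges and no vertex of degree
smaller than `i`. -/
def planeGraphsLEDeg (S : Finset Pt) (m : ℝ) (i : ℕ) : Finset (Finset (Sym2 Pt)) :=
  (planeGraphs S).filter fun G => (G.card : ℝ) ≤ m ∧ MinDegGe S G i

/-- `ĥv_{x,m}(S,i)`: the average of `v_x(G)` over a uniformly random plane graph
on `S` with at most `m` edges and no vertex of degree smaller than `i`. -/
def hvxLEDeg (S : Finset Pt) (m : ℝ) (i : ℕ) : ℝ :=
  (∑ G ∈ planeGraphsLEDeg S m i, (vx S G : ℝ)) / (planeGraphsLEDeg S m i).card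

/-- `pg(N, i)`: the maximum, over sets `S` of `N` points in general position, of
the number of plane graphs on `S` with no vertex of degree smaller than `i`. -/
def pgMaxDeg (N i : ℕ) : ℕ :=
  sSup {n : ℕ | ∃ S : Finset Pt, S.card = N ∧ GenPos S ∧ (planeGraphsDeg S i).card = n}

/-- The underlying abstract graph of `G` on the vertex set `S`. -/
def abstractGraph (S : Finset Pt) (G : Finset (Sym2 Pt)) :
    SimpleGraph (S : Set Pt) :=
  SimpleGraph.induce (S : Set Pt) (SimpleGraph.fromEdgeSet (G : Set (Sym2 Pt)))

/-- The connected plane graphs on `S`. -/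
def connPlaneGraphs (S : Finset Pt) : Finset (Finset (Sym2 Pt)) :=
  (planeGraphs S).filter fun G => (abstractGraph S G).Connected

/-- The underlying abstract graph of `G` is bi-connected (2-vertex-connected):
it is connected and remains connected after deletion of any single vertex. -/
def Biconnected (S : Finset Pt) (G : Finset (Sym2 Pt)) : Prop :=
  (abstractGraph S G).Connected ∧
    ∀ v ∈ S, (SimpleGraph.induce ((S : Set Pt) \ {v})
      (SimpleGraph.fromEdgeSet (G : Set (Sym2 Pt)))).Connected

/-- The bi-connected plane graphs on `S`. -/
def biconnPlaneGraphs (S : Finset Pt) : Finset (Finset (Sym2 Pt)) :=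
  (planeGraphs S).filter (Biconnected S)

/-- `G` is a `k`-quasi-plane graph on `S`: a straight-edge graph on `S`
(crossings allowed) with no `k` pairwise crossing edges. -/
def IsQuasiPlane (k : ℕ) (S : Finset Pt) (G : Finset (Sym2 Pt)) : Prop :=
  (∀ e ∈ G, ¬ e.IsDiag ∧ ∀ p ∈ e, p ∈ S) ∧
    ¬ ∃ T ⊆ G, T.card = k ∧ ∀ e ∈ T, ∀ f ∈ T, e ≠ f → EdgesCross e f

/-- The (finite) collection of all `k`-quasi-plane graphs on `S`. -/
def qpGraphs (k : ℕ) (S : Finset Pt) : Finset (Finset (Sym2 Pt)) :=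
  S.sym2.powerset.filter (IsQuasiPlane k S)

/-- The ving `(p, G)` is an x-ving of the `k`-quasi-plane graph `G`: no straight
edge from `p` to another point of `S` can be added to `G` without violating
`k`-quasi-planarity. -/
def IsXVingQP (k : ℕ) (S : Finset Pt) (G : Finset (Sym2 Pt)) (p : Pt) : Prop :=
  ∀ q ∈ S, q ≠ p → s(p, q) ∉ G → ¬ IsQuasiPlane k S (insert s(p, q) G)

/-- `v_x(G)` for a `k`-quasi-plane graph `G`. -/
def vxQP (k : ℕ) (S : Finset Pt) (G : Finset (Sym2 Pt)) : ℕ :=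
  (S.filter (IsXVingQP k S G)).card

/-- `ĥv_x^k(S)`: the average of `v_x(G)` over a uniformly random `k`-quasi-plane
graph on `S`. -/
def hvxQP (k : ℕ) (S : Finset Pt) : ℝ :=
  (∑ G ∈ qpGraphs k S, (vxQP k S G : ℝ)) / (qpGraphs k S).card

/-- `qp_k(N)`: the maximum number of `k`-quasi-plane graphs over all sets of `N`
points in general position. -/
def qpMax (k N : ℕ) : ℕ :=
  sSup {n : ℕ | ∃ S : Finset Pt, S.card = N ∧ GenPos S ∧ (qpGraphs k S).card = n}

/-- Twice the signed area of the triangle `a b c`. -/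
def orient (a b c : Pt) : ℝ := (b.1 - a.1) * (c.2 - a.2) - (b.2 - a.2) * (c.1 - a.1)

/-- No three distinct points of `S` have vanishing orientation. -/
def OrientGP (S : Finset Pt) : Prop :=
  ∀ a ∈ S, ∀ b ∈ S, ∀ c ∈ S, a ≠ b → a ≠ c → b ≠ c → orient a b c ≠ 0

/-- The segments `a b` and `c d` cross properly. -/
def Cr (a b c d : Pt) : Prop :=
  orient a b c * orient a b d < 0 ∧ orient c d a * orient c d b < 0

lemma orient_rot (a b c : Pt) : orient b c a = orient a b c := by unfold orient; ring
lemma orient_swap (a b c : Pt) : orient b a c = -orient a b c := by unfold orient; ring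
lemma orient_swap_right (a b c : Pt) : orient a c b = -orient a b c := by unfold orient; ring
@[simp] lemma orient_self_left (a c : Pt) : orient a a c = 0 := by unfold orient; ring
@[simp] lemma orient_self_right (a c : Pt) : orient a c c = 0 := by unfold orient; ring
@[simp] lemma orient_self_mid (a c : Pt) : orient a c a = 0 := by unfold orient; ring

lemma Cr.symm {a b c d : Pt} (h : Cr a b c d) : Cr c d a b := ⟨h.2, h.1⟩

lemma Cr.swap_left {a b c d : Pt} (h : Cr a b c d) : Cr b a c d := by
  refine ⟨?_, by rw [mul_comm]; exact h.2⟩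
  rw [orient_swap a b c, orient_swap a b d, neg_mul_neg]; exact h.1

lemma Cr.swap_right {a b c d : Pt} (h : Cr a b c d) : Cr a b d c := h.symm.swap_left.symm

/-- The point dividing the segment `a b` in ratio `t`. -/
def seg (a b : Pt) (t : ℝ) : Pt := ((1 - t) * a.1 + t * b.1, (1 - t) * a.2 + t * b.2)

lemma orient_seg (a b c d : Pt) (t : ℝ) :
    orient a b (seg c d t) = (1 - t) * orient a b c + t * orient a b d := by
  unfold orient seg; ring

lemma orient_seg_mid (p x c d : Pt) (t : ℝ) :
    orient p (seg c d t) x = (1 - t) * orient p c x + t * orient p d x := by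
  unfold orient seg; ring

lemma seg_mem_openSegment {a b : Pt} {t : ℝ} (h0 : 0 < t) (h1 : t < 1) :
    seg a b t ∈ openSegment ℝ a b :=
  ⟨1 - t, t, by linarith, h0, by ring, by ext <;> simp [seg]⟩

lemma exists_seg_of_mem_openSegment {a b z : Pt} (h : z ∈ openSegment ℝ a b) :
    ∃ t, 0 < t ∧ t < 1 ∧ z = seg a b t := by
  obtain ⟨u, v, hu, hv, huv, rfl⟩ := h
  refine ⟨v, hv, by linarith, ?_⟩
  obtain rfl : u = 1 - v := by linarith
  ext <;> simp [seg]

lemma Cr.exists_seg {a b c d : Pt} (h : Cr a b c d) :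
    ∃ t r, 0 < t ∧ t < 1 ∧ 0 < r ∧ r < 1 ∧ seg a b t = seg c d r := by
  obtain ⟨h1, h2⟩ := h
  have key : ∀ u v : ℝ, u * v < 0 → u - v ≠ 0 ∧ 0 < u / (u - v) ∧ u / (u - v) < 1 := by
    intro u v huv
    rcases mul_neg_iff.1 huv with ⟨hu, hv⟩ | ⟨hu, hv⟩
    · have : 0 < u - v := by linarith
      exact ⟨this.ne', div_pos hu this, (div_lt_one this).2 (by linarith)⟩
    · have : u - v < 0 := by linarith
      exact ⟨this.ne, div_pos_of_neg_of_neg hu this, (div_lt_one_of_neg this).2 (by linarith)⟩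
  obtain ⟨k1, k2, k3⟩ := key _ _ h1
  obtain ⟨l1, l2, l3⟩ := key _ _ h2
  refine ⟨_, _, l2, l3, k2, k3, ?_⟩
  unfold orient seg at *
  ext
  · simp only
    field_simp
    ring
  · simp only
    field_simp
    ring

lemma exists_orient_ne {a b : Pt} (h : a ≠ b) : ∃ c, orient a b c ≠ 0 := by
  by_contra! hc
  apply h
  have h1 := hc (a.1 + 1, a.2)
  have h2 := hc (a.1, a.2 + 1)
  unfold orient at h1 h2
  ext <;> simp at h1 h2 <;> linarith

lemma OrientGP.cr_of_seg {S : Finset Pt} (hS : OrientGP S) {a b c d : Pt} (ha : a ∈ S) (hb : b ∈ S)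
    (hc : c ∈ S) (hd : d ∈ S) (hab : a ≠ b) (hcd : c ≠ d) (hne : s(a, b) ≠ s(c, d)) {t r : ℝ}
    (ht0 : 0 < t) (ht1 : t < 1) (hr0 : 0 < r) (hr1 : r < 1) (h : seg a b t = seg c d r) :
    Cr a b c d := by
  have key : ∀ a ∈ S, ∀ b ∈ S, ∀ c ∈ S, ∀ d ∈ S, a ≠ b → c ≠ d → s(a, b) ≠ s(c, d) →
      ∀ t r : ℝ, 0 < r → r < 1 → seg a b t = seg c d r → orient a b c * orient a b d < 0 := by
    clear * - hS
    intro a ha b hb c hc d hd hab hcd hne t r hr0 hr1 h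
    have e : (1 - r) * orient a b c + r * orient a b d = 0 := by
      rw [← orient_seg, ← h, orient_seg]; simp
    have zc : orient a b c = 0 → c = a ∨ c = b := by
      intro h0; by_contra! hh; exact hS a ha b hb c hc hab hh.1.symm hh.2.symm h0
    have zd : orient a b d = 0 → d = a ∨ d = b := by
      intro h0; by_contra! hh; exact hS a ha b hb d hd hab hh.1.symm hh.2.symm h0
    have nz : ¬ (orient a b c = 0 ∧ orient a b d = 0) := by
      rintro ⟨h1, h2⟩
      rcases zc h1 with rfl | rfl <;> rcases zd h2 with rfl | rfl <;> simp_all [Sym2.eq_swap]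
    rcases lt_trichotomy (orient a b c) 0 with h1 | h1 | h1
    · have : 0 < orient a b d := by
        by_contra! h2; nlinarith
      exact mul_neg_of_neg_of_pos h1 this
    · exfalso; rw [h1] at e; simp [hr0.ne'] at e; exact nz ⟨h1, e⟩
    · have : orient a b d < 0 := by
        by_contra! h2; nlinarith
      exact mul_neg_of_pos_of_neg h1 this
  exact ⟨key a ha b hb c hc d hd hab hcd hne t r hr0 hr1 h,
    key c hc d hd a ha b hb hcd hab hne.symm r t ht0 ht1 h.symm⟩

lemma OrientGP.edgesCross_iff {S : Finset Pt} (hS : OrientGP S) {a b c d : Pt} (ha : a ∈ S)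
    (hb : b ∈ S) (hc : c ∈ S) (hd : d ∈ S) (hab : a ≠ b) (hcd : c ≠ d) (hne : s(a, b) ≠ s(c, d)) :
    EdgesCross s(a, b) s(c, d) ↔ Cr a b c d := by
  constructor
  · rintro ⟨a', b', c', d', h1, h2, z, hz1, hz2⟩
    have hz1 : z ∈ openSegment ℝ a b := by
      rcases Sym2.eq_iff.1 h1 with ⟨rfl, rfl⟩ | ⟨rfl, rfl⟩
      · exact hz1
      · rw [openSegment_symm]; exact hz1
    have hz2 : z ∈ openSegment ℝ c d := by
      rcases Sym2.eq_iff.1 h2 with ⟨rfl, rfl⟩ | ⟨rfl, rfl⟩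
      · exact hz2
      · rw [openSegment_symm]; exact hz2
    obtain ⟨t, t0, t1, e1⟩ := exists_seg_of_mem_openSegment hz1
    obtain ⟨r, r0, r1, e2⟩ := exists_seg_of_mem_openSegment hz2
    exact hS.cr_of_seg ha hb hc hd hab hcd hne t0 t1 r0 r1 (e1.symm.trans e2)
  · intro h
    obtain ⟨t, r, t0, t1, r0, r1, e⟩ := h.exists_seg
    exact ⟨a, b, c, d, rfl, rfl, _, seg_mem_openSegment t0 t1, e ▸ seg_mem_openSegment r0 r1⟩

lemma GenPos.orientGP {S : Finset Pt} (h : GenPos S) : OrientGP S := by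
  intro a ha b hb c hc hab hac hbc h0
  apply h a ha b hb c hc hab hac hbc
  rw [collinear_iff_of_mem (p₀ := a) (by simp)]
  refine ⟨b - a, ?_⟩
  have hne : b.1 - a.1 ≠ 0 ∨ b.2 - a.2 ≠ 0 := by
    by_contra! hh
    exact hab (Prod.ext (by linarith [hh.1]) (by linarith [hh.2]))
  have hcx : ∃ r : ℝ, c = r • (b - a) +ᵥ a := by
    unfold orient at h0
    rcases hne with hh | hh
    · refine ⟨(c.1 - a.1) / (b.1 - a.1), ?_⟩
      ext
      · simp; field_simp; ring
      · simp; field_simp; linarith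
    · refine ⟨(c.2 - a.2) / (b.2 - a.2), ?_⟩
      ext
      · simp; field_simp; linarith
      · simp; field_simp; ring
  rintro p (rfl | rfl | rfl)
  · exact ⟨0, by simp⟩
  · exact ⟨1, by simp⟩
  · exact hcx

lemma OrientGP.mono {S T : Finset Pt} (hS : OrientGP S) (h : T ⊆ S) : OrientGP T :=
  fun a ha b hb c hc => hS a (h ha) b (h hb) c (h hc)

/-- The edges of `G` join distinct points of `S` and do not cross. -/
structure PG (S : Finset Pt) (G : Finset (Sym2 Pt)) : Prop where
  mem : ∀ {a b}, s(a, b) ∈ G → a ≠ b ∧ a ∈ S ∧ b ∈ S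
  not_cr : ∀ {a b c d}, s(a, b) ∈ G → s(c, d) ∈ G → ¬ Cr a b c d

lemma not_cr_self (a b : Pt) : ¬ Cr a b a b := by simp [Cr]

lemma isPlaneGraph_iff {S : Finset Pt} (hS : OrientGP S) {G : Finset (Sym2 Pt)} :
    IsPlaneGraph S G ↔ PG S G := by
  constructor
  · rintro ⟨h1, h2⟩
    have hm : ∀ {a b}, s(a, b) ∈ G → a ≠ b ∧ a ∈ S ∧ b ∈ S := by
      intro a b hab
      obtain ⟨h3, h4⟩ := h1 _ hab
      exact ⟨by simpa using h3, h4 a (by simp), h4 b (by simp)⟩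
    refine ⟨hm, ?_⟩
    intro a b c d hab hcd hcr
    obtain ⟨n1, a1, b1⟩ := hm hab
    obtain ⟨n2, c1, d1⟩ := hm hcd
    have hne : s(a, b) ≠ s(c, d) := by
      intro he
      rcases Sym2.eq_iff.1 he with ⟨rfl, rfl⟩ | ⟨rfl, rfl⟩
      · exact not_cr_self _ _ hcr
      · exact not_cr_self _ _ hcr.swap_left
    exact h2 _ hab _ hcd hne ((hS.edgesCross_iff a1 b1 c1 d1 n1 n2 hne).2 hcr)
  · intro h
    constructor
    · intro e he
      induction e with
      | _ a b =>
        obtain ⟨h1, h2, h3⟩ := h.mem he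
        refine ⟨by simpa using h1, ?_⟩
        intro p hp
        rcases Sym2.mem_iff.1 hp with rfl | rfl <;> assumption
    · intro e he f hf hne hcr
      induction e with
      | _ a b =>
        induction f with
        | _ c d =>
          obtain ⟨h1, h2, h3⟩ := h.mem he
          obtain ⟨h4, h5, h6⟩ := h.mem hf
          exact h.not_cr he hf ((hS.edgesCross_iff h2 h3 h5 h6 h1 h4 hne).1 hcr)

lemma mem_planeGraphs {S : Finset Pt} (hS : OrientGP S) {G : Finset (Sym2 Pt)} :
    G ∈ planeGraphs S ↔ PG S G := by
  unfold planeGraphs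
  rw [Finset.mem_filter, isPlaneGraph_iff hS, and_iff_right_iff_imp]
  intro h
  rw [Finset.mem_powerset]
  intro e he
  induction e with
  | _ a b =>
    obtain ⟨-, h2, h3⟩ := h.mem he
    simp [h2, h3]

lemma exists_affine_zero {A B r s : ℝ} (hr : 0 < (1 - r) * A + r * B)
    (hs : (1 - s) * A + s * B < 0) (hrs : r < s) :
    ∃ m, r < m ∧ m < s ∧ (1 - m) * A + m * B = 0 := by
  have h : 0 < A - B := by nlinarith
  refine ⟨A / (A - B), ?_, ?_, ?_⟩
  · rw [lt_div_iff₀ h]; linarith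
  · rw [div_lt_iff₀ h]; linarith
  · field_simp; ring

/-- The orientation of `a b c`, scaled by `σ`; the sign of `σ` lets one treat both
orientations of the plane at once. -/
def os (σ : ℝ) (a b c : Pt) : ℝ := σ * orient a b c

lemma os_rot (σ : ℝ) (a b c : Pt) : os σ b c a = os σ a b c := by unfold os; rw [orient_rot]
lemma os_swap (σ : ℝ) (a b c : Pt) : os σ b a c = -os σ a b c := by
  unfold os; rw [orient_swap]; ring
lemma os_swap_right (σ : ℝ) (a b c : Pt) : os σ a c b = -os σ a b c := by
  unfold os; rw [orient_swap_right]; ring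
@[simp] lemma os_self_left (σ : ℝ) (a c : Pt) : os σ a a c = 0 := by simp [os]
@[simp] lemma os_self_right (σ : ℝ) (a c : Pt) : os σ a c c = 0 := by simp [os]
@[simp] lemma os_self_mid (σ : ℝ) (a c : Pt) : os σ a c a = 0 := by simp [os]
lemma os_seg (σ : ℝ) (a b c d : Pt) (t : ℝ) :
    os σ a b (seg c d t) = (1 - t) * os σ a b c + t * os σ a b d := by
  unfold os; rw [orient_seg]; ring
lemma os_seg_mid (σ : ℝ) (p x c d : Pt) (t : ℝ) :
    os σ p (seg c d t) x = (1 - t) * os σ p c x + t * os σ p d x := by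
  unfold os; rw [orient_seg_mid]; ring
lemma os_plucker (σ : ℝ) (p a v x w : Pt) :
    os σ p a v * os σ p x w = os σ p a x * os σ p v w + os σ p a w * os σ p x v := by
  unfold os orient; ring
/-- The oriented areas of the four triangles spanned by four points. -/
lemma os_four (σ : ℝ) (p w a b : Pt) :
    os σ a b p - os σ a b w = os σ p w b - os σ p w a := by
  unfold os orient; ring

lemma OrientGP.os_ne {S : Finset Pt} (hS : OrientGP S) {σ : ℝ} (hσ : σ ≠ 0) {a b c : Pt}
    (ha : a ∈ S) (hb : b ∈ S) (hc : c ∈ S) (hab : a ≠ b) (hac : a ≠ c) (hbc : b ≠ c) :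
    os σ a b c ≠ 0 :=
  mul_ne_zero hσ (hS a ha b hb c hc hab hac hbc)

lemma Cr.os_left {a b c d : Pt} (h : Cr a b c d) {σ : ℝ} (hσ : σ ≠ 0) :
    os σ a b c * os σ a b d < 0 := by
  have h1 := h.1
  have h2 : 0 < σ ^ 2 := by positivity
  unfold os
  nlinarith [mul_neg_of_pos_of_neg h2 h1]

lemma Cr.os_right {a b c d : Pt} (h : Cr a b c d) {σ : ℝ} (hσ : σ ≠ 0) :
    os σ c d a * os σ c d b < 0 := h.symm.os_left hσ

/-- If `p w` and `a b` cross and `b` lies on the positive side of `p w`, then `p` lies on the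
positive side of `a b`. -/
lemma Cr.os_pos {p w a b : Pt} (h : Cr p w a b) {σ : ℝ} (hσ : σ ≠ 0) (hb : 0 < os σ p w b) :
    os σ p w a < 0 ∧ 0 < os σ a b p ∧ os σ a b w < 0 := by
  have h1 := h.os_left hσ
  have h2 := h.os_right hσ
  have h3 := os_four σ p w a b
  have h4 : os σ p w a < 0 := by
    by_contra! hh; nlinarith
  have h5 : 0 < os σ a b p := by
    by_contra! hh; nlinarith
  exact ⟨h4, h5, by by_contra! hh; nlinarith⟩

lemma eq_seg_of_orient_eq_zero {a b z : Pt} (h : orient a b z = 0) {p w : Pt}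
    (hne : orient p a w - orient p b w ≠ 0) :
    z = seg a b ((orient p a w - orient p z w) / (orient p a w - orient p b w)) := by
  have hq := div_mul_cancel₀ (orient p a w - orient p z w) hne
  set q := (orient p a w - orient p z w) / (orient p a w - orient p b w)
  unfold orient at *
  ext
  · apply mul_left_cancel₀ hne
    simp only [seg]
    linear_combination (a.1 - b.1) * hq - (w.1 - p.1) * h
  · apply mul_left_cancel₀ hne
    simp only [seg]
    linear_combination (a.2 - b.2) * hq - (w.2 - p.2) * h

lemma eq_seg_of_os_eq_zero {σ : ℝ} (hσ : σ ≠ 0) {a b z : Pt} (h : os σ a b z = 0) {p w : Pt}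
    (hne : os σ p a w - os σ p b w ≠ 0) :
    z = seg a b ((os σ p a w - os σ p z w) / (os σ p a w - os σ p b w)) := by
  unfold os at *
  have h : orient a b z = 0 := by simpa [hσ] using h
  rw [← mul_sub, ← mul_sub, mul_div_mul_left _ _ hσ]
  rw [← mul_sub] at hne
  exact eq_seg_of_orient_eq_zero h (right_ne_zero_of_mul hne)

/-- The points of `S` visible from `p` among the edges of `G`. -/
def vis (S : Finset Pt) (G : Finset (Sym2 Pt)) (p : Pt) : Finset Pt :=
  S.filter fun w => w ≠ p ∧ ∀ a b, s(a, b) ∈ G → ¬ Cr p w a b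

lemma mem_vis {S : Finset Pt} {G : Finset (Sym2 Pt)} {p w : Pt} :
    w ∈ vis S G p ↔ w ∈ S ∧ w ≠ p ∧ ∀ a b, s(a, b) ∈ G → ¬ Cr p w a b := by
  simp [vis]

lemma Cr.fst_ne {a b c d : Pt} (h : Cr a b c d) : a ≠ c ∧ a ≠ d ∧ b ≠ c ∧ b ≠ d := by
  refine ⟨?_, ?_, ?_, ?_⟩ <;> rintro rfl <;> simp [Cr] at h

lemma Cr.sym2_ne {a b c d : Pt} (h : Cr a b c d) : s(a, b) ≠ s(c, d) := by
  intro he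
  rcases Sym2.eq_iff.1 he with ⟨rfl, rfl⟩ | ⟨rfl, rfl⟩
  · exact h.fst_ne.1 rfl
  · exact h.fst_ne.2.1 rfl

/-- If `p w` crosses `a b` and neither segment is crossed by an edge of `G`, then some point
of the triangle cut off at `p` on the side of `a` is visible from `p`, and it can be chosen
angularly closest to `w`. -/
lemma OrientGP.exists_vis_of_cr {S : Finset Pt} (hS : OrientGP S) {G : Finset (Sym2 Pt)}
    (hG : ∀ {a b}, s(a, b) ∈ G → a ≠ b ∧ a ∈ S ∧ b ∈ S) {p w a b : Pt} (hp : p ∈ S) (ha : a ∈ S)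
    (hb : b ∈ S) {σ : ℝ} (hσ : σ ≠ 0) (hcr : Cr p w a b) (hw : w ∈ vis S G p)
    (hab : ∀ c d, s(c, d) ∈ G → ¬ Cr a b c d) (haw : 0 < os σ p a w) :
    ∃ x ∈ vis S G p, 0 < os σ p x w ∧ (x = a ∨ (0 < os σ p a x ∧ 0 < os σ a b x)) ∧
      ∀ v ∈ S, 0 < os σ p x v → 0 < os σ p v w → ¬ 0 < os σ a b v := by
  obtain ⟨hwS, hwp, hwG⟩ := mem_vis.1 hw
  obtain ⟨hpa, hpb, hwa, hwb⟩ := hcr.fst_ne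
  have hpwb : 0 < os σ p w b := by
    have := hcr.os_left hσ
    rw [os_swap_right σ p a w] at this
    by_contra! hh; nlinarith
  obtain ⟨-, gp, gw⟩ := hcr.os_pos hσ hpwb
  have hab' : a ≠ b := by rintro rfl; simp at gp
  set C := S.filter fun v => 0 < os σ p v w ∧ (v = a ∨ (0 < os σ p a v ∧ 0 < os σ a b v)) with hC
  obtain ⟨x, hxC, hmax⟩ := C.exists_max_image (fun v => os σ p a v / os σ p v w)
    ⟨a, by simp [hC, ha, haw]⟩
  obtain ⟨hxS, hxw, hx⟩ := Finset.mem_filter.1 hxC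
  have hax : 0 ≤ os σ p a x := by
    rcases hx with rfl | hx
    · simp
    · exact hx.1.le
  have gx : 0 ≤ os σ a b x := by
    rcases hx with rfl | hx
    · simp
    · exact hx.2.le
  have close : ∀ v ∈ S, 0 < os σ p x v → 0 < os σ p v w → ¬ 0 < os σ a b v := by
    intro v hv h1 h2 h3
    have h4 : 0 < os σ p a v := by
      have := os_plucker σ p a v x w
      by_contra! hh
      nlinarith [mul_pos haw h1, mul_nonneg hax h2.le]
    have h5 := hmax v (by simp [hC, hv, h2, h3, h4])
    rw [div_le_div_iff₀ h2 hxw] at h5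
    have := os_plucker σ p a v x w
    nlinarith [mul_pos haw h1]
  have hxp : x ≠ p := by rintro rfl; simp at hxw
  refine ⟨x, mem_vis.2 ⟨hxS, hxp, ?_⟩, hxw, hx, close⟩
  suffices H : ∀ c d, s(c, d) ∈ G → Cr p x c d → 0 < os σ p x d → False by
    intro c d hcd hc
    rcases lt_trichotomy (os σ p x d) 0 with h | h | h
    · have := hc.os_left hσ
      exact H d c (by rwa [Sym2.eq_swap]) hc.swap_right (by by_contra! hh; nlinarith)
    · have := hc.os_left hσ; rw [h] at this; simp at this
    · exact H c d hcd hc h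
  intro c d hcd hc hXd
  obtain ⟨ncd, hcS, hdS⟩ := hG hcd
  obtain ⟨hXc, Fp, Fx⟩ := hc.os_pos hσ hXd
  obtain ⟨npc, npd, nxc, nxd⟩ := hc.fst_ne
  obtain ⟨t, r, t0, t1, r0, r1, he⟩ := hc.exists_seg
  have hH : 0 < (1 - r) * os σ p c w + r * os σ p d w := by
    rw [← os_seg_mid, ← he, os_seg_mid]; simp only [os_self_left]; nlinarith
  have hX : (1 - r) * os σ p x c + r * os σ p x d = 0 := by
    rw [← os_seg, ← he, os_seg]; simp
  have hQ : 0 < (1 - r) * os σ a b c + r * os σ a b d := by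
    rw [← os_seg, ← he, os_seg]; nlinarith
  have hne : s(p, w) ≠ s(c, d) := by
    intro h
    have : p ∈ s(c, d) := h ▸ Sym2.mem_mk_left p w
    rcases Sym2.mem_iff.1 this with rfl | rfl <;> contradiction
  have hne2 : s(a, b) ≠ s(c, d) := by
    intro h
    rcases Sym2.eq_iff.1 h with ⟨rfl, rfl⟩ | ⟨rfl, rfl⟩ <;> simp at hQ
  have step : ∃ r1, r < r1 ∧ r1 ≤ 1 ∧ 0 ≤ (1 - r1) * os σ p c w + r1 * os σ p d w ∧
      (1 - r1) * os σ a b c + r1 * os σ a b d < 0 := by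
    rcases le_or_gt 0 (os σ p d w) with h1 | h1
    · refine ⟨1, r1, le_rfl, by linarith, ?_⟩
      suffices os σ a b d < 0 by linarith
      rcases h1.eq_or_lt with h2 | h2
      · have : d = w := by
          by_contra hdw
          exact hS.os_ne hσ hp hdS hwS npd hwp.symm hdw h2.symm
        rwa [this]
      · by_contra! h3
        rcases h3.eq_or_lt with h4 | h4
        · have : d = a ∨ d = b := by
            by_contra! hh
            exact hS.os_ne hσ ha hb hdS hab' hh.1.symm hh.2.symm h4.symm
          rcases this with rfl | rfl
          · rw [os_swap_right] at hXd; linarith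
          · rw [os_swap_right] at hpwb; linarith
        · exact close d hdS hXd h2 h4
    · obtain ⟨m, m1, m2, m3⟩ := exists_affine_zero hH (s := 1) (by linarith) r1
      refine ⟨m, m1, m2.le, m3.ge, ?_⟩
      by_contra! h3
      have hXm : 0 < os σ p x (seg c d m) := by rw [os_seg]; nlinarith
      have e0 : os σ p w (seg c d m) = 0 := by
        rw [os_swap_right, os_seg_mid, m3]; simp
      have hne' : os σ x p p - os σ x w p ≠ 0 := by
        rw [os_self_right, os_rot σ p x w]; simpa using hxw.ne'
      have e1 := eq_seg_of_os_eq_zero hσ e0 hne'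
      set s := (os σ x p p - os σ x (seg c d m) p) / (os σ x p p - os σ x w p) with hs
      have e2 : s = os σ p x (seg c d m) / os σ p x w := by
        rw [hs, os_self_right, os_rot σ p x, os_rot σ p x, zero_sub, zero_sub, neg_div_neg_eq]
      have s0 : 0 < s := by rw [e2]; positivity
      have s1 : s < 1 := by
        rw [← os_seg, e1, os_seg] at h3
        by_contra! hh; nlinarith
      exact hwG c d hcd (hS.cr_of_seg hp hwS hcS hdS hwp.symm ncd hne s0 s1 (by linarith) m2 e1.symm)
  obtain ⟨q, hrq, hq1, hHq, hQq⟩ := step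
  obtain ⟨m, m1, m2, m3⟩ := exists_affine_zero hQ hQq hrq
  have hXm : 0 < os σ p x (seg c d m) := by rw [os_seg]; nlinarith
  have hHm : 0 < os σ p (seg c d m) w := by
    rw [os_seg_mid]
    nlinarith [mul_pos (sub_pos.2 m2) hH, mul_nonneg (sub_pos.2 m1).le hHq]
  have hkm : 0 < os σ p a (seg c d m) := by
    have := os_plucker σ p a (seg c d m) x w
    by_contra! hh
    nlinarith [mul_pos haw hXm, mul_nonneg hax hHm.le]
  have hbw : os σ p b w < 0 := by rw [os_swap_right]; linarith
  have e1 := eq_seg_of_os_eq_zero hσ (z := seg c d m) (by rw [os_seg, m3])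
    (p := p) (w := w) (by linarith : os σ p a w - os σ p b w ≠ 0)
  set τ := (os σ p a w - os σ p (seg c d m) w) / (os σ p a w - os σ p b w) with hτ
  have τ1 : τ < 1 := by rw [hτ, div_lt_one (by linarith)]; linarith
  have τ0 : 0 < τ := by
    rw [e1, os_seg, os_self_right] at hkm
    have := os_rot σ p a b
    by_contra! hh; nlinarith
  exact hab c d hcd (hS.cr_of_seg ha hb hcS hdS hab' ncd hne2 τ0 τ1 (by linarith) (by linarith)
    e1.symm)

lemma orient_four (p w a b : Pt) :
    orient a b p - orient a b w = orient p w b - orient p w a := by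
  unfold orient; ring

lemma seg_swap (a b : Pt) (t : ℝ) : seg b a (1 - t) = seg a b t := by
  unfold seg; ext <;> simp <;> ring

lemma eq_seg_ray {p x z : Pt} (h : orient p x z = 0) {y : Pt} (hxy : 0 < orient p x y) :
    z = seg p x (orient p z y / orient p x y) := by
  have := eq_seg_of_orient_eq_zero h (p := p) (w := y) (by simpa using hxy.ne')
  rwa [orient_self_left, zero_sub, zero_sub, neg_div_neg_eq] at this

lemma eq_seg_ray' {p y z : Pt} (h : orient p z y = 0) {x : Pt} (hxy : 0 < orient p x y) :
    z = seg p y (orient p x z / orient p x y) := by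
  have h' : orient p y z = 0 := by rw [orient_swap_right, h, neg_zero]
  have := eq_seg_of_orient_eq_zero h' (p := p) (w := x)
    (by rw [orient_swap_right p x y]; simpa using hxy.ne')
  rwa [orient_self_left, zero_sub, zero_sub, neg_div_neg_eq, orient_swap_right p x y,
    orient_swap_right p x z, neg_div_neg_eq] at this

/-- An edge of `G` that leaves the triangle `p x y` neither through `p x` and `p y` (two
unobstructed segments) nor through `x y` must end inside. -/
lemma OrientGP.mem_cone_of_edge {S : Finset Pt} (hS : OrientGP S) {G : Finset (Sym2 Pt)}
    (hG : ∀ {a b}, s(a, b) ∈ G → a ≠ b ∧ a ∈ S ∧ b ∈ S) {p x y c d : Pt} {r : ℝ} (hp : p ∈ S)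
    (hx : x ∈ vis S G p) (hy : y ∈ vis S G p) (hxy : 0 < orient p x y) (hcd : s(c, d) ∈ G)
    (hpc : p ≠ c) (hpd : p ≠ d) (r1 : r < 1) (r0 : 0 < r)
    (hz1 : 0 < orient p x (seg c d r)) (hz2 : 0 < orient p (seg c d r) y)
    (hz3 : 0 ≤ orient x y (seg c d r)) (hd : 0 < orient x y d) :
    0 < orient p x d ∧ 0 < orient p d y := by
  obtain ⟨hxS, hxp, hxG⟩ := mem_vis.1 hx
  obtain ⟨hyS, hyp, hyG⟩ := mem_vis.1 hy
  obtain ⟨ncd, hcS, hdS⟩ := hG hcd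
  have hdx : x ≠ d := by rintro rfl; simp at hd
  have hdy : d ≠ y := by rintro rfl; simp at hd
  have gp : 0 < orient x y p := by rwa [orient_rot p x y]
  have hne : ∀ v, s(p, v) ≠ s(c, d) := by
    intro v h
    have : p ∈ s(c, d) := h ▸ Sym2.mem_mk_left p v
    rcases Sym2.mem_iff.1 this with rfl | rfl <;> contradiction
  have hgm : ∀ m, r < m → m < 1 → 0 < orient x y (seg c d m) := by
    intro m m1 m2
    rw [orient_seg] at hz3 ⊢
    nlinarith [mul_nonneg (sub_pos.2 m2).le hz3, mul_pos (sub_pos.2 m1) hd]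
  have exitX : ∀ m, r < m → m < 1 → orient p x (seg c d m) = 0 →
      ¬ 0 < orient p (seg c d m) y := by
    intro m m1 m2 h0 hY
    have e := eq_seg_ray h0 hxy
    have hg := hgm m m1 m2
    set s := orient p (seg c d m) y / orient p x y with hs
    have s0 : 0 < s := div_pos hY hxy
    rw [e, orient_seg, orient_self_mid] at hg
    have s1 : s < 1 := by by_contra! hh; nlinarith
    exact hxG c d hcd
      (hS.cr_of_seg hp hxS hcS hdS hxp.symm ncd (hne x) s0 s1 (by linarith) m2 e.symm)
  have exitY : ∀ m, r < m → m < 1 → orient p (seg c d m) y = 0 →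
      ¬ 0 < orient p x (seg c d m) := by
    intro m m1 m2 h0 hX
    have e := eq_seg_ray' h0 hxy
    have hg := hgm m m1 m2
    set s := orient p x (seg c d m) / orient p x y with hs
    have s0 : 0 < s := div_pos hX hxy
    rw [e, orient_seg, orient_self_right] at hg
    have s1 : s < 1 := by by_contra! hh; nlinarith
    exact hyG c d hcd
      (hS.cr_of_seg hp hyS hcS hdS hyp.symm ncd (hne y) s0 s1 (by linarith) m2 e.symm)
  have nX : orient p x d ≠ 0 := hS p hp x hxS d hdS hxp.symm hpd hdx
  have nY : orient p d y ≠ 0 := hS p hp d hdS y hyS hpd hyp.symm hdy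
  have zX : orient p x d < 0 → ∃ m, r < m ∧ m < 1 ∧ orient p x (seg c d m) = 0 ∧
      ∀ m', r < m' → m' < m → 0 < orient p x (seg c d m') := by
    intro h
    rw [orient_seg] at hz1
    obtain ⟨m, m1, m2, m3⟩ := exists_affine_zero hz1 (s := 1) (by linarith) r1
    refine ⟨m, m1, m2, by rw [orient_seg, m3], fun m' h1 h2 => ?_⟩
    rw [orient_seg]; nlinarith
  have zY : orient p d y < 0 → ∃ m, r < m ∧ m < 1 ∧ orient p (seg c d m) y = 0 ∧
      ∀ m', r < m' → m' < m → 0 < orient p (seg c d m') y := by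
    intro h
    rw [orient_seg_mid] at hz2
    obtain ⟨m, m1, m2, m3⟩ := exists_affine_zero hz2 (s := 1) (by linarith) r1
    refine ⟨m, m1, m2, by rw [orient_seg_mid, m3], fun m' h1 h2 => ?_⟩
    rw [orient_seg_mid]; nlinarith
  rcases lt_or_gt_of_ne nX with h1 | h1
  · exfalso
    obtain ⟨m, m1, m2, m3, m4⟩ := zX h1
    rcases lt_or_gt_of_ne nY with h2 | h2
    · obtain ⟨n, n1, n2, n3, n4⟩ := zY h2
      rcases lt_trichotomy m n with h | h | h
      · exact exitX m m1 m2 m3 (n4 m m1 h)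
      · subst h
        have e := eq_seg_ray m3 hxy
        rw [n3, zero_div] at e
        have e' : seg c d m = p := by rw [e]; unfold seg; simp
        have : orient c d p = 0 := by rw [← e', orient_seg]; simp
        exact hS c hcS d hdS p hp ncd hpc.symm hpd.symm this
      · exact exitY n n1 n2 n3 (m4 n n1 h)
    · refine exitX m m1 m2 m3 ?_
      rw [orient_seg_mid] at hz2 ⊢
      nlinarith [mul_pos (sub_pos.2 m2) hz2, mul_pos (sub_pos.2 m1) h2]
  · rcases lt_or_gt_of_ne nY with h2 | h2
    · exfalso
      obtain ⟨n, n1, n2, n3, n4⟩ := zY h2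
      refine exitY n n1 n2 n3 ?_
      rw [orient_seg] at hz1 ⊢
      nlinarith [mul_pos (sub_pos.2 n2) hz1, mul_pos (sub_pos.2 n1) h1]
    · exact ⟨h1, h2⟩

/-- If the triangle spanned by `p` and two points visible from `p` contains a point, it
contains a visible one. -/
lemma OrientGP.exists_vis_triangle {S : Finset Pt} (hS : OrientGP S) {G : Finset (Sym2 Pt)}
    (hG : ∀ {a b}, s(a, b) ∈ G → a ≠ b ∧ a ∈ S ∧ b ∈ S) {p x y : Pt} (hp : p ∈ S)
    (hx : x ∈ vis S G p) (hy : y ∈ vis S G p) (hxy : 0 < orient p x y)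
    (h : ∃ v ∈ S, 0 < orient p x v ∧ 0 < orient p v y ∧ 0 < orient x y v) :
    ∃ v ∈ vis S G p, 0 < orient p x v ∧ 0 < orient p v y ∧ 0 < orient x y v := by
  set C := S.filter fun v => 0 < orient p x v ∧ 0 < orient p v y ∧ 0 < orient x y v with hC
  obtain ⟨v, hvC, hmax⟩ := C.exists_max_image (fun v => orient x y v)
    (by obtain ⟨v, hv, h⟩ := h; exact ⟨v, by simp [hC, hv, h]⟩)
  obtain ⟨hvS, h1, h2, h3⟩ := Finset.mem_filter.1 hvC
  refine ⟨v, mem_vis.2 ⟨hvS, by rintro rfl; simp at h1, ?_⟩, h1, h2, h3⟩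
  suffices H : ∀ c d, s(c, d) ∈ G → p ≠ c → p ≠ d → ∀ t r, 0 < t → t < 1 → 0 < r → r < 1 →
      seg p v t = seg c d r → orient x y c ≤ orient x y d → False by
    intro c d hcd hc
    obtain ⟨t, r, t0, t1, r0, r1, e⟩ := hc.exists_seg
    rcases le_total (orient x y c) (orient x y d) with h | h
    · exact H c d hcd hc.fst_ne.1 hc.fst_ne.2.1 t r t0 t1 r0 r1 e h
    · exact H d c (by rwa [Sym2.eq_swap]) hc.fst_ne.2.1 hc.fst_ne.1 t (1 - r) t0 t1 (by linarith)
        (by linarith) (by rw [e, seg_swap]) h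
  intro c d hcd hpc hpd t r t0 t1 r0 r1 e hle
  have hpv : orient x y v < orient x y p := by
    have := orient_four p v x y
    have := orient_swap_right p v x
    linarith
  have g1 : orient x y v < orient x y (seg c d r) := by
    rw [← e, orient_seg]; nlinarith
  have g2 : orient x y (seg c d r) ≤ orient x y d := by
    rw [orient_seg]; nlinarith
  have := hS.mem_cone_of_edge hG hp hx hy hxy hcd hpc hpd r1 r0
    (by rw [← e, orient_seg]; simpa using mul_pos t0 h1)
    (by rw [← e, orient_seg_mid]; simpa using mul_pos t0 h2) (by linarith) (by linarith)
  have := hmax d (by simp [hC, (hG hcd).2.2, this]; linarith)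
  linarith

/-- If every visible point in the cone `x p y` lies beyond `x y`, no edge of `G` avoiding `p`
crosses `x y`. -/
lemma OrientGP.not_cr_chord {S : Finset Pt} (hS : OrientGP S) {G : Finset (Sym2 Pt)}
    (hG : ∀ {a b}, s(a, b) ∈ G → a ≠ b ∧ a ∈ S ∧ b ∈ S) {p x y : Pt} (hp : p ∈ S)
    (hx : x ∈ vis S G p) (hy : y ∈ vis S G p) (hxy : 0 < orient p x y)
    (hbey : ∀ v ∈ vis S G p, 0 < orient p x v → 0 < orient p v y → orient x y v < 0)
    {c d : Pt} (hcd : s(c, d) ∈ G) (hpc : p ≠ c) (hpd : p ≠ d) : ¬ Cr x y c d := by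
  intro hcr
  suffices H : ∀ c d, s(c, d) ∈ G → p ≠ c → p ≠ d → ∀ t r, 0 < t → t < 1 → 0 < r → r < 1 →
      seg x y t = seg c d r → 0 < orient x y d → False by
    obtain ⟨t, r, t0, t1, r0, r1, e⟩ := hcr.exists_seg
    rcases mul_neg_iff.1 hcr.1 with ⟨h, -⟩ | ⟨-, h⟩
    · exact H d c (by rwa [Sym2.eq_swap]) hpd hpc t (1 - r) t0 t1 (by linarith)
        (by linarith) (by rw [e, seg_swap]) h
    · exact H c d hcd hpc hpd t r t0 t1 r0 r1 e h
  intro c d hcd hpc hpd t r t0 t1 r0 r1 e hd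
  obtain ⟨h1, h2⟩ := hS.mem_cone_of_edge hG hp hx hy hxy hcd hpc hpd r1 r0
    (by rw [← e, orient_seg]; simpa using mul_pos t0 hxy)
    (by rw [← e, orient_seg_mid]; simpa using mul_pos (sub_pos.2 t1) hxy)
    (by rw [← e, orient_seg]; simp) hd
  obtain ⟨v, hv, h3, h4, h5⟩ := hS.exists_vis_triangle hG hp hx hy hxy
    ⟨d, (hG hcd).2.2, h1, h2, hd⟩
  linarith [hbey v hv h3 h4]

/-- The linear functional with coefficients `k`. -/
def lin (k p : Pt) : ℝ := k.1 * p.1 + k.2 * p.2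

lemma lin_neg (k p : Pt) : lin (-k) p = -lin k p := by simp [lin]; ring

lemma lin_seg (k a b : Pt) (t : ℝ) : lin k (seg a b t) = (1 - t) * lin k a + t * lin k b := by
  unfold lin seg; ring

lemma orient_mul_lin (k p x w y : Pt) :
    orient p x y * (lin k w - lin k p) =
      orient p x w * (lin k y - lin k p) + orient p w y * (lin k x - lin k p) := by
  unfold lin orient; ring

lemma os_mul_lin (σ : ℝ) (k p x w y : Pt) :
    os σ p x y * (lin k w - lin k p) =
      os σ p x w * (lin k y - lin k p) + os σ p w y * (lin k x - lin k p) := by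
  unfold lin os orient; ring

/-- Every affine functional, here `orient a b`, is determined by its values on `p x y`. -/
lemma orient_bary (p x y w a b : Pt) :
    orient p x y * orient a b w =
      orient x y w * orient a b p + orient p w y * orient a b x + orient p x w * orient a b y := by
  unfold orient; ring

lemma lt_lin_of_cone {σ : ℝ} {k p x w y : Pt} (h1 : 0 < os σ p x w) (h2 : 0 < os σ p w y)
    (h3 : 0 < os σ p x y) (hx : lin k p < lin k x) (hy : lin k p < lin k y) :
    lin k p < lin k w := by
  have := os_mul_lin σ k p x w y
  by_contra! hh
  nlinarith [mul_pos h1 (sub_pos.2 hy), mul_pos h2 (sub_pos.2 hx)]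

lemma os_pos_of_lin {σ : ℝ} {k p x w y : Pt} (h1 : 0 < os σ p x w) (h2 : 0 < os σ p w y)
    (hx : lin k p < lin k x) (hw : lin k p < lin k w) (hy : lin k p < lin k y) :
    0 < os σ p x y := by
  have := os_mul_lin σ k p x w y
  by_contra! hh
  nlinarith [mul_pos h1 (sub_pos.2 hy), mul_pos h2 (sub_pos.2 hx)]

lemma cr_of_os {σ : ℝ} (hσ : σ ≠ 0) {a b c d : Pt} (h1 : os σ a b c * os σ a b d < 0)
    (h2 : os σ c d a * os σ c d b < 0) : Cr a b c d := by
  have : 0 < σ ^ 2 := by positivity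
  unfold os at h1 h2
  constructor <;> by_contra! hh <;> nlinarith [mul_nonneg this.le hh]

lemma OrientGP.exists_vis_of_cr_right {S : Finset Pt} (hS : OrientGP S) {G : Finset (Sym2 Pt)}
    (hG : ∀ {a b}, s(a, b) ∈ G → a ≠ b ∧ a ∈ S ∧ b ∈ S) {p w a b k : Pt} (hp : p ∈ S) (ha : a ∈ S)
    (hb : b ∈ S) {σ : ℝ} (hσ : σ ≠ 0) (hcr : Cr p w a b) (hw : w ∈ vis S G p)
    (hab : ∀ c d, s(c, d) ∈ G → ¬ Cr a b c d) (haw : 0 < os σ p a w) (kw : lin k p < lin k w)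
    (ka : lin k p < lin k a) :
    ∃ x ∈ vis S G p, lin k p < lin k x ∧ 0 < os σ p x w ∧ 0 ≤ os σ a b x ∧
      (lin k p < lin k b → ∀ v ∈ S, s(p, v) ∈ G → 0 < os σ p x v → 0 < os σ p v w → False) := by
  obtain ⟨x, hx, hxw, hxa, hclose⟩ := hS.exists_vis_of_cr hG hp ha hb hσ hcr hw hab haw
  have kx : lin k p < lin k x := by
    rcases hxa with rfl | hxa
    · exact ka
    · exact lt_lin_of_cone hxa.1 hxw haw ka kw
  have hax : 0 ≤ os σ p a x := by
    rcases hxa with rfl | hxa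
    · simp
    · exact hxa.1.le
  have gx : 0 ≤ os σ a b x := by
    rcases hxa with rfl | hxa
    · simp
    · exact hxa.2.le
  refine ⟨x, hx, kx, hxw, gx, ?_⟩
  intro kb v hv hpv h1 h2
  have hpwb : 0 < os σ p w b := by
    have := hcr.os_left hσ
    rw [os_swap_right σ p a w] at this
    by_contra! hh; nlinarith
  obtain ⟨-, gp, gw⟩ := hcr.os_pos hσ hpwb
  have hg := hclose v hv h1 h2
  have hab' : a ≠ b := by rintro rfl; simp at gp
  have hva : a ≠ v := by
    rintro rfl
    rw [os_swap_right] at h1; linarith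
  have hvb : b ≠ v := by
    rintro rfl
    rw [os_swap_right] at h2; linarith
  have hg' : os σ a b v < 0 :=
    lt_of_le_of_ne (not_lt.1 hg) (hS.os_ne hσ ha hb hv hab' hva hvb)
  have hav : 0 < os σ p a v := by
    have := os_plucker σ p a v x w
    by_contra! hh
    nlinarith [mul_pos haw h1, mul_nonneg hax h2.le]
  have kv : lin k p < lin k v := lt_lin_of_cone h1 h2 hxw kx kw
  have hvb : 0 < os σ p v b := os_pos_of_lin h2 hpwb kv kw kb
  apply hab p v hpv
  apply Cr.symm
  refine cr_of_os hσ ?_ (mul_neg_of_pos_of_neg gp hg')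
  rw [os_swap_right σ p a v]
  nlinarith

/-- The points `x` and `y` lie strictly on the same side of `p` with respect to `k`. -/
def Same (k p x y : Pt) : Prop :=
  (lin k p < lin k x ∧ lin k p < lin k y) ∨ (lin k x < lin k p ∧ lin k y < lin k p)

lemma same_neg (k p x y : Pt) : Same (-k) p x y ↔ Same k p x y := by
  simp only [Same, lin_neg, neg_lt_neg_iff]; tauto

lemma Same.symm {k p x y : Pt} (h : Same k p x y) : Same k p y x := by
  unfold Same at *; tauto

lemma Same.trans {k p x y z : Pt} (h : Same k p x y) (h' : Same k p y z) : Same k p x z := by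
  unfold Same at *
  rcases h with h | h <;> rcases h' with h' | h'
  · exact Or.inl ⟨h.1, h'.2⟩
  · linarith [h.2, h'.1]
  · linarith [h.2, h'.1]
  · exact Or.inr ⟨h.1, h'.2⟩

/-- `w` is tight: whenever `w` lies beyond the chord of two points `x, y` visible from `p`,
some edge of `G` at `p` runs inside the cone `x p y`. -/
def Tight (k : Pt) (S : Finset Pt) (G : Finset (Sym2 Pt)) (p w : Pt) : Prop :=
  ∀ x ∈ vis S G p, ∀ y ∈ vis S G p, Same k p x y → 0 < orient p x y → 0 < orient p x w →
    0 < orient p w y → orient x y w < 0 →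
    ∃ v, s(p, v) ∈ G ∧ 0 < orient p x v ∧ 0 < orient p v y

lemma tight_neg (k : Pt) (S : Finset Pt) (G : Finset (Sym2 Pt)) (p w : Pt) :
    Tight (-k) S G p w ↔ Tight k S G p w := by
  simp only [Tight, same_neg]

lemma PG.not_cr_of_tight {S : Finset Pt} (hS : OrientGP S) {G : Finset (Sym2 Pt)} (hG : PG S G)
    {k p w a b : Pt} (hp : p ∈ S) (ha : a ∈ S) (hb : b ∈ S) (hw : w ∈ vis S G p)
    (ht : Tight k S G p w) (hab : ∀ c d, s(c, d) ∈ G → ¬ Cr a b c d) (kw : lin k p < lin k w)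
    (ka : lin k p < lin k a) (kb : lin k p < lin k b) (haw : 0 < orient p a w) :
    ¬ Cr p w a b := by
  intro hcr
  have hpwb : 0 < orient p w b := by
    have := hcr.1
    rw [orient_swap_right p a w] at this
    by_contra! hh; nlinarith
  have gp : 0 < orient a b p ∧ orient a b w < 0 := by
    have := (hcr.os_pos one_ne_zero (σ := 1) (by simpa [os] using hpwb)).2
    simpa [os] using this
  obtain ⟨x, hx, kx, hxw, gx, hxv⟩ := hS.exists_vis_of_cr_right hG.mem hp ha hb
    one_ne_zero hcr hw hab (by simpa [os] using haw) kw ka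
  obtain ⟨y, hy, ky, hyw, gy, hyv⟩ := hS.exists_vis_of_cr_right hG.mem hp hb ha
    (neg_ne_zero.2 one_ne_zero) hcr.swap_right hw (fun c d h h' => hab c d h h'.swap_left)
    (by simpa [os, orient_swap_right p w b] using hpwb) kw kb
  replace hxv := hxv kb
  replace hyv := hyv ka
  simp only [os, one_mul, neg_mul, ← orient_swap_right] at hxw gx hxv hyw gy hyv
  rw [orient_rot] at gy
  have hxy : 0 < orient p x y := by
    have := os_pos_of_lin (σ := 1) (by simpa [os] using hxw) (by simpa [os] using hyw) kx kw ky
    simpa [os] using this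
  have hbey : orient x y w < 0 := by
    have := orient_bary p x y w a b
    by_contra! hh
    nlinarith [mul_pos hxy (neg_pos.2 gp.2), mul_nonneg hyw.le gx, mul_nonneg hxw.le gy,
      mul_nonneg hh gp.1.le]
  obtain ⟨v, hpv, h1, h2⟩ := ht x hx y hy (Or.inl ⟨kx, ky⟩) hxy hxw hyw hbey
  obtain ⟨npv, -, hv⟩ := hG.mem hpv
  obtain ⟨hwS, hwp, -⟩ := mem_vis.1 hw
  have hvw : v ≠ w := by
    rintro rfl
    exact hab p v hpv hcr.symm
  rcases lt_or_gt_of_ne (hS p hp v hv w hwS npv hwp.symm hvw) with h | h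
  · refine hyv v hv hpv h2 ?_
    rw [orient_swap_right]; linarith
  · exact hxv v hv hpv h1 h

/-- The pairs `(p, w)` where `w` is a tight visible point on the right of `p`. -/
def tightPairs (k : Pt) (S : Finset Pt) (G : Finset (Sym2 Pt)) : Finset (Pt × Pt) :=
  (S ×ˢ S).filter fun e => lin k e.1 < lin k e.2 ∧ e.2 ∈ vis S G e.1 ∧ Tight k S G e.1 e.2

lemma PG.tightPairs_not_cr {S : Finset Pt} (hS : OrientGP S) {G : Finset (Sym2 Pt)} (hG : PG S G)
    {k : Pt} (hk : ∀ a ∈ S, ∀ b ∈ S, lin k a = lin k b → a = b) {p w a b : Pt}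
    (h1 : (p, w) ∈ tightPairs k S G) (h2 : (a, b) ∈ tightPairs k S G) : ¬ Cr p w a b := by
  intro hcr
  have key : ∀ p w a b, (p, w) ∈ tightPairs k S G → (a, b) ∈ tightPairs k S G → Cr p w a b →
      lin k p < lin k a → False := by
    intro p w a b h1 h2 hcr hpa
    simp only [tightPairs, Finset.mem_filter, Finset.mem_product] at h1 h2
    obtain ⟨⟨hp, hw⟩, kw, hwv, ht⟩ := h1
    obtain ⟨⟨ha, hb⟩, kb, hbv, -⟩ := h2
    have hab : ∀ c d, s(c, d) ∈ G → ¬ Cr a b c d := (mem_vis.1 hbv).2.2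
    have h := hcr.1
    rcases lt_trichotomy (orient p w a) 0 with h3 | h3 | h3
    · exact hG.not_cr_of_tight hS hp ha hb hwv ht hab kw hpa (hpa.trans kb)
        (by rw [orient_swap_right]; linarith) hcr
    · rw [h3] at h; simp at h
    · exact hG.not_cr_of_tight hS hp hb ha hwv ht (fun c d h h' => hab c d h h'.swap_left) kw
        (hpa.trans kb) hpa (by rw [orient_swap_right]; by_contra! hh; nlinarith) hcr.swap_right
  have hp : p ∈ S := by simp [tightPairs] at h1; tauto
  have ha : a ∈ S := by simp [tightPairs] at h2; tauto
  rcases lt_trichotomy (lin k p) (lin k a) with h | h | h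
  · exact key p w a b h1 h2 hcr h
  · exact hcr.fst_ne.1 (hk p hp a ha h)
  · exact key a b p w h2 h1 hcr.symm h

/-- Every point that is not extreme in direction `k` sees some point on its right. -/
lemma PG.exists_vis_right {S : Finset Pt} (hS : OrientGP S) {G : Finset (Sym2 Pt)} (hG : PG S G)
    {k p q : Pt} (hp : p ∈ S) (hq : q ∈ S) (hpq : lin k p < lin k q) :
    ∃ w ∈ vis S G p, lin k p < lin k w := by
  suffices H : ∀ G' ⊆ G, ∃ w ∈ vis S G' p, lin k p < lin k w from H G subset_rfl
  intro G' hG'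
  induction G' using Finset.induction_on with
  | empty => exact ⟨q, mem_vis.2 ⟨hq, by rintro rfl; simp at hpq, by simp⟩, hpq⟩
  | insert e H _ ih =>
    have hH : H ⊆ G := (Finset.subset_insert e H).trans hG'
    have he : e ∈ G := hG' (Finset.mem_insert_self e H)
    obtain ⟨w, hw, kw⟩ := ih hH
    obtain ⟨hwS, hwp, hwH⟩ := mem_vis.1 hw
    have hmem : ∀ {a b}, s(a, b) ∈ H → a ≠ b ∧ a ∈ S ∧ b ∈ S := fun h => hG.mem (hH h)
    have key : ∀ a b, s(a, b) = e → Cr p w a b → lin k p < lin k a →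
        ∃ w ∈ vis S (insert e H) p, lin k p < lin k w := by
      intro a b hab hcr ka
      rw [← hab] at he
      obtain ⟨nab, ha, hb⟩ := hG.mem he
      have hσ : orient p a w ≠ 0 := by
        intro h0
        have := hcr.1
        rw [orient_swap_right p a w, h0] at this; simp at this
      have haw : 0 < os (orient p a w) p a w := mul_self_pos.2 hσ
      obtain ⟨x, hx, kx, hxw, gx, -⟩ := hS.exists_vis_of_cr_right hmem hp ha hb hσ hcr hw
        (fun c d h => hG.not_cr he (hH h)) haw kw ka
      have hpwb : 0 < os (orient p a w) p w b := by
        have := hcr.os_left hσ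
        rw [os_swap_right _ p a w] at this
        by_contra! hh; nlinarith
      obtain ⟨-, gp, -⟩ := hcr.os_pos hσ hpwb
      obtain ⟨hxS, hxp, hxH⟩ := mem_vis.1 hx
      refine ⟨x, mem_vis.2 ⟨hxS, hxp, ?_⟩, kx⟩
      have hno : ¬ Cr p x a b := by
        intro h
        have := h.os_right hσ
        nlinarith [mul_nonneg gp.le gx]
      intro c d hcd
      rcases Finset.mem_insert.1 hcd with h | h
      · rw [← hab] at h
        rcases Sym2.eq_iff.1 h with ⟨rfl, rfl⟩ | ⟨rfl, rfl⟩
        · exact hno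
        · exact fun h => hno h.swap_right
      · exact hxH c d h
    by_cases hc : ∃ a b, s(a, b) = e ∧ Cr p w a b
    · obtain ⟨a, b, hab, hcr⟩ := hc
      by_cases ka : lin k p < lin k a
      · exact key a b hab hcr ka
      · refine key b a (by rw [Sym2.eq_swap, hab]) hcr.swap_right ?_
        obtain ⟨t, r, t0, t1, r0, r1, he⟩ := hcr.exists_seg
        have := congrArg (lin k) he
        rw [lin_seg, lin_seg] at this
        by_contra! hh
        nlinarith
    · push Not at hc
      refine ⟨w, mem_vis.2 ⟨hwS, hwp, ?_⟩, kw⟩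
      intro c d hcd
      rcases Finset.mem_insert.1 hcd with h | h
      · exact hc c d h
      · exact hwH c d h

/-- Two segments that are both cut by two lines in direction `k` and swap their order in between
cross. The second line passes through `m`, which separates the two segments there. -/
lemma cr_of_strip {σ : ℝ} (hσ : σ ≠ 0) {k A B c d m : Pt} (h1 : lin k A < lin k c)
    (h2 : lin k c < lin k m) (h3 : lin k m ≤ lin k B) (h4 : lin k m ≤ lin k d)
    (hc : 0 < os σ A B c) (hm : os σ A B m ≤ 0) (hm' : 0 ≤ os σ c d m)
    (hne : os σ A B m < 0 ∨ 0 < os σ c d m) : Cr A B c d := by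
  have I1 : (lin k d - lin k c) * os σ A B m = (lin k d - lin k m) * os σ A B c +
      (lin k m - lin k c) * os σ A B d + (lin k B - lin k A) * os σ c d m := by
    unfold os orient lin; ring
  have I2 : (lin k B - lin k A) * os σ c d m = (lin k B - lin k m) * os σ c d A +
      (lin k m - lin k A) * os σ c d B + (lin k d - lin k c) * os σ A B m := by
    unfold os orient lin; ring
  have I3 : 0 = (lin k B - lin k c) * os σ c d A +
      (lin k c - lin k A) * os σ c d B + (lin k d - lin k c) * os σ A B c := by
    unfold os orient lin; ring
  set g := os σ A B m
  set f := os σ c d m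
  have pos : 0 < (lin k B - lin k A) * f - (lin k d - lin k c) * g := by
    rcases hne with h | h
    · nlinarith [mul_nonneg (by linarith : 0 ≤ lin k B - lin k A) hm']
    · nlinarith [mul_nonneg (by linarith : 0 ≤ lin k d - lin k c) (neg_nonneg.2 hm)]
  have hd : os σ A B d < 0 := by
    by_contra! hh
    nlinarith [mul_nonneg (sub_nonneg.2 h4) hc.le, mul_nonneg (sub_pos.2 h2).le hh]
  have hneg : 0 < (lin k d - lin k c) * os σ A B c := mul_pos (by linarith) hc
  have hB : 0 < os σ c d B := by
    have e : (lin k B - lin k A) * (lin k m - lin k c) * os σ c d B =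
        (lin k B - lin k c) * ((lin k B - lin k A) * f - (lin k d - lin k c) * g) +
        (lin k B - lin k m) * ((lin k d - lin k c) * os σ A B c) := by
      linear_combination (-(lin k B - lin k c)) * I2 + (lin k B - lin k m) * I3
    have e1 : 0 < (lin k B - lin k A) * (lin k m - lin k c) * os σ c d B := by
      rw [e]
      have := mul_pos (by linarith : 0 < lin k B - lin k c) pos
      have := mul_nonneg (sub_nonneg.2 h3) hneg.le
      linarith
    exact pos_of_mul_pos_right e1 (mul_nonneg (by linarith) (by linarith))
  have hA : os σ c d A < 0 := by
    by_contra! hh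
    nlinarith [mul_nonneg (by linarith : 0 ≤ lin k B - lin k c) hh, mul_pos (sub_pos.2 h1) hB]
  exact cr_of_os hσ (mul_neg_of_pos_of_neg hc hd) (mul_neg_of_neg_of_pos hA hB)

section Noncrossing

variable {S : Finset Pt} {E : Finset (Pt × Pt)} {k : Pt}

/-- `m` is the leftmost point, other than `p`, of the triangle spanned by the edge `p u` and the
next edge `p v` above it. -/
structure LeftCorner (S : Finset Pt) (E : Finset (Pt × Pt)) (k p u m v : Pt) : Prop where
  mem : (p, v) ∈ E
  pos : 0 < orient p u v
  next : ∀ w, (p, w) ∈ E → 0 < orient p u w → ¬ 0 < orient p w v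
  mem_pt : m ∈ S
  right : lin k p < lin k m
  nonneg_left : 0 ≤ orient p u m
  nonneg_right : 0 ≤ orient p m v
  le_left : lin k m ≤ lin k u
  le_right : lin k m ≤ lin k v
  min : ∀ w ∈ S, w ≠ p → 0 ≤ orient p u w → 0 ≤ orient p w v → 0 ≤ orient u v w →
    lin k m ≤ lin k w
  pos_left : m ≠ u → 0 < orient p u m

lemma exists_leftCorner (hS : OrientGP S)
    (hE : ∀ p u, (p, u) ∈ E → p ∈ S ∧ u ∈ S ∧ lin k p < lin k u) {p u : Pt} (hpu : (p, u) ∈ E)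
    (hv : ∃ v, (p, v) ∈ E ∧ 0 < orient p u v) : ∃ m v, LeftCorner S E k p u m v := by
  obtain ⟨hp, hu, ku⟩ := hE p u hpu
  obtain ⟨v0, hv0, hv0'⟩ := hv
  obtain ⟨⟨p', v⟩, hvm, hmin⟩ := (E.filter fun e => e.1 = p ∧ 0 < orient p u e.2).exists_min_image
    (fun e => orient p u e.2 / (lin k e.2 - lin k p)) ⟨(p, v0), by simp [hv0, hv0']⟩
  simp only [Finset.mem_filter] at hvm hmin
  obtain ⟨hvE, rfl, hv⟩ := hvm
  obtain ⟨-, hvS, kv⟩ := hE _ _ hvE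
  obtain ⟨m, hm, hmm⟩ := (S.filter fun w => w ≠ p' ∧ 0 ≤ orient p' u w ∧ 0 ≤ orient p' w v ∧
    0 ≤ orient u v w).exists_min_image (fun w => lin k w)
    ⟨u, by
      have : u ≠ p' := by rintro rfl; exact lt_irrefl _ ku
      simp [hu, this, hv.le]⟩
  simp only [Finset.mem_filter] at hm hmm
  obtain ⟨hmS, hmp, hm1, hm2, hm3⟩ := hm
  have hmu : lin k m ≤ lin k u := hmm u ⟨hu, by rintro rfl; exact lt_irrefl _ ku, by simp,
    hv.le, by simp⟩
  have hmv : lin k m ≤ lin k v := hmm v ⟨hvS, by rintro rfl; exact lt_irrefl _ kv, hv.le, by simp,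
    by simp⟩
  have hleft : m ≠ u → 0 < orient p' u m := fun hne =>
    lt_of_le_of_ne hm1 (hS p' hp u hu m hmS (by rintro rfl; exact lt_irrefl _ ku) hmp.symm
      hne.symm).symm
  refine ⟨m, v, hvE, hv, ?_, hmS, ?_, hm1, hm2, hmu, hmv, fun w h1 h2 h3 h4 h5 =>
    hmm w ⟨h1, h2, h3, h4, h5⟩, hleft⟩
  · intro w hw h1 h2
    obtain ⟨-, -, kw⟩ := hE _ _ hw
    have := hmin (p', w) ⟨hw, rfl, h1⟩
    simp only at this
    rw [div_le_div_iff₀ (sub_pos.2 kv) (sub_pos.2 kw)] at this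
    have e := orient_mul_lin k p' u w v
    nlinarith [mul_pos h2 (sub_pos.2 ku)]
  · have e := orient_mul_lin k p' u m v
    by_cases hmu : m = u
    · rwa [hmu]
    · have := hleft hmu
      by_contra! hh
      nlinarith [mul_pos this (sub_pos.2 kv), mul_nonneg hm2 (sub_pos.2 ku).le]

lemma LeftCorner.above_or_below
    (hE : ∀ p u, (p, u) ∈ E → p ∈ S ∧ u ∈ S ∧ lin k p < lin k u) {P U m V p : Pt}
    (hPU : (P, U) ∈ E) (h : LeftCorner S E k P U m V) (hp : p ∈ S) (h1 : lin k P < lin k p)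
    (h2 : lin k p < lin k m) : orient P U p < 0 ∨ 0 < orient P V p := by
  obtain ⟨hP, hU, kU⟩ := hE _ _ hPU
  obtain ⟨-, hV, kV⟩ := hE _ _ h.mem
  by_contra! hh
  have h3 : 0 ≤ orient P p V := by rw [orient_swap_right]; linarith
  have h4 : 0 ≤ orient U V p := by
    have e : orient U V p * (lin k P - lin k p) + orient P p V * (lin k U - lin k p) +
        orient P U p * (lin k V - lin k p) = 0 := by
      unfold orient lin; ring
    have := h.le_left
    have := h.le_right
    by_contra! h5
    nlinarith [mul_nonneg h3 (by linarith : 0 ≤ lin k U - lin k p),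
      mul_nonneg hh.1 (by linarith : 0 ≤ lin k V - lin k p)]
  have := h.min p hp (by rintro rfl; exact lt_irrefl _ h1) hh.1 h3 h4
  linarith

lemma LeftCorner.eq_of_eq
    (hE : ∀ p u, (p, u) ∈ E → p ∈ S ∧ u ∈ S ∧ lin k p < lin k u)
    (hcr : ∀ p u q v, (p, u) ∈ E → (q, v) ∈ E → ¬ Cr p u q v) {P U V p u v m : Pt}
    (hPU : (P, U) ∈ E) (hpu : (p, u) ∈ E) (H : LeftCorner S E k P U m V)
    (h : LeftCorner S E k p u m v) (hflag : m = U ↔ m = u) : ¬ lin k P < lin k p := by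
  intro hlt
  obtain ⟨hP, hU, kU⟩ := hE _ _ hPU
  obtain ⟨hp, hu, ku⟩ := hE _ _ hpu
  rcases H.above_or_below hE hPU hp hlt h.right with hb | ha
  · refine hcr P U p v hPU h.mem (cr_of_strip (σ := -1) (by norm_num) hlt h.right H.le_left
      h.le_right ?_ ?_ ?_ ?_)
    · simpa [os] using hb
    · simpa [os] using H.nonneg_left
    · simpa [os, ← orient_swap_right] using h.nonneg_right
    · by_cases hm : m = U
      · right
        have hmu := hflag.1 hm
        have := h.pos
        simpa [os, ← orient_swap_right, hmu] using this
      · left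
        simpa [os] using H.pos_left hm
  · refine hcr P V p u H.mem hpu (cr_of_strip (σ := 1) (by norm_num) hlt h.right H.le_right
      h.le_left ?_ ?_ ?_ ?_)
    · simpa [os] using ha
    · have := H.nonneg_right
      rw [orient_swap_right] at this
      simpa [os] using this
    · simpa [os] using h.nonneg_left
    · by_cases hm : m = u
      · left
        have hmU := hflag.2 hm
        have := H.pos
        rw [← hmU, orient_swap_right] at this
        simpa [os] using this
      · right
        simpa [os] using h.pos_left hm

lemma LeftCorner.not_above
    (hE : ∀ p u, (p, u) ∈ E → p ∈ S ∧ u ∈ S ∧ lin k p < lin k u) {U V p u v m : Pt}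
    (hPU : (p, U) ∈ E) (H : LeftCorner S E k p U m V)
    (h : LeftCorner S E k p u m v) (hflag : m = U ↔ m = u) : ¬ 0 < orient p u U := by
  intro hpos
  by_cases hm : m = u
  · have hmU := hflag.2 hm
    rw [← hm, ← hmU] at hpos
    simp at hpos
  · have hmU : m ≠ U := fun h => hm (hflag.1 h)
    have h1 := H.pos_left hmU
    refine h.next U hPU hpos ?_
    obtain ⟨-, -, kU⟩ := hE _ _ hPU
    obtain ⟨-, -, kv⟩ := hE _ _ h.mem
    have e := orient_mul_lin k p U m v
    have := h.right
    have := h.nonneg_right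
    by_contra! hh
    nlinarith [mul_pos h1 (sub_pos.2 kv), mul_nonneg this (sub_pos.2 kU).le]

/-- A plane straight-line graph on `S` has at most `3 |S|` edges. -/
lemma card_le_of_noncrossing (hS : OrientGP S) (hk : ∀ a ∈ S, ∀ b ∈ S, lin k a = lin k b → a = b)
    (hE : ∀ p u, (p, u) ∈ E → p ∈ S ∧ u ∈ S ∧ lin k p < lin k u)
    (hcr : ∀ p u q v, (p, u) ∈ E → (q, v) ∈ E → ¬ Cr p u q v) : E.card ≤ 3 * S.card := by
  have hne : ∀ p u, (p, u) ∈ E → p ≠ u := by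
    intro p u h; rintro rfl; exact lt_irrefl _ (hE _ _ h).2.2
  set up : Pt × Pt → Prop := fun e => ∃ v, (e.1, v) ∈ E ∧ 0 < orient e.1 e.2 v with hup
  have h1 : (E.filter fun e => ¬ up e).card ≤ S.card := by
    refine Finset.card_le_card_of_injOn Prod.fst ?_ ?_
    · rintro ⟨p, u⟩ he
      simp only [Finset.coe_filter, Set.mem_ofPred_eq] at he
      exact (hE p u he.1).1
    · rintro ⟨p, u⟩ he ⟨q, v⟩ hf hpq
      simp only [Finset.coe_filter, Set.mem_ofPred_eq, hup] at he hf hpq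
      subst hpq
      by_contra hne'
      have huv : u ≠ v := fun h => hne' (by rw [h])
      obtain ⟨hp, hu, -⟩ := hE _ _ he.1
      obtain ⟨-, hv, -⟩ := hE _ _ hf.1
      rcases lt_or_gt_of_ne (hS p hp u hu v hv (hne _ _ he.1) (hne _ _ hf.1) huv) with h | h
      · exact hf.2 ⟨u, he.1, by rw [orient_swap_right]; linarith⟩
      · exact he.2 ⟨v, hf.1, h⟩
  have h2 : (E.filter up).card ≤ 2 * S.card := by
    have hex : ∀ e : Pt × Pt, ∃ m, e ∈ E → up e → ∃ v, LeftCorner S E k e.1 e.2 m v := by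
      rintro ⟨p, u⟩
      by_cases h : (p, u) ∈ E ∧ up (p, u)
      · obtain ⟨m, v, hv⟩ := exists_leftCorner hS hE h.1 h.2
        exact ⟨m, fun _ _ => ⟨v, hv⟩⟩
      · exact ⟨0, fun h1 h2 => absurd ⟨h1, h2⟩ h⟩
    choose f hf using hex
    have : (S ×ˢ (Finset.univ : Finset Bool)).card = 2 * S.card := by
      rw [Finset.card_product]; simp [mul_comm]
    rw [← this]
    refine Finset.card_le_card_of_injOn (fun e => (f e, decide (f e = e.2))) ?_ ?_
    · rintro e he
      simp only [Finset.coe_filter, Set.mem_ofPred_eq] at he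
      obtain ⟨v, hv⟩ := hf e he.1 he.2
      simpa [em] using hv.mem_pt
    · rintro ⟨p, u⟩ he ⟨q, w⟩ he' heq
      simp only [Finset.coe_filter, Set.mem_ofPred_eq, Prod.mk.injEq, decide_eq_decide] at he he' heq
      obtain ⟨v, hv⟩ := hf _ he.1 he.2
      obtain ⟨v', hv'⟩ := hf _ he'.1 he'.2
      obtain ⟨heq, hfl⟩ := heq
      rw [heq] at hv hfl
      simp only at hv hv' hfl
      have hpq : p = q := hk _ (hE _ _ he.1).1 _ (hE _ _ he'.1).1
        (le_antisymm (not_lt.1 (hv'.eq_of_eq hE hcr he'.1 he.1 hv hfl.symm))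
          (not_lt.1 (hv.eq_of_eq hE hcr he.1 he'.1 hv' hfl)))
      subst hpq
      by_contra hne'
      have huv : u ≠ w := fun h => hne' (by rw [h])
      obtain ⟨hp, hu, -⟩ := hE _ _ he.1
      obtain ⟨-, hw, -⟩ := hE _ _ he'.1
      rcases lt_or_gt_of_ne (hS p hp u hu w hw (hne _ _ he.1) (hne _ _ he'.1) huv) with h | h
      · exact hv.not_above hE he.1 hv' hfl (by rw [orient_swap_right]; linarith)
      · exact hv'.not_above hE he'.1 hv hfl.symm h
  have := Finset.card_filter_add_card_filter_not (s := E) up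
  omega

end Noncrossing

section LowerHull

variable {α : Type*} {u t : α → ℝ} {V : Finset α}

/-- The point `w` lies strictly above the line through `x` and `y`. -/
def Above (u t : α → ℝ) (x y w : α) : Prop :=
  (u y - u w) * t x + (u w - u x) * t y < (u y - u x) * t w

/-- The edges of the lower convex hull of the points `(u v, t v)`, `v ∈ V`, oriented in the
direction of increasing `u`. -/
def lowerEdges (u t : α → ℝ) (V : Finset α) : Finset (α × α) :=
  (V ×ˢ V).filter fun e => u e.1 < u e.2 ∧ ∀ w ∈ V, w ≠ e.1 → w ≠ e.2 → Above u t e.1 e.2 w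

lemma mem_lowerEdges {x y : α} : (x, y) ∈ lowerEdges u t V ↔
    (x ∈ V ∧ y ∈ V) ∧ u x < u y ∧ ∀ w ∈ V, w ≠ x → w ≠ y → Above u t x y w := by
  simp [lowerEdges]

/-- The height at abscissa `m` of the line through `a` and `b`. -/
def lineAt (u t : α → ℝ) (m : ℝ) (a b : α) : ℝ :=
  ((u b - m) * t a + (m - u a) * t b) / (u b - u a)

lemma lineAt_sub {a b : α} (h : u a < u b) (m c d : ℝ) :
    lineAt u t m a b - (c * m + d) =
      ((u b - m) * (t a - (c * u a + d)) + (m - u a) * (t b - (c * u b + d))) / (u b - u a) := by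
  have : u b - u a ≠ 0 := (sub_pos.2 h).ne'
  unfold lineAt; field_simp; ring

lemma exists_line {a b : α} (h : u a < u b) :
    ∃ c d, t a = c * u a + d ∧ t b = c * u b + d := by
  have : u b - u a ≠ 0 := (sub_pos.2 h).ne'
  refine ⟨(t b - t a) / (u b - u a), t a - (t b - t a) / (u b - u a) * u a, by ring, ?_⟩
  field_simp; ring

lemma above_iff {x y w : α} (h : u x < u y) {c d : ℝ} (hx : t x = c * u x + d)
    (hy : t y = c * u y + d) : Above u t x y w ↔ c * u w + d < t w := by
  unfold Above
  rw [hx, hy, ← sub_pos, ← sub_pos (a := t w)]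
  have : (u y - u x) * t w - ((u y - u w) * (c * u x + d) + (u w - u x) * (c * u y + d)) =
    (u y - u x) * (t w - (c * u w + d)) := by ring
  rw [this]
  exact mul_pos_iff_of_pos_left (sub_pos.2 h)

lemma exists_lowerEdge
    (hgp : ∀ x ∈ V, ∀ y ∈ V, ∀ w ∈ V, u x < u y → w ≠ x → w ≠ y → ¬ Above u t x y w →
      (u y - u x) * t w < (u y - u w) * t x + (u w - u x) * t y)
    {w z : α} (hw : w ∈ V) (hz : z ∈ V) (hwz : u w < u z) :
    ∃ x y, (x, y) ∈ lowerEdges u t V ∧ u x ≤ u w ∧ u w < u y := by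
  obtain ⟨z, hz, hmin⟩ := (V.filter fun v => u w < u v).exists_min_image u ⟨z, by simp [hz, hwz]⟩
  simp only [Finset.mem_filter] at hz hmin
  set m := (u w + u z) / 2 with hm
  have hwm : u w < m := by linarith [hz.2]
  have hmz : m < u z := by linarith [hz.2]
  have hm2 : ∀ v ∈ V, u v < m ↔ u v ≤ u w := by
    intro v hv
    refine ⟨fun h => ?_, fun h => by linarith⟩
    by_contra! hh
    linarith [hmin v ⟨hv, hh⟩]
  have hm3 : ∀ v ∈ V, u v < m ∨ m < u v := by
    intro v hv
    rcases le_or_gt (u v) (u w) with h | h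
    · exact Or.inl (by linarith)
    · exact Or.inr (by linarith [hmin v ⟨hv, h⟩])
  obtain ⟨⟨x, y⟩, hxy, hL⟩ := ((V ×ˢ V).filter fun e => u e.1 < m ∧ m < u e.2).exists_min_image
    (fun e => lineAt u t m e.1 e.2) ⟨(w, z), by simp [hw, hz.1, hwm, hmz]⟩
  simp only [Finset.mem_filter, Finset.mem_product] at hxy hL
  obtain ⟨⟨hx, hy⟩, hxm, hmy⟩ := hxy
  have huxy : u x < u y := hxm.trans hmy
  refine ⟨x, y, mem_lowerEdges.2 ⟨⟨hx, hy⟩, huxy, ?_⟩, (hm2 x hx).1 hxm, hwm.trans hmy⟩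
  intro v hv hvx hvy
  by_contra hna
  obtain ⟨c, d, hcx, hcy⟩ := exists_line (t := t) huxy
  have hb := hgp x hx y hy v hv huxy hvx hvy hna
  have hb' : t v - (c * u v + d) < 0 := by
    rw [hcx, hcy] at hb
    by_contra! hh
    nlinarith [mul_nonneg (sub_pos.2 huxy).le hh]
  have h0 := lineAt_sub (t := t) huxy m c d
  rw [hcx, hcy] at h0
  simp only [sub_self, mul_zero, add_zero, zero_div] at h0
  rcases hm3 v hv with h | h
  · have h1 := hL (v, y) ⟨⟨hv, hy⟩, h, hmy⟩
    have h2 := lineAt_sub (t := t) (h.trans hmy) m c d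
    rw [hcy] at h2
    have : ((u y - m) * (t v - (c * u v + d)) + (m - u v) * (c * u y + d - (c * u y + d))) /
        (u y - u v) < 0 := by
      apply div_neg_of_neg_of_pos _ (by linarith)
      rw [sub_self, mul_zero, add_zero]
      exact mul_neg_of_pos_of_neg (by linarith) hb'
    simp only at h1
    linarith
  · have h1 := hL (x, v) ⟨⟨hx, hv⟩, hxm, h⟩
    have h2 := lineAt_sub (t := t) (hxm.trans h) m c d
    rw [hcx] at h2
    have : ((u v - m) * (c * u x + d - (c * u x + d)) + (m - u x) * (t v - (c * u v + d))) /
        (u v - u x) < 0 := by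
      apply div_neg_of_neg_of_pos _ (by linarith)
      rw [sub_self, mul_zero, zero_add]
      exact mul_neg_of_pos_of_neg (by linarith) hb'
    simp only at h1
    linarith

lemma lowerEdge_unique {x y x' y' : α} {m : ℝ}
    (h : (x, y) ∈ lowerEdges u t V) (h' : (x', y') ∈ lowerEdges u t V) (h1 : u x ≤ m)
    (h2 : m < u y) (h1' : u x' ≤ m) (h2' : m < u y') : x = x' ∧ y = y' := by
  obtain ⟨⟨hx, hy⟩, huxy, hab⟩ := mem_lowerEdges.1 h
  obtain ⟨⟨hx', hy'⟩, huxy', hab'⟩ := mem_lowerEdges.1 h'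
  -- compare the two lines just to the right of `m`
  obtain ⟨n, hn, hny, hny'⟩ : ∃ n, m < n ∧ n < u y ∧ n < u y' := by
    obtain ⟨n, h3, h4⟩ := exists_between (lt_min h2 h2')
    exact ⟨n, h3, (lt_min_iff.1 h4).1, (lt_min_iff.1 h4).2⟩
  have key : ∀ x y x' y', x' ∈ V → y' ∈ V → u x < u y → u x' < n → n < u y' → u x < n → n < u y →
      (∀ w ∈ V, w ≠ x → w ≠ y → Above u t x y w) →
      lineAt u t n x y ≤ lineAt u t n x' y' ∧
        (¬ (x = x' ∧ y = y') → lineAt u t n x y < lineAt u t n x' y') := by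
    clear * -
    intro x y x' y' hx' hy' huxy h1 h2 h3 h4 hab
    obtain ⟨c, d, hcx, hcy⟩ := exists_line (t := t) huxy
    have h0 := lineAt_sub (t := t) huxy n c d
    rw [hcx, hcy] at h0
    simp only [sub_self, mul_zero, add_zero, zero_div] at h0
    have g := lineAt_sub (t := t) (h1.trans h2) n c d
    have hge : ∀ w ∈ V, 0 ≤ t w - (c * u w + d) ∧ (w ≠ x → w ≠ y → 0 < t w - (c * u w + d)) := by
      intro w hw
      by_cases hwx : w = x
      · subst hwx; simp [hcx]
      by_cases hwy : w = y
      · subst hwy; simp [hcy]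
      have := (above_iff huxy hcx hcy).1 (hab w hw hwx hwy)
      exact ⟨by linarith, fun _ _ => by linarith⟩
    have d0 : 0 < u y' - u x' := by linarith
    have g1 := hge x' hx'
    have g2 := hge y' hy'
    constructor
    · have : 0 ≤ lineAt u t n x' y' - (c * n + d) := by
        rw [g]
        exact div_nonneg (add_nonneg (mul_nonneg (by linarith) g1.1)
          (mul_nonneg (by linarith) g2.1)) d0.le
      linarith
    · intro hne
      have : 0 < lineAt u t n x' y' - (c * n + d) := by
        rw [g]
        apply div_pos _ d0
        by_cases hx : x = x'
        · have : 0 < t y' - (c * u y' + d) := by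
            refine g2.2 ?_ fun h => hne ⟨hx, h.symm⟩
            rintro rfl; linarith
          exact add_pos_of_nonneg_of_pos (mul_nonneg (by linarith) g1.1)
            (mul_pos (by linarith) this)
        · have : 0 < t x' - (c * u x' + d) := by
            refine g1.2 (Ne.symm hx) ?_
            rintro rfl; linarith
          exact add_pos_of_pos_of_nonneg (mul_pos (by linarith) this)
            (mul_nonneg (by linarith) g2.1)
      linarith
  by_contra hne
  have a1 := (key x y x' y' hx' hy' huxy (by linarith) hny' (by linarith) hny hab).2 hne
  have a2 := (key x' y' x y hx hy huxy' (by linarith) hny (by linarith) hny' hab').1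
  linarith

lemma card_lowerEdges
    (hgp : ∀ x ∈ V, ∀ y ∈ V, ∀ w ∈ V, u x < u y → w ≠ x → w ≠ y → ¬ Above u t x y w →
      (u y - u x) * t w < (u y - u w) * t x + (u w - u x) * t y)
    (hu : ∀ x ∈ V, ∀ y ∈ V, u x = u y → x = y) (hV : V.Nonempty) :
    V.card = 1 + (lowerEdges u t V).card +
      ∑ e ∈ lowerEdges u t V, (V.filter fun w => u e.1 < u w ∧ u w < u e.2).card := by
  obtain ⟨z, hz, hmax⟩ := V.exists_max_image u hV
  have hlt : ∀ w ∈ V.erase z, u w < u z := by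
    intro w hw
    obtain ⟨h1, h2⟩ := Finset.mem_erase.1 hw
    exact lt_of_le_of_ne (hmax w h2) fun h => h1 (hu w h2 z hz h)
  have hun : V.erase z = (lowerEdges u t V).biUnion fun e =>
      insert e.1 (V.filter fun w => u e.1 < u w ∧ u w < u e.2) := by
    ext w
    simp only [Finset.mem_biUnion, Finset.mem_insert, Finset.mem_filter]
    constructor
    · intro hw
      obtain ⟨x, y, he, h1, h2⟩ := exists_lowerEdge hgp (Finset.mem_of_mem_erase hw) hz (hlt w hw)
      refine ⟨(x, y), he, ?_⟩
      rcases h1.lt_or_eq with h1 | h1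
      · exact Or.inr ⟨Finset.mem_of_mem_erase hw, h1, h2⟩
      · exact Or.inl (hu _ (mem_lowerEdges.1 he).1.1 _ (Finset.mem_of_mem_erase hw) h1).symm
    · rintro ⟨⟨x, y⟩, he, h⟩
      obtain ⟨⟨hx, hy⟩, huxy, -⟩ := mem_lowerEdges.1 he
      rcases h with rfl | ⟨hw, h1, h2⟩
      · exact Finset.mem_erase.2 ⟨fun h => absurd (hmax y hy) (by rw [← h]; simpa using huxy), hx⟩
      · exact Finset.mem_erase.2 ⟨fun h => absurd (hmax y hy) (by rw [← h]; simpa using h2), hw⟩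
  have hcard : (V.erase z).card =
      ∑ e ∈ lowerEdges u t V, ((V.filter fun w => u e.1 < u w ∧ u w < u e.2).card + 1) := by
    rw [hun, Finset.card_biUnion]
    · refine Finset.sum_congr rfl fun e _ => Finset.card_insert_of_notMem (by simp)
    · rintro ⟨x, y⟩ he ⟨x', y'⟩ he' hne
      rw [Function.onFun, Finset.disjoint_left]
      intro w hw hw'
      have hm : ∀ x y, (x, y) ∈ lowerEdges u t V →
          w ∈ insert x (V.filter fun w => u x < u w ∧ u w < u y) → u x ≤ u w ∧ u w < u y := by
        intro x y he hw
        rcases Finset.mem_insert.1 hw with rfl | hw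
        · exact ⟨le_rfl, (mem_lowerEdges.1 he).2.1⟩
        · exact ⟨(Finset.mem_filter.1 hw).2.1.le, (Finset.mem_filter.1 hw).2.2⟩
      have h1 := hm x y he hw
      have h2 := hm x' y' he' hw'
      obtain ⟨rfl, rfl⟩ := lowerEdge_unique he he' h1.1 h1.2 h2.1 h2.2
      exact hne rfl
  rw [Finset.sum_add_distrib, Finset.sum_const, smul_eq_mul, mul_one] at hcard
  have := Finset.card_erase_add_one hz
  omega

/-- The starting points of the lower edges, and the point of largest `u`, lie below all other
chords. -/
lemma exists_lowerVertices (hV : V.Nonempty) :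
    ∃ T ⊆ V, T.card = (lowerEdges u t V).card + 1 ∧
      ∀ w ∈ T, ∀ x ∈ V, ∀ y ∈ V, u x < u w → u w < u y → ¬ Above u t x y w := by
  obtain ⟨z, hz, hmax⟩ := V.exists_max_image u hV
  have hz' : z ∉ (lowerEdges u t V).image Prod.fst := by
    simp only [Finset.mem_image, not_exists, not_and]
    rintro ⟨x, y⟩ he rfl
    obtain ⟨⟨hx, hy⟩, huxy, -⟩ := mem_lowerEdges.1 he
    exact absurd (hmax y hy) (by simpa using huxy)
  refine ⟨insert z ((lowerEdges u t V).image Prod.fst), ?_, ?_, ?_⟩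
  · intro w hw
    rcases Finset.mem_insert.1 hw with rfl | hw
    · exact hz
    · obtain ⟨⟨x, y⟩, he, rfl⟩ := Finset.mem_image.1 hw
      exact (mem_lowerEdges.1 he).1.1
  · rw [Finset.card_insert_of_notMem hz', Finset.card_image_of_injOn]
    rintro ⟨x, y⟩ he ⟨x', y'⟩ he' heq
    simp only at heq
    subst heq
    obtain ⟨-, h⟩ := lowerEdge_unique he he' le_rfl (mem_lowerEdges.1 he).2.1 le_rfl
      (mem_lowerEdges.1 he').2.1
    rw [h]
  · intro w hw x hx y hy hxw hwy
    rcases Finset.mem_insert.1 hw with rfl | hw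
    · exact absurd (hmax y hy) (by simpa using hwy)
    · obtain ⟨⟨w, z⟩, he, rfl⟩ := Finset.mem_image.1 hw
      simp only at hxw hwy ⊢
      obtain ⟨-, huwz, hab⟩ := mem_lowerEdges.1 he
      obtain ⟨c, d, hcw, hcz⟩ := exists_line (t := t) huwz
      have hge : ∀ v ∈ V, 0 ≤ t v - (c * u v + d) := by
        intro v hv
        by_cases hvw : v = w
        · subst hvw; simp [hcw]
        by_cases hvz : v = z
        · subst hvz; simp [hcz]
        linarith [(above_iff huwz hcw hcz).1 (hab v hv hvw hvz)]
      unfold Above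
      rw [hcw]
      have h1 := mul_nonneg (sub_pos.2 hwy).le (hge x hx)
      have h2 := mul_nonneg (sub_pos.2 hxw).le (hge y hy)
      nlinarith

/-- Every end point of a lower edge lies below all other chords. -/
lemma lowerEdge_end {x y w : α} {e : α × α} (he : e ∈ lowerEdges u t V) (hw : w = e.1 ∨ w = e.2)
    (hx : x ∈ V) (hy : y ∈ V) (hxw : u x < u w) (hwy : u w < u y) : ¬ Above u t x y w := by
  obtain ⟨a, b⟩ := e
  obtain ⟨-, hab', hab⟩ := mem_lowerEdges.1 he
  obtain ⟨c, d, hca, hcb⟩ := exists_line (t := t) hab'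
  have hge : ∀ v ∈ V, 0 ≤ t v - (c * u v + d) := by
    intro v hv
    by_cases hvw : v = a
    · subst hvw; simp [hca]
    by_cases hvz : v = b
    · subst hvz; simp [hcb]
    linarith [(above_iff hab' hca hcb).1 (hab v hv hvw hvz)]
  have hcw : t w = c * u w + d := by rcases hw with rfl | rfl <;> assumption
  unfold Above
  rw [hcw]
  have h1 := mul_nonneg (sub_pos.2 hwy).le (hge x hx)
  have h2 := mul_nonneg (sub_pos.2 hxw).le (hge y hy)
  nlinarith

/-- Removing points that are not end points of lower edges does not change the lower edges. -/
lemma lowerEdges_subset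
    (hgp : ∀ x ∈ V, ∀ y ∈ V, ∀ w ∈ V, u x < u y → w ≠ x → w ≠ y → ¬ Above u t x y w →
      (u y - u x) * t w < (u y - u w) * t x + (u w - u x) * t y)
    {W : Finset α} (hW : W ⊆ V) (h : ∀ e ∈ lowerEdges u t V, e.1 ∈ W ∧ e.2 ∈ W) :
    lowerEdges u t W = lowerEdges u t V := by
  have h1 : lowerEdges u t V ⊆ lowerEdges u t W := by
    rintro ⟨x, y⟩ he
    obtain ⟨-, hxy, hab⟩ := mem_lowerEdges.1 he
    exact mem_lowerEdges.2 ⟨h _ he, hxy, fun w hw => hab w (hW hw)⟩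
  refine (Finset.Subset.antisymm h1 ?_).symm
  rintro ⟨x, y⟩ he
  obtain ⟨⟨hx, hy⟩, hxy, hab⟩ := mem_lowerEdges.1 he
  obtain ⟨x', y', he', h2, h3⟩ := exists_lowerEdge hgp (hW hx) (hW hy) hxy
  obtain ⟨rfl, rfl⟩ := lowerEdge_unique (h1 he') he h2 h3 le_rfl hxy
  exact he'

end LowerHull

/-- `p ∉ V`, the points of `V ∪ {p}` are in general position and no point of `V` lies on the line
through `p` orthogonal to `k`. -/
structure LocalGP (k p : Pt) (V : Finset Pt) : Prop where
  gp : ∀ x ∈ V, ∀ y ∈ V, x ≠ y → orient p x y ≠ 0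
  gp' : ∀ x ∈ V, ∀ y ∈ V, ∀ w ∈ V, x ≠ y → x ≠ w → y ≠ w → orient x y w ≠ 0
  lin_ne : ∀ w ∈ V, lin k w ≠ lin k p

lemma LocalGP.mono {k p : Pt} {V W : Finset Pt} (h : LocalGP k p V) (hW : W ⊆ V) :
    LocalGP k p W where
  gp := fun x hx y hy => h.gp x (hW hx) y (hW hy)
  gp' := fun x hx y hy w hw => h.gp' x (hW hx) y (hW hy) w (hW hw)
  lin_ne := fun w hw => h.lin_ne w (hW hw)

lemma LocalGP.neg {k p : Pt} {V : Finset Pt} (h : LocalGP k p V) : LocalGP (-k) p V where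
  gp := h.gp
  gp' := h.gp'
  lin_ne := fun w hw => by rw [lin_neg, lin_neg]; exact fun e => h.lin_ne w hw (neg_injective e)

/-- The slope of the ray from `p` to `v` with respect to `k`. -/
def slopeOf (k p v : Pt) : ℝ := (k.1 * (v.2 - p.2) - k.2 * (v.1 - p.1)) / (lin k v - lin k p)

/-- The negative inverse distance of `v` from `p` in direction `k`. -/
def depthOf (k p v : Pt) : ℝ := -1 / (lin k v - lin k p)

lemma sq_pos_of_lin_lt {k p x : Pt} (hx : lin k p < lin k x) : 0 < k.1 ^ 2 + k.2 ^ 2 := by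
  by_contra! h
  have h1 : k.1 = 0 := by nlinarith [sq_nonneg k.1, sq_nonneg k.2]
  have h2 : k.2 = 0 := by nlinarith [sq_nonneg k.1, sq_nonneg k.2]
  simp [lin, h1, h2] at hx

lemma slopeOf_lt_iff {k p x y : Pt} (hx : lin k p < lin k x) (hy : lin k p < lin k y) :
    slopeOf k p x < slopeOf k p y ↔ 0 < orient p x y := by
  have hk := sq_pos_of_lin_lt hx
  have hx' := sub_pos.2 hx
  have hy' := sub_pos.2 hy
  have : slopeOf k p y - slopeOf k p x = orient p x y *
      ((k.1 ^ 2 + k.2 ^ 2) / ((lin k x - lin k p) * (lin k y - lin k p))) := by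
    unfold slopeOf
    rw [div_sub_div _ _ hy'.ne' hx'.ne', ← mul_div_assoc, mul_comm (lin k x - _)]
    congr 1
    unfold lin orient; ring
  rw [← sub_pos, this]
  exact mul_pos_iff_of_pos_right (div_pos hk (mul_pos hx' hy'))

lemma above_sub {k p x y w : Pt} (hx : lin k p < lin k x) (hy : lin k p < lin k y)
    (hw : lin k p < lin k w) :
    (slopeOf k p y - slopeOf k p w) * depthOf k p x +
        (slopeOf k p w - slopeOf k p x) * depthOf k p y -
        (slopeOf k p y - slopeOf k p x) * depthOf k p w =
      orient x y w * ((k.1 ^ 2 + k.2 ^ 2) /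
        ((lin k x - lin k p) * (lin k y - lin k p) * (lin k w - lin k p))) := by
  have hx' := (sub_pos.2 hx).ne'
  have hy' := (sub_pos.2 hy).ne'
  have hw' := (sub_pos.2 hw).ne'
  have e : orient x y w * (k.1 ^ 2 + k.2 ^ 2) =
      (lin k x - lin k p) * (k.1 * (y.2 - p.2) - k.2 * (y.1 - p.1)) -
      (lin k y - lin k p) * (k.1 * (x.2 - p.2) - k.2 * (x.1 - p.1)) +
      (lin k y - lin k p) * (k.1 * (w.2 - p.2) - k.2 * (w.1 - p.1)) -
      (lin k w - lin k p) * (k.1 * (y.2 - p.2) - k.2 * (y.1 - p.1)) +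
      (lin k w - lin k p) * (k.1 * (x.2 - p.2) - k.2 * (x.1 - p.1)) -
      (lin k x - lin k p) * (k.1 * (w.2 - p.2) - k.2 * (w.1 - p.1)) := by
    unfold orient lin; ring
  rw [← mul_div_assoc, e]
  unfold slopeOf depthOf
  generalize lin k x - lin k p = A at *
  generalize lin k y - lin k p = B at *
  generalize lin k w - lin k p = C at *
  field_simp
  ring

lemma above_iff_orient {k p x y w : Pt} (hx : lin k p < lin k x) (hy : lin k p < lin k y)
    (hw : lin k p < lin k w) :
    Above (slopeOf k p) (depthOf k p) x y w ↔ orient x y w < 0 := by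
  unfold Above
  rw [← sub_neg, above_sub hx hy hw, ← neg_pos, ← neg_mul, ← neg_pos (a := orient x y w)]
  exact mul_pos_iff_of_pos_right (div_pos (sq_pos_of_lin_lt hx)
    (mul_pos (mul_pos (sub_pos.2 hx) (sub_pos.2 hy)) (sub_pos.2 hw)))

/-- The points of `V` on the right of `p`. -/
def rightOf (k p : Pt) (V : Finset Pt) : Finset Pt := V.filter fun w => lin k p < lin k w

lemma mem_rightOf {k p w : Pt} {V : Finset Pt} :
    w ∈ rightOf k p V ↔ w ∈ V ∧ lin k p < lin k w := by simp [rightOf]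

/-- The hull edges on the right of `p`. -/
def hullR (k p : Pt) (V : Finset Pt) : Finset (Pt × Pt) :=
  lowerEdges (slopeOf k p) (depthOf k p) (rightOf k p V)

/-- The hull edges of `V` on both sides of `p`. -/
def hull (k p : Pt) (V : Finset Pt) : Finset (Pt × Pt) := hullR k p V ∪ hullR (-k) p V

lemma mem_hullR {k p : Pt} {V : Finset Pt} {x y : Pt} : (x, y) ∈ hullR k p V ↔
    x ∈ rightOf k p V ∧ y ∈ rightOf k p V ∧ 0 < orient p x y ∧
      ∀ w ∈ rightOf k p V, w ≠ x → w ≠ y → orient x y w < 0 := by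
  unfold hullR
  rw [mem_lowerEdges, and_assoc]
  refine and_congr_right fun hx => and_congr_right fun hy => ?_
  have hx' := (mem_rightOf.1 hx).2
  have hy' := (mem_rightOf.1 hy).2
  rw [slopeOf_lt_iff hx' hy']
  refine and_congr_right fun _ => forall₂_congr fun w hw => ?_
  rw [above_iff_orient hx' hy' (mem_rightOf.1 hw).2]

lemma LocalGP.above {k p : Pt} {V : Finset Pt} (h : LocalGP k p V) :
    ∀ x ∈ rightOf k p V, ∀ y ∈ rightOf k p V, ∀ w ∈ rightOf k p V,
      slopeOf k p x < slopeOf k p y → w ≠ x → w ≠ y →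
      ¬ Above (slopeOf k p) (depthOf k p) x y w →
      (slopeOf k p y - slopeOf k p x) * depthOf k p w <
        (slopeOf k p y - slopeOf k p w) * depthOf k p x +
          (slopeOf k p w - slopeOf k p x) * depthOf k p y := by
  intro x hx y hy w hw hxy hwx hwy hna
  obtain ⟨hxV, hx⟩ := mem_rightOf.1 hx
  obtain ⟨hyV, hy⟩ := mem_rightOf.1 hy
  obtain ⟨hwV, hw⟩ := mem_rightOf.1 hw
  rw [above_iff_orient hx hy hw, not_lt] at hna
  have hne : x ≠ y := by rintro rfl; simp at hxy
  have := lt_of_le_of_ne hna (h.gp' x hxV y hyV w hwV hne hwx.symm hwy.symm).symm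
  rw [← sub_pos, above_sub hx hy hw]
  exact mul_pos this (div_pos (sq_pos_of_lin_lt hx)
    (mul_pos (mul_pos (sub_pos.2 hx) (sub_pos.2 hy)) (sub_pos.2 hw)))

lemma LocalGP.slopeOf_inj {k p : Pt} {V : Finset Pt} (h : LocalGP k p V) :
    ∀ x ∈ rightOf k p V, ∀ y ∈ rightOf k p V, slopeOf k p x = slopeOf k p y → x = y := by
  intro x hx y hy hxy
  obtain ⟨hxV, hx⟩ := mem_rightOf.1 hx
  obtain ⟨hyV, hy⟩ := mem_rightOf.1 hy
  by_contra hne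
  rcases lt_or_gt_of_ne (h.gp x hxV y hyV hne) with h1 | h1
  · have := (slopeOf_lt_iff hy hx).2 (by rw [orient_swap_right]; linarith)
    exact this.ne hxy.symm
  · exact ((slopeOf_lt_iff hx hy).2 h1).ne hxy

/-- The points of `V` in the open cone `x p y`. -/
def cone (V : Finset Pt) (p x y : Pt) : Finset Pt :=
  V.filter fun w => 0 < orient p x w ∧ 0 < orient p w y

lemma mem_cone {V : Finset Pt} {p x y w : Pt} :
    w ∈ cone V p x y ↔ w ∈ V ∧ 0 < orient p x w ∧ 0 < orient p w y := by simp [cone]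

lemma cone_right {k p x y w : Pt} (hx : lin k p < lin k x) (hy : lin k p < lin k y)
    (hxy : 0 < orient p x y) (h1 : 0 < orient p x w) (h2 : 0 < orient p w y) :
    lin k p < lin k w :=
  lt_lin_of_cone (σ := 1) (by simpa [os] using h1) (by simpa [os] using h2)
    (by simpa [os] using hxy) hx hy

lemma hullR_disjoint (k p : Pt) (V : Finset Pt) : Disjoint (hullR k p V) (hullR (-k) p V) := by
  rw [Finset.disjoint_left]
  rintro ⟨x, y⟩ h1 h2
  have h1 := (mem_rightOf.1 (mem_hullR.1 h1).1).2
  have h2 := (mem_rightOf.1 (mem_hullR.1 h2).1).2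
  rw [lin_neg, lin_neg] at h2
  linarith

lemma LocalGP.card_rightOf {k p : Pt} {V : Finset Pt} (h : LocalGP k p V)
    (hV : (rightOf k p V).Nonempty) : (rightOf k p V).card =
      1 + (hullR k p V).card + ∑ e ∈ hullR k p V, (cone V p e.1 e.2).card := by
  have := card_lowerEdges h.above h.slopeOf_inj hV
  rw [this]
  congr 1
  refine Finset.sum_congr rfl ?_
  rintro ⟨x, y⟩ he
  congr 1
  obtain ⟨hx, hy, hxy, -⟩ := mem_hullR.1 he
  ext w
  simp only [Finset.mem_filter, mem_cone, mem_rightOf]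
  have hx := (mem_rightOf.1 hx).2
  have hy := (mem_rightOf.1 hy).2
  constructor
  · rintro ⟨⟨hw, hpw⟩, h1, h2⟩
    exact ⟨hw, (slopeOf_lt_iff hx hpw).1 h1, (slopeOf_lt_iff hpw hy).1 h2⟩
  · rintro ⟨hw, h1, h2⟩
    have hpw := cone_right hx hy hxy h1 h2
    exact ⟨⟨hw, hpw⟩, (slopeOf_lt_iff hx hpw).2 h1, (slopeOf_lt_iff hpw hy).2 h2⟩

lemma LocalGP.rightOf_union {k p : Pt} {V : Finset Pt} (h : LocalGP k p V) :
    rightOf k p V ∪ rightOf (-k) p V = V := by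
  ext w
  simp only [Finset.mem_union, mem_rightOf, lin_neg, neg_lt_neg_iff]
  constructor
  · rintro (⟨h, -⟩ | ⟨h, -⟩) <;> exact h
  · intro hw
    rcases lt_or_gt_of_ne (h.lin_ne w hw) with h | h
    · exact Or.inr ⟨hw, h⟩
    · exact Or.inl ⟨hw, h⟩

lemma rightOf_disjoint (k p : Pt) (V : Finset Pt) :
    Disjoint (rightOf k p V) (rightOf (-k) p V) := by
  rw [Finset.disjoint_left]
  intro w h1 h2
  have h1 := (mem_rightOf.1 h1).2
  have h2 := (mem_rightOf.1 h2).2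
  rw [lin_neg, lin_neg] at h2
  linarith

lemma LocalGP.card_eq {k p : Pt} {V : Finset Pt} (h : LocalGP k p V)
    (hV : (rightOf k p V).Nonempty) (hV' : (rightOf (-k) p V).Nonempty) :
    V.card = 2 + (hull k p V).card + ∑ e ∈ hull k p V, (cone V p e.1 e.2).card := by
  unfold hull
  rw [Finset.sum_union (hullR_disjoint k p V), Finset.card_union_of_disjoint (hullR_disjoint k p V)]
  have h1 := h.card_rightOf hV
  have h2 := h.neg.card_rightOf hV'
  have h3 := congrArg Finset.card h.rightOf_union
  rw [Finset.card_union_of_disjoint (rightOf_disjoint k p V)] at h3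
  omega

/-- No point of `V` lies in front of `w` in the sense that `w` is beyond a chord of `V`. -/
def Front (k p : Pt) (V : Finset Pt) (w : Pt) : Prop :=
  ∀ x ∈ V, ∀ y ∈ V, Same k p x y → 0 < orient p x y → 0 < orient p x w → 0 < orient p w y →
    ¬ orient x y w < 0

lemma front_of_right {k p : Pt} {V : Finset Pt} {w : Pt} (hw : w ∈ rightOf k p V)
    (h : ∀ x ∈ rightOf k p V, ∀ y ∈ rightOf k p V, slopeOf k p x < slopeOf k p w →
      slopeOf k p w < slopeOf k p y → ¬ Above (slopeOf k p) (depthOf k p) x y w) :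
    Front k p V w := by
  intro x hx y hy hs hxy h1 h2
  have hpw := (mem_rightOf.1 hw).2
  rcases hs with ⟨hx', hy'⟩ | ⟨hx', hy'⟩
  · rw [← above_iff_orient hx' hy' hpw]
    exact h x (mem_rightOf.2 ⟨hx, hx'⟩) y (mem_rightOf.2 ⟨hy, hy'⟩)
      ((slopeOf_lt_iff hx' hpw).2 h1) ((slopeOf_lt_iff hpw hy').2 h2)
  · have := cone_right (k := -k) (by simpa [lin_neg] using hx') (by simpa [lin_neg] using hy')
      hxy h1 h2
    rw [lin_neg, lin_neg] at this
    linarith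

lemma front_neg {k p : Pt} {V : Finset Pt} {w : Pt} : Front (-k) p V w ↔ Front k p V w := by
  simp only [Front, same_neg]

lemma exists_front {k p : Pt} {V : Finset Pt} (hV : (rightOf k p V).Nonempty)
    (hV' : (rightOf (-k) p V).Nonempty) :
    ∃ T ⊆ V, T.card = (hull k p V).card + 2 ∧ ∀ w ∈ T, Front k p V w := by
  obtain ⟨T, hT, hc, hf⟩ :=
    exists_lowerVertices (u := slopeOf k p) (t := depthOf k p) hV
  obtain ⟨T', hT', hc', hf'⟩ :=
    exists_lowerVertices (u := slopeOf (-k) p) (t := depthOf (-k) p) hV'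
  refine ⟨T ∪ T', Finset.union_subset (hT.trans (Finset.filter_subset _ _))
    (hT'.trans (Finset.filter_subset _ _)), ?_, ?_⟩
  · rw [Finset.card_union_of_disjoint ((rightOf_disjoint k p V).mono hT hT')]
    unfold hull
    rw [Finset.card_union_of_disjoint (hullR_disjoint k p V)]
    unfold hullR
    omega
  · intro w hw
    rcases Finset.mem_union.1 hw with hw | hw
    · exact front_of_right (hT hw) (hf w hw)
    · exact front_neg.1 (front_of_right (hT' hw) (hf' w hw))

lemma hull_end {k p : Pt} {V : Finset Pt} {e : Pt × Pt} (he : e ∈ hull k p V) :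
    (e.1 ∈ V ∧ e.2 ∈ V) ∧ Same k p e.1 e.2 ∧ 0 < orient p e.1 e.2 ∧
      Front k p V e.1 ∧ Front k p V e.2 ∧
      ∀ w ∈ V, Same k p e.1 w → w ≠ e.1 → w ≠ e.2 → orient e.1 e.2 w < 0 := by
  have key : ∀ k, e ∈ hullR k p V → (e.1 ∈ V ∧ e.2 ∈ V) ∧ Same k p e.1 e.2 ∧
      0 < orient p e.1 e.2 ∧ Front k p V e.1 ∧ Front k p V e.2 ∧
      ∀ w ∈ V, Same k p e.1 w → w ≠ e.1 → w ≠ e.2 → orient e.1 e.2 w < 0 := by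
    intro k he
    obtain ⟨x, y⟩ := e
    obtain ⟨hx, hy, hxy, hab⟩ := mem_hullR.1 he
    obtain ⟨hxV, hx'⟩ := mem_rightOf.1 hx
    obtain ⟨hyV, hy'⟩ := mem_rightOf.1 hy
    refine ⟨⟨hxV, hyV⟩, Or.inl ⟨hx', hy'⟩, hxy, ?_, ?_, ?_⟩
    · exact front_of_right hx fun a ha b hb => lowerEdge_end he (Or.inl rfl) ha hb
    · exact front_of_right hy fun a ha b hb => lowerEdge_end he (Or.inr rfl) ha hb
    · intro w hw hs
      refine hab w (mem_rightOf.2 ⟨hw, ?_⟩)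
      rcases hs with hs | hs
      · exact hs.2
      · linarith [hs.1]
  rcases Finset.mem_union.1 he with he | he
  · exact key k he
  · have := key (-k) he
    simpa only [same_neg, front_neg] using this

lemma mem_hull_iff {k p : Pt} {V : Finset Pt} {x y : Pt} : (x, y) ∈ hull k p V ↔
    (x ∈ V ∧ y ∈ V) ∧ Same k p x y ∧ 0 < orient p x y ∧
      ∀ w ∈ V, Same k p x w → w ≠ x → w ≠ y → orient x y w < 0 := by
  constructor
  · intro h
    obtain ⟨h1, h2, h3, -, -, h4⟩ := hull_end h
    exact ⟨h1, h2, h3, h4⟩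
  · rintro ⟨⟨hx, hy⟩, hs, hxy, hab⟩
    rcases hs with ⟨h1, h2⟩ | ⟨h1, h2⟩
    · refine Finset.mem_union_left _ (mem_hullR.2 ⟨mem_rightOf.2 ⟨hx, h1⟩, mem_rightOf.2 ⟨hy, h2⟩,
        hxy, fun w hw => hab w (mem_rightOf.1 hw).1 (Or.inl ⟨h1, (mem_rightOf.1 hw).2⟩)⟩)
    · rw [← neg_lt_neg_iff, ← lin_neg, ← lin_neg] at h1 h2
      refine Finset.mem_union_right _ (mem_hullR.2 ⟨mem_rightOf.2 ⟨hx, h1⟩, mem_rightOf.2 ⟨hy, h2⟩,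
        hxy, fun w hw => hab w (mem_rightOf.1 hw).1 ?_⟩)
      rw [← same_neg]
      exact Or.inl ⟨h1, (mem_rightOf.1 hw).2⟩

lemma LocalGP.hull_subset {k p : Pt} {V W : Finset Pt} (h : LocalGP k p V) (hW : W ⊆ V)
    (hend : ∀ e ∈ hull k p V, e.1 ∈ W ∧ e.2 ∈ W) : hull k p W = hull k p V := by
  have key : ∀ k, LocalGP k p V → (∀ e ∈ hullR k p V, e.1 ∈ W ∧ e.2 ∈ W) →
      hullR k p W = hullR k p V := by
    intro k h hend
    refine lowerEdges_subset h.above (Finset.filter_subset_filter _ hW) ?_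
    rintro ⟨x, y⟩ he
    obtain ⟨hx, hy, -⟩ := mem_hullR.1 he
    exact ⟨mem_rightOf.2 ⟨(hend _ he).1, (mem_rightOf.1 hx).2⟩,
      mem_rightOf.2 ⟨(hend _ he).2, (mem_rightOf.1 hy).2⟩⟩
  unfold hull
  rw [key k h fun e he => hend e (Finset.mem_union_left _ he),
    key (-k) h.neg fun e he => hend e (Finset.mem_union_right _ he)]

/-- Adding points beyond a hull edge does not change the hull edges. -/
lemma LocalGP.hull_eq_of_beyond {k p : Pt} {V W : Finset Pt} (h : LocalGP k p V) (hW : W ⊆ V)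
    {x y : Pt} (he : (x, y) ∈ hull k p W)
    (hb : ∀ w ∈ V, w ∉ W → 0 < orient p x w ∧ 0 < orient p w y ∧ orient x y w < 0) :
    hull k p V = hull k p W := by
  refine (h.hull_subset hW ?_).symm
  obtain ⟨⟨hx, hy⟩, hs, hxy, -⟩ := mem_hull_iff.1 he
  intro e he'
  obtain ⟨⟨h1, h2⟩, -, -, f1, f2, -⟩ := hull_end he'
  constructor
  · by_contra hn
    obtain ⟨g1, g2, g3⟩ := hb _ h1 hn
    exact f1 x (hW hx) y (hW hy) hs hxy g1 g2 g3
  · by_contra hn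
    obtain ⟨g1, g2, g3⟩ := hb _ h2 hn
    exact f2 x (hW hx) y (hW hy) hs hxy g1 g2 g3

/-- The open cones of two hull edges contain no common point of `V`. -/
lemma cone_disjoint {k p : Pt} {V : Finset Pt} {e f : Pt × Pt}
    (he : e ∈ hull k p V) (hf : f ∈ hull k p V) (hne : e ≠ f) :
    Disjoint (cone V p e.1 e.2) (cone V p f.1 f.2) := by
  rw [Finset.disjoint_left]
  intro w hw hw'
  obtain ⟨hwV, h1, h2⟩ := mem_cone.1 hw
  obtain ⟨-, h1', h2'⟩ := mem_cone.1 hw'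
  have key : ∀ k, e ∈ hullR k p V → f ∈ hullR k p V → False := by
    intro k he hf
    obtain ⟨x, y⟩ := e
    obtain ⟨x', y'⟩ := f
    obtain ⟨hx, hy, hxy, -⟩ := mem_hullR.1 he
    obtain ⟨hx', hy', -, -⟩ := mem_hullR.1 hf
    replace hx := (mem_rightOf.1 hx).2
    replace hy := (mem_rightOf.1 hy).2
    replace hx' := (mem_rightOf.1 hx').2
    replace hy' := (mem_rightOf.1 hy').2
    have kw := cone_right hx hy hxy h1 h2
    obtain ⟨rfl, rfl⟩ := lowerEdge_unique he hf ((slopeOf_lt_iff hx kw).2 h1).le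
      ((slopeOf_lt_iff kw hy).2 h2) ((slopeOf_lt_iff hx' kw).2 h1').le
      ((slopeOf_lt_iff kw hy').2 h2')
    exact hne rfl
  have side : ∀ k, ∀ e ∈ hullR k p V, 0 < orient p e.1 w → 0 < orient p w e.2 →
      lin k p < lin k w := by
    rintro k ⟨x, y⟩ he h1 h2
    obtain ⟨hx, hy, hxy, -⟩ := mem_hullR.1 he
    exact cone_right (mem_rightOf.1 hx).2 (mem_rightOf.1 hy).2 hxy h1 h2
  rcases Finset.mem_union.1 he with he | he <;> rcases Finset.mem_union.1 hf with hf | hf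
  · exact key k he hf
  · have a := side k e he h1 h2
    have b := side (-k) f hf h1' h2'
    rw [lin_neg, lin_neg] at b; linarith
  · have a := side (-k) e he h1 h2
    have b := side k f hf h1' h2'
    rw [lin_neg, lin_neg] at a; linarith
  · exact key (-k) he hf

/-- Tightness of `w` in terms of the set `V` of visible points and the set `X` of neighbours
of `p`. -/
def TightAt (k p : Pt) (V X : Finset Pt) (w : Pt) : Prop :=
  ∀ x ∈ V, ∀ y ∈ V, Same k p x y → 0 < orient p x y → 0 < orient p x w →
    0 < orient p w y → orient x y w < 0 → ∃ v ∈ X, 0 < orient p x v ∧ 0 < orient p v y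

lemma Front.tightAt {k p w : Pt} {V : Finset Pt} (h : Front k p V w) (X : Finset Pt) :
    TightAt k p V X w :=
  fun x hx y hy h1 h2 h3 h4 h5 => absurd h5 (h x hx y hy h1 h2 h3 h4)

lemma tightAt_of_mem {k p w : Pt} {V X : Finset Pt} (h : w ∈ X) : TightAt k p V X w :=
  fun _ _ _ _ _ _ h3 h4 _ => ⟨w, h, h3, h4⟩

/-- The total weight of the stars at `p` with neighbours in `V`. -/
def starWeight (k p : Pt) (V : Finset Pt) : ℝ :=
  ∑ X ∈ V.powerset, (1 + 6 / 5 * (6 - ((V.filter (TightAt k p V X)).card : ℝ)))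

lemma starWeight_le {k p : Pt} {V : Finset Pt} (g : Pt → ℝ)
    (hg : ∀ w ∈ V, g w * 2 ^ V.card ≤ ((V.powerset.filter fun X => TightAt k p V X w).card : ℝ)) :
    starWeight k p V ≤ 2 ^ V.card * (1 + 6 / 5 * (6 - ∑ w ∈ V, g w)) := by
  have hsw : ∑ X ∈ V.powerset, ((V.filter (TightAt k p V X)).card : ℝ) =
      ∑ w ∈ V, ((V.powerset.filter fun X => TightAt k p V X w).card : ℝ) := by
    have : ∀ (s : Finset Pt) (q : Pt → Prop), ((s.filter q).card : ℝ) =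
        ∑ w ∈ s, if q w then (1 : ℝ) else 0 := by
      intro s q; rw [Finset.sum_boole]
    have h' : ∀ (s : Finset (Finset Pt)) (q : Finset Pt → Prop), ((s.filter q).card : ℝ) =
        ∑ w ∈ s, if q w then (1 : ℝ) else 0 := by
      intro s q; rw [Finset.sum_boole]
    simp_rw [this, h']
    rw [Finset.sum_comm]
  have h2 : (∑ w ∈ V, g w) * 2 ^ V.card ≤
      ∑ X ∈ V.powerset, ((V.filter (TightAt k p V X)).card : ℝ) := by
    rw [hsw, Finset.sum_mul]
    exact Finset.sum_le_sum hg
  have h3 : starWeight k p V = 2 ^ V.card * (1 + 6 / 5 * 6) -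
      6 / 5 * ∑ X ∈ V.powerset, ((V.filter (TightAt k p V X)).card : ℝ) := by
    unfold starWeight
    rw [Finset.sum_congr rfl fun X _ => show (1 + 6 / 5 *
      (6 - ((V.filter (TightAt k p V X)).card : ℝ))) = (1 + 6 / 5 * 6) -
        6 / 5 * ((V.filter (TightAt k p V X)).card : ℝ) by ring, Finset.sum_sub_distrib,
      ← Finset.mul_sum, Finset.sum_const, Finset.card_powerset, nsmul_eq_mul]
    push_cast; rfl
  rw [h3]; nlinarith

lemma card_hitting {V J : Finset Pt} (hJ : J ⊆ V) {q : Finset Pt → Prop}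
    (hq : ∀ X ⊆ V, (∃ j ∈ J, j ∈ X) → q X) :
    (1 - (1 / 2) ^ J.card) * 2 ^ V.card ≤ ((V.powerset.filter q).card : ℝ) := by
  have h1 : V.powerset ⊆ V.powerset.filter q ∪ (V \ J).powerset := by
    intro X hX
    rw [Finset.mem_powerset] at hX
    rw [Finset.mem_union, Finset.mem_filter, Finset.mem_powerset, Finset.mem_powerset]
    by_cases h : ∃ j ∈ J, j ∈ X
    · exact Or.inl ⟨hX, hq X hX h⟩
    · push Not at h
      refine Or.inr fun v hv => Finset.mem_sdiff.2 ⟨hX hv, fun hj => h v hj hv⟩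
  have h2 := (Finset.card_le_card h1).trans (Finset.card_union_le _ _)
  rw [Finset.card_powerset, Finset.card_powerset] at h2
  have h3 : (2 : ℝ) ^ V.card ≤ (V.powerset.filter q).card + 2 ^ (V \ J).card := by
    exact_mod_cast h2
  have h4 : (1 / 2 : ℝ) ^ J.card * 2 ^ V.card = 2 ^ (V \ J).card := by
    rw [← Finset.card_sdiff_add_card_eq_card hJ, pow_add, mul_comm, mul_assoc, ← mul_pow]
    norm_num
  nlinarith

lemma half_le_tight {k p w : Pt} {V : Finset Pt} (hw : w ∈ V) :
    1 / 2 * 2 ^ V.card ≤ ((V.powerset.filter fun X => TightAt k p V X w).card : ℝ) := by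
  have := card_hitting (V := V) (J := {w}) (by simpa using hw)
    (q := fun X => TightAt k p V X w) (by
      rintro X - ⟨j, hj, hX⟩
      rw [Finset.mem_singleton] at hj
      subst hj
      exact tightAt_of_mem hX)
  norm_num at this ⊢
  linarith

lemma front_le_tight {k p w : Pt} {V : Finset Pt} (hw : Front k p V w) :
    1 * 2 ^ V.card ≤ ((V.powerset.filter fun X => TightAt k p V X w).card : ℝ) := by
  rw [Finset.filter_true_of_mem fun X _ => hw.tightAt X, Finset.card_powerset]
  simp

lemma starWeight_le_of_front {k p : Pt} {V T : Finset Pt} (hT : T ⊆ V)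
    (hf : ∀ w ∈ T, Front k p V w) : starWeight k p V ≤
      2 ^ V.card * (1 + 6 / 5 * (6 - (V.card + T.card) / 2)) := by
  refine (starWeight_le (fun w => if w ∈ T then 1 else 1 / 2) ?_).trans_eq ?_
  · intro w hw
    split_ifs with h
    · exact front_le_tight (hf w h)
    · exact half_le_tight hw
  · congr 4
    rw [Finset.sum_ite, Finset.filter_mem_eq_inter, Finset.inter_eq_right.2 hT,
      Finset.filter_not, Finset.filter_mem_eq_inter, Finset.inter_eq_right.2 hT]
    simp only [Finset.sum_const, nsmul_eq_mul, mul_one]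
    rw [Finset.card_sdiff_of_subset hT, Nat.cast_sub (Finset.card_le_card hT)]
    ring

lemma starWeight_le_of_front_insert {k p c : Pt} {V T J : Finset Pt} (hT : T ⊆ V)
    (hf : ∀ w ∈ T, Front k p V w) (hc : c ∈ V) (hcT : c ∉ T) (hJ : J ⊆ V)
    (hcJ : ∀ X ⊆ V, (∃ j ∈ J, j ∈ X) → TightAt k p V X c) : starWeight k p V ≤
      2 ^ V.card * (1 + 6 / 5 * (6 - ((V.card + T.card - 1) / 2 + (1 - (1 / 2) ^ J.card)))) := by
  refine (starWeight_le (fun w => (if w ∈ T then 1 else 1 / 2) +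
    if w = c then (1 / 2 - (1 / 2) ^ J.card) else 0) ?_).trans_eq ?_
  · intro w hw
    by_cases h : w = c
    · subst h
      have := card_hitting hJ hcJ
      simp only [hcT, if_false, if_true]
      calc _ = (1 - (1 / 2 : ℝ) ^ J.card) * 2 ^ V.card := by ring
        _ ≤ _ := this
    simp only [h, if_false, add_zero]
    split_ifs with h
    · exact front_le_tight (hf w h)
    · exact half_le_tight hw
  · congr 4
    rw [Finset.sum_add_distrib, Finset.sum_ite, Finset.filter_mem_eq_inter,
      Finset.inter_eq_right.2 hT, Finset.filter_not, Finset.filter_mem_eq_inter,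
      Finset.inter_eq_right.2 hT, Finset.sum_ite_eq' V c, if_pos hc]
    simp only [Finset.sum_const, nsmul_eq_mul, mul_one]
    rw [Finset.card_sdiff_of_subset hT, Nat.cast_sub (Finset.card_le_card hT)]
    ring

/-- The bound on `starWeight` in terms of the number `n` of hull edges. -/
lemma starWeight_le_of_hull {k p : Pt} {V : Finset Pt} (hV : (rightOf k p V).Nonempty)
    (hV' : (rightOf (-k) p V).Nonempty) : starWeight k p V ≤
      2 ^ V.card * (1 + 6 / 5 * (6 - (V.card + ((hull k p V).card + 2)) / 2)) := by
  obtain ⟨T, hT, hc, hf⟩ := exists_front hV hV'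
  have := starWeight_le_of_front hT hf
  rw [hc] at this
  push_cast at this
  exact this

/-- `S` is in general position, `p ∈ S` is not extreme in direction `k`, and no other point of `S`
has the same value under `k`. -/
structure Interior (k p : Pt) (S : Finset Pt) : Prop where
  gp : OrientGP S
  mem : p ∈ S
  inj : ∀ a ∈ S, lin k a = lin k p → a = p
  right : ∃ q ∈ S, lin k p < lin k q
  left : ∃ q ∈ S, lin k q < lin k p

lemma Interior.localGP {k p : Pt} {S : Finset Pt} (h : Interior k p S) (G : Finset (Sym2 Pt)) :
    LocalGP k p (vis S G p) where
  gp := fun x hx y hy hxy => h.gp p h.mem x (mem_vis.1 hx).1 y (mem_vis.1 hy).1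
    (mem_vis.1 hx).2.1.symm (mem_vis.1 hy).2.1.symm hxy
  gp' := fun x hx y hy w hw => h.gp x (mem_vis.1 hx).1 y (mem_vis.1 hy).1 w (mem_vis.1 hw).1
  lin_ne := fun w hw e => (mem_vis.1 hw).2.1 (h.inj w (mem_vis.1 hw).1 e)

lemma PG.mono_left {S T : Finset Pt} {G : Finset (Sym2 Pt)} (hG : PG S G) (h : S ⊆ T) : PG T G where
  mem := fun hab => ⟨(hG.mem hab).1, h (hG.mem hab).2.1, h (hG.mem hab).2.2⟩
  not_cr := hG.not_cr

lemma PG.mono_right {S : Finset Pt} {G H : Finset (Sym2 Pt)} (hG : PG S G) (h : H ⊆ G) : PG S H where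
  mem := fun hab => hG.mem (h hab)
  not_cr := fun h1 h2 => hG.not_cr (h h1) (h h2)

lemma Interior.right_nonempty {k p : Pt} {S : Finset Pt} (h : Interior k p S)
    {G : Finset (Sym2 Pt)} (hG : PG (S.erase p) G) : (rightOf k p (vis S G p)).Nonempty := by
  obtain ⟨q, hq, hpq⟩ := h.right
  obtain ⟨w, hw, kw⟩ := (hG.mono_left (S.erase_subset p)).exists_vis_right h.gp h.mem hq hpq
  exact ⟨w, mem_rightOf.2 ⟨hw, kw⟩⟩

lemma Interior.left_nonempty {k p : Pt} {S : Finset Pt} (h : Interior k p S)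
    {G : Finset (Sym2 Pt)} (hG : PG (S.erase p) G) : (rightOf (-k) p (vis S G p)).Nonempty := by
  obtain ⟨q, hq, hpq⟩ := h.left
  obtain ⟨w, hw, kw⟩ := (hG.mono_left (S.erase_subset p)).exists_vis_right (k := -k) h.gp h.mem hq
    (by rw [lin_neg, lin_neg]; linarith)
  exact ⟨w, mem_rightOf.2 ⟨hw, kw⟩⟩

lemma cr_chord_iff {p x y w : Pt} (hxy : 0 < orient p x y) :
    Cr p w x y ↔ 0 < orient p x w ∧ 0 < orient p w y ∧ orient x y w < 0 := by
  have h0 := orient_four p w x y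
  unfold Cr
  rw [orient_rot p x y, orient_swap_right p x w] at *
  constructor
  · rintro ⟨h1, h2⟩
    have h3 : orient x y w < 0 := by by_contra! hh; nlinarith
    refine ⟨?_, ?_, h3⟩
    · by_contra! hh; nlinarith
    · by_contra! hh; nlinarith
  · rintro ⟨h1, h2, h3⟩
    exact ⟨by nlinarith, mul_neg_of_pos_of_neg hxy h3⟩

lemma mem_vis_insert {S : Finset Pt} {G : Finset (Sym2 Pt)} {p x y w : Pt} :
    w ∈ vis S (insert s(x, y) G) p ↔ w ∈ vis S G p ∧ ¬ Cr p w x y := by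
  simp only [mem_vis, Finset.mem_insert]
  constructor
  · rintro ⟨h1, h2, h3⟩
    exact ⟨⟨h1, h2, fun a b h => h3 a b (Or.inr h)⟩, h3 x y (Or.inl rfl)⟩
  · rintro ⟨⟨h1, h2, h3⟩, h4⟩
    refine ⟨h1, h2, ?_⟩
    rintro a b (h | h)
    · rcases Sym2.eq_iff.1 h with ⟨rfl, rfl⟩ | ⟨rfl, rfl⟩
      · exact h4
      · exact fun h => h4 h.swap_right
    · exact h3 a b h

/-- A chord such that all visible points in its cone are beyond it can be added to `G`. -/
lemma PG.insert_chord {S : Finset Pt} (hS : OrientGP S) {p x y : Pt} (hp : p ∈ S)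
    {G : Finset (Sym2 Pt)} (hG : PG (S.erase p) G) (hx : x ∈ vis S G p) (hy : y ∈ vis S G p)
    (hxy : 0 < orient p x y) (hb : ∀ w ∈ cone (vis S G p) p x y, orient x y w < 0) :
    PG (S.erase p) (insert s(x, y) G) := by
  have hG' := hG.mono_left (S.erase_subset p)
  have hne : x ≠ y := by rintro rfl; simp at hxy
  have hx' := mem_vis.1 hx
  have hy' := mem_vis.1 hy
  have hxS : x ∈ S.erase p := Finset.mem_erase.2 ⟨hx'.2.1, hx'.1⟩
  have hyS : y ∈ S.erase p := Finset.mem_erase.2 ⟨hy'.2.1, hy'.1⟩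
  have hcr : ∀ c d, s(c, d) ∈ G → ¬ Cr x y c d := by
    intro c d hcd
    obtain ⟨-, hc, hd⟩ := hG.mem hcd
    exact hS.not_cr_chord hG'.mem hp hx hy hxy
      (fun v hv h1 h2 => hb v (mem_cone.2 ⟨hv, h1, h2⟩)) hcd (Finset.ne_of_mem_erase hc).symm
      (Finset.ne_of_mem_erase hd).symm
  have hcr' : ∀ a b c d, s(a, b) = s(x, y) → s(c, d) ∈ G → ¬ Cr a b c d := by
    intro a b c d hab hcd
    rcases Sym2.eq_iff.1 hab with ⟨rfl, rfl⟩ | ⟨rfl, rfl⟩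
    · exact hcr c d hcd
    · exact fun h => hcr c d hcd h.swap_left
  constructor
  · intro a b hab
    rcases Finset.mem_insert.1 hab with h | h
    · rcases Sym2.eq_iff.1 h with ⟨rfl, rfl⟩ | ⟨rfl, rfl⟩
      · exact ⟨hne, hxS, hyS⟩
      · exact ⟨hne.symm, hyS, hxS⟩
    · exact hG.mem h
  · intro a b c d hab hcd h
    rcases Finset.mem_insert.1 hab with hab | hab <;> rcases Finset.mem_insert.1 hcd with hcd | hcd
    · exact h.sym2_ne (hab.trans hcd.symm)
    · exact hcr' a b c d hab hcd h
    · exact hcr' c d a b hcd hab h.symm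
    · exact hG.not_cr hab hcd h

lemma hull_beyond {k p : Pt} {V : Finset Pt} {x y w : Pt} (he : (x, y) ∈ hull k p V)
    (hw : w ∈ cone V p x y) : orient x y w < 0 := by
  obtain ⟨⟨hx, hy⟩, hs, hxy, hab⟩ := mem_hull_iff.1 he
  obtain ⟨hwV, h1, h2⟩ := mem_cone.1 hw
  refine hab w hwV ?_ (by rintro rfl; simp at h1) (by rintro rfl; simp at h2)
  rcases hs with ⟨h3, h4⟩ | ⟨h3, h4⟩
  · exact Or.inl ⟨h3, cone_right h3 h4 hxy h1 h2⟩
  · refine Or.inr ⟨h3, ?_⟩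
    have := cone_right (k := -k) (by simpa [lin_neg] using h3) (by simpa [lin_neg] using h4)
      hxy h1 h2
    rw [lin_neg, lin_neg] at this
    linarith

lemma vis_mono {S : Finset Pt} {G H : Finset (Sym2 Pt)} (h : H ⊆ G) (p : Pt) :
    vis S G p ⊆ vis S H p := by
  intro w hw
  obtain ⟨h1, h2, h3⟩ := mem_vis.1 hw
  exact mem_vis.2 ⟨h1, h2, fun a b hab => h3 a b (h hab)⟩

lemma cr_of_mem_vis_erase {S : Finset Pt} {G : Finset (Sym2 Pt)} {p x y w : Pt}
    (hw : w ∈ vis S (G.erase s(x, y)) p) (hw' : w ∉ vis S G p) : Cr p w x y := by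
  by_contra hn
  refine hw' (vis_mono (fun e he => ?_) p (mem_vis_insert.2 ⟨hw, hn⟩))
  by_cases h : e = s(x, y)
  · exact Finset.mem_insert.2 (Or.inl h)
  · exact Finset.mem_insert_of_mem (Finset.mem_erase.2 ⟨h, he⟩)

lemma Interior.hull_insert {k p : Pt} {S : Finset Pt} (h : Interior k p S) {G : Finset (Sym2 Pt)}
    {x y : Pt} (he : (x, y) ∈ hull k p (vis S G p)) :
    hull k p (vis S (insert s(x, y) G) p) = hull k p (vis S G p) := by
  obtain ⟨⟨hx, hy⟩, hs, hxy, hab⟩ := mem_hull_iff.1 he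
  have hsub : vis S (insert s(x, y) G) p ⊆ vis S G p := vis_mono (Finset.subset_insert _ _) p
  refine ((h.localGP G).hull_eq_of_beyond hsub (x := x) (y := y) ?_ ?_).symm
  · refine mem_hull_iff.2 ⟨⟨mem_vis_insert.2 ⟨hx, fun h => h.fst_ne.2.2.1 rfl⟩,
      mem_vis_insert.2 ⟨hy, fun h => h.fst_ne.2.2.2 rfl⟩⟩, hs, hxy, fun w hw => hab w (hsub hw)⟩
  · intro w hw hw'
    rw [mem_vis_insert] at hw'
    exact (cr_chord_iff hxy).1 (by tauto)

lemma Interior.hull_erase {k p : Pt} {S : Finset Pt} (h : Interior k p S) {G : Finset (Sym2 Pt)}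
    {x y : Pt} (he : (x, y) ∈ hull k p (vis S G p)) :
    hull k p (vis S (G.erase s(x, y)) p) = hull k p (vis S G p) :=
  (h.localGP _).hull_eq_of_beyond (vis_mono (Finset.erase_subset _ _) p) he fun _ hw hw' =>
    (cr_chord_iff (mem_hull_iff.1 he).2.2.1).1 (cr_of_mem_vis_erase hw hw')

lemma Interior.insert_hull {k p : Pt} {S : Finset Pt} (h : Interior k p S) {G : Finset (Sym2 Pt)}
    (hG : PG (S.erase p) G) {x y : Pt} (he : (x, y) ∈ hull k p (vis S G p)) :
    PG (S.erase p) (insert s(x, y) G) := by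
  obtain ⟨⟨hx, hy⟩, -, hxy, -⟩ := mem_hull_iff.1 he
  exact hG.insert_chord h.gp h.mem hx hy hxy fun w hw => hull_beyond he hw

lemma cone_insert_self {k p : Pt} {S : Finset Pt} {G : Finset (Sym2 Pt)}
    {x y : Pt} (he : (x, y) ∈ hull k p (vis S G p)) :
    cone (vis S (insert s(x, y) G) p) p x y = ∅ := by
  rw [Finset.eq_empty_iff_forall_notMem]
  intro w hw
  obtain ⟨hw, h1, h2⟩ := mem_cone.1 hw
  rw [mem_vis_insert] at hw
  exact hw.2 ((cr_chord_iff (mem_hull_iff.1 he).2.2.1).2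
    ⟨h1, h2, hull_beyond he (mem_cone.2 ⟨hw.1, h1, h2⟩)⟩)

lemma cone_insert_other {k p : Pt} {S : Finset Pt} {G : Finset (Sym2 Pt)}
    {x y : Pt} {f : Pt × Pt} (he : (x, y) ∈ hull k p (vis S G p))
    (hf : f ∈ hull k p (vis S G p)) (hne : (x, y) ≠ f) :
    cone (vis S (insert s(x, y) G) p) p f.1 f.2 = cone (vis S G p) p f.1 f.2 := by
  ext w
  rw [mem_cone, mem_cone, mem_vis_insert]
  refine ⟨fun h => ⟨h.1.1, h.2⟩, fun h => ⟨⟨h.1, fun hcr => ?_⟩, h.2⟩⟩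
  obtain ⟨h1, h2, -⟩ := (cr_chord_iff (mem_hull_iff.1 he).2.2.1).1 hcr
  exact Finset.disjoint_left.1 (cone_disjoint he hf hne) (mem_cone.2 ⟨h.1, h1, h2⟩)
    (mem_cone.2 h)

lemma Interior.card_vis {k p : Pt} {S : Finset Pt} (h : Interior k p S) {G : Finset (Sym2 Pt)}
    (hG : PG (S.erase p) G) : (vis S G p).card = 2 + (hull k p (vis S G p)).card +
      ∑ e ∈ hull k p (vis S G p), (cone (vis S G p) p e.1 e.2).card :=
  (h.localGP G).card_eq (h.right_nonempty hG) (h.left_nonempty hG)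

lemma Interior.starWeight_le {k p : Pt} {S : Finset Pt} (h : Interior k p S)
    {G : Finset (Sym2 Pt)} (hG : PG (S.erase p) G) : starWeight k p (vis S G p) ≤
      2 ^ (vis S G p).card *
        (1 + 6 / 5 * (6 - ((vis S G p).card + ((hull k p (vis S G p)).card + 2)) / 2)) :=
  starWeight_le_of_hull (h.right_nonempty hG) (h.left_nonempty hG)

lemma Interior.starWeight_le_of_card_eq_zero {k p : Pt} {S : Finset Pt} (h : Interior k p S)
    {G : Finset (Sym2 Pt)} (hG : PG (S.erase p) G) (hc : (hull k p (vis S G p)).card = 0) :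
    starWeight k p (vis S G p) ≤ 163 := by
  have h1 := h.starWeight_le hG
  have h2 := h.card_vis hG
  rw [hc] at h1 h2
  rw [Finset.card_eq_zero] at hc
  rw [hc, Finset.sum_empty] at h2
  rw [h2] at h1
  norm_num at h1
  linarith

lemma Interior.starWeight_le_of_three_le {k p : Pt} {S : Finset Pt} (h : Interior k p S)
    {G : Finset (Sym2 Pt)} (hG : PG (S.erase p) G) (hc : 3 ≤ (hull k p (vis S G p)).card) :
    starWeight k p (vis S G p) ≤ 163 := by
  have h1 := h.starWeight_le hG
  have h2 := h.card_vis hG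
  refine h1.trans ?_
  generalize (vis S G p).card = K at *
  generalize (hull k p (vis S G p)).card = n at *
  have h5 : 5 ≤ K := by omega
  have hn : (3 : ℝ) ≤ n := by exact_mod_cast hc
  have h6 : (2 : ℝ) ^ K * (1 + 6 / 5 * (6 - (K + (n + 2)) / 2)) ≤ 2 ^ K * (26 / 5 - 3 / 5 * K) := by
    apply mul_le_mul_of_nonneg_left _ (by positivity)
    linarith
  refine h6.trans ?_
  by_cases h9 : 9 ≤ K
  · have : (9 : ℝ) ≤ K := by exact_mod_cast h9
    have : (2 : ℝ) ^ K * (26 / 5 - 3 / 5 * K) ≤ 0 :=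
      mul_nonpos_of_nonneg_of_nonpos (by positivity) (by linarith)
    linarith
  · interval_cases K <;> norm_num

lemma two_pow_mul_le (m : ℕ) : (2 : ℝ) ^ m * (17 / 5 - 3 / 5 * m) ≤ 16 ∧
    (6 ≤ m → (2 : ℝ) ^ m * (17 / 5 - 3 / 5 * m) ≤ 0) := by
  have h6 : 6 ≤ m → (2 : ℝ) ^ m * (17 / 5 - 3 / 5 * m) ≤ 0 := by
    intro h
    have : (6 : ℝ) ≤ m := by exact_mod_cast h
    exact mul_nonpos_of_nonneg_of_nonpos (by positivity) (by linarith)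
  refine ⟨?_, h6⟩
  by_cases h : 6 ≤ m
  · linarith [h6 h]
  · interval_cases m <;> norm_num

lemma sum_two_pow_le (a b : ℕ) : (2 : ℝ) ^ (a + b) * (17 / 5 - 3 / 5 * (a + b : ℕ)) +
    2 ^ a * (17 / 5 - 3 / 5 * a) + 2 ^ b * (17 / 5 - 3 / 5 * b) + 17 / 5 ≤ 652 / 16 := by
  by_cases h : 6 ≤ a + b
  · linarith [(two_pow_mul_le (a + b)).2 h, (two_pow_mul_le a).1, (two_pow_mul_le b).1]
  · have ha : a < 6 := by omega
    have hb : b < 6 := by omega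
    interval_cases a <;> interval_cases b <;> first | omega | norm_num

/-- The four graphs obtained by adding subsets of the two hull edges. -/
lemma Interior.sum_starWeight_two {k p : Pt} {S : Finset Pt} (h : Interior k p S)
    {G : Finset (Sym2 Pt)} (hG : PG (S.erase p) G) {x y x' y' : Pt} (hne : (x, y) ≠ (x', y'))
    (he : hull k p (vis S G p) = {(x, y), (x', y')}) :
    starWeight k p (vis S G p) + starWeight k p (vis S (insert s(x, y) G) p) +
      starWeight k p (vis S (insert s(x', y') G) p) +
      starWeight k p (vis S (insert s(x, y) (insert s(x', y') G)) p) ≤ 4 * 163 := by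
  have key : ∀ G, PG (S.erase p) G → hull k p (vis S G p) = {(x, y), (x', y')} → ∀ a b,
      (cone (vis S G p) p x y).card = a → (cone (vis S G p) p x' y').card = b →
      starWeight k p (vis S G p) ≤ 16 * (2 ^ (a + b) * (17 / 5 - 3 / 5 * (a + b : ℕ))) := by
    intro G hG he a b ha hb
    have h1 := h.starWeight_le hG
    have h2 := h.card_vis hG
    rw [he, Finset.sum_pair hne, Finset.card_pair hne] at h2
    simp only [ha, hb] at h2
    rw [he, Finset.card_pair hne, h2] at h1
    refine h1.trans_eq ?_
    push_cast
    ring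
  have m1 : (x, y) ∈ hull k p (vis S G p) := by rw [he]; simp
  have m2 : (x', y') ∈ hull k p (vis S G p) := by rw [he]; simp
  have e2 := h.hull_insert m2
  have m12 : (x, y) ∈ hull k p (vis S (insert s(x', y') G) p) := by rw [e2]; exact m1
  have m22 : (x', y') ∈ hull k p (vis S (insert s(x', y') G) p) := by rw [e2]; exact m2
  have k0 := key G hG he _ _ rfl rfl
  have k1 := key _ (h.insert_hull hG m1) ((h.hull_insert m1).trans he) 0 _
    (by rw [cone_insert_self m1, Finset.card_empty])
    (by rw [cone_insert_other m1 m2 hne])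
  have k2 := key _ (h.insert_hull hG m2) (e2.trans he) _ 0
    (by rw [cone_insert_other m2 m1 hne.symm])
    (by rw [cone_insert_self m2, Finset.card_empty])
  have k3 := key _ (h.insert_hull (h.insert_hull hG m2) m12)
    ((h.hull_insert m12).trans (e2.trans he)) 0 0
    (by rw [cone_insert_self m12, Finset.card_empty])
    (by rw [cone_insert_other m12 m22 hne, cone_insert_self m2, Finset.card_empty])
  have := sum_two_pow_le (cone (vis S G p) p x y).card (cone (vis S G p) p x' y').card
  simp only [zero_add, add_zero, pow_zero, Nat.cast_zero, mul_zero, sub_zero, one_mul] at k1 k2 k3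
  linarith

lemma Same.orient_trans {k p x w y : Pt} (h : Same k p x w) (h' : Same k p w y)
    (h1 : 0 < orient p x w) (h2 : 0 < orient p w y) : 0 < orient p x y := by
  have key : ∀ k, lin k p < lin k x → lin k p < lin k w → lin k p < lin k y →
      0 < orient p x y := fun k hx hw hy => by
    simpa [os] using os_pos_of_lin (σ := 1) (by simpa [os] using h1) (by simpa [os] using h2)
      hx hw hy
  rcases h.trans h' with ⟨hx, hy⟩ | ⟨hx, hy⟩ <;> rcases h with ⟨hx', hw⟩ | ⟨hx', hw⟩
  · exact key k hx hw hy
  · linarith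
  · linarith
  · exact key (-k) (by simpa [lin_neg] using hx) (by simpa [lin_neg] using hw)
      (by simpa [lin_neg] using hy)

lemma Same.of_cone {k p x w y : Pt} (h : Same k p x y) (hxy : 0 < orient p x y)
    (h1 : 0 < orient p x w) (h2 : 0 < orient p w y) : Same k p x w := by
  rcases h with ⟨hx, hy⟩ | ⟨hx, hy⟩
  · exact Or.inl ⟨hx, cone_right hx hy hxy h1 h2⟩
  · refine Or.inr ⟨hx, ?_⟩
    have := cone_right (k := -k) (by simpa [lin_neg] using hx) (by simpa [lin_neg] using hy)
      hxy h1 h2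
    rw [lin_neg, lin_neg] at this
    linarith

lemma LocalGP.exists_hull {k p : Pt} {V : Finset Pt} (h : LocalGP k p V) {w v : Pt}
    (hw : w ∈ V) (hv : v ∈ V) (hs : Same k p w v) (hwv : 0 < orient p w v) :
    ∃ e ∈ hull k p V, ¬ 0 < orient p w e.1 ∧ 0 < orient p w e.2 ∧ Same k p w e.1 := by
  have key : ∀ k, LocalGP k p V → lin k p < lin k w → lin k p < lin k v →
      ∃ e ∈ hullR k p V, ¬ 0 < orient p w e.1 ∧ 0 < orient p w e.2 ∧ Same k p w e.1 := by
    intro k h kw kv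
    obtain ⟨x, y, he, h1, h2⟩ := exists_lowerEdge h.above (mem_rightOf.2 ⟨hw, kw⟩)
      (mem_rightOf.2 ⟨hv, kv⟩) ((slopeOf_lt_iff kw kv).2 hwv)
    have he' := mem_hullR.1 he
    have kx := (mem_rightOf.1 he'.1).2
    refine ⟨(x, y), he, ?_, (slopeOf_lt_iff kw (mem_rightOf.1 he'.2.1).2).1 h2, Or.inl ⟨kw, kx⟩⟩
    rw [← slopeOf_lt_iff kw kx]
    exact h1.not_gt
  rcases hs with ⟨kw, kv⟩ | ⟨kw, kv⟩
  · obtain ⟨e, he, h⟩ := key k h kw kv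
    exact ⟨e, Finset.mem_union_left _ he, h⟩
  · obtain ⟨e, he, h⟩ := key (-k) h.neg (by simpa [lin_neg] using kw) (by simpa [lin_neg] using kv)
    rw [same_neg] at h
    exact ⟨e, Finset.mem_union_right _ he, h⟩

/-- The segment from `c` to `z` is the last edge of the hull of the points strictly inside the cone
spanned by `a` and `z`, together with `z`. -/
def First (V : Finset Pt) (p a z c : Pt) : Prop :=
  c ∈ cone V p a z ∧ ∀ w ∈ cone V p a z, w ≠ c → orient c z w < 0

lemma First.unique {V : Finset Pt} {p a z c c' : Pt} (h : First V p a z c)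
    (h' : First V p a z c') : c' = c := by
  by_contra hne
  have h1 := h.2 c' h'.1 hne
  have h2 := h'.2 c h.1 (Ne.symm hne)
  have := orient_rot c z c'
  have := orient_rot c' z c
  have := orient_swap_right z c' c
  linarith

lemma LocalGP.exists_first {k p a z : Pt} {V : Finset Pt} (h : LocalGP k p V)
    (he : (a, z) ∈ hull k p V) (hne : (cone V p a z).Nonempty) : ∃ c, First V p a z c := by
  obtain ⟨⟨-, hz⟩, hs, haz, -⟩ := mem_hull_iff.1 he
  have key : ∀ k, LocalGP k p V → lin k p < lin k a → lin k p < lin k z →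
      ∃ c, First V p a z c := by
    intro k h ka kz
    obtain ⟨w, hw, hmax⟩ := (cone V p a z).exists_max_image (slopeOf k p) hne
    have hr : ∀ v ∈ cone V p a z, lin k p < lin k v := fun v hv =>
      cone_right ka kz haz (mem_cone.1 hv).2.1 (mem_cone.1 hv).2.2
    have hW : insert z (cone V p a z) ⊆ V :=
      Finset.insert_subset hz (Finset.filter_subset _ _)
    obtain ⟨x, y, hxy, h1, h2⟩ := exists_lowerEdge (h.mono hW).above
      (mem_rightOf.2 ⟨Finset.mem_insert_of_mem hw, hr w hw⟩)
      (mem_rightOf.2 ⟨Finset.mem_insert_self _ _, kz⟩)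
      ((slopeOf_lt_iff (hr w hw) kz).2 (mem_cone.1 hw).2.2)
    obtain ⟨hx, hy, -, hab⟩ := mem_hullR.1 hxy
    obtain rfl : y = z := by
      rcases Finset.mem_insert.1 (mem_rightOf.1 hy).1 with h | h
      · exact h
      · linarith [hmax y h]
    have hxc : x ∈ cone V p a y := by
      rcases Finset.mem_insert.1 (mem_rightOf.1 hx).1 with rfl | h
      · linarith
      · exact h
    refine ⟨x, hxc, fun v hv hvx => hab v ?_ hvx ?_⟩
    · exact mem_rightOf.2 ⟨Finset.mem_insert_of_mem hv, hr v hv⟩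
    · rintro rfl
      simpa using (mem_cone.1 hv).2.2
  rcases hs with ⟨ka, kz⟩ | ⟨ka, kz⟩
  · exact key k h ka kz
  · exact key (-k) h.neg (by simpa [lin_neg] using ka) (by simpa [lin_neg] using kz)

lemma First.tightAt {k p a z c j : Pt} {V X : Finset Pt} (h : LocalGP k p V)
    (he : hull k p V = {(a, z)}) (hc : First V p a z c) (hj : j = c ∨ j ∈ cone V p a c)
    (hX : j ∈ X) : TightAt k p V X c := by
  obtain ⟨⟨ha, hz⟩, hs, haz, -⟩ := mem_hull_iff.1 (he ▸ Finset.mem_singleton_self (a, z))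
  obtain ⟨⟨hcV, hac, hcz⟩, hlast⟩ := hc.imp_left mem_cone.1
  intro x hx y hy hsxy hxy hxc hcy hbey
  rcases hj with rfl | hj
  · exact ⟨j, hX, hxc, hcy⟩
  have sxc := hsxy.of_cone hxy hxc hcy
  have scy := sxc.symm.trans hsxy
  have sac := hs.of_cone haz hac hcz
  have scz := sac.symm.trans hs
  obtain rfl : x = a := by
    by_contra hne
    rcases lt_or_gt_of_ne (h.gp x hx a ha hne) with h1 | h1
    · rw [orient_swap_right, neg_lt_zero] at h1
      have hxM : x ∈ cone V p a z := mem_cone.2 ⟨hx, h1, sxc.orient_trans scz hxc hcz⟩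
      have o1 := hlast x hxM (by rintro rfl; simp at hxc)
      by_cases hyz : y = z
      · subst hyz
        have := orient_rot c y x
        have := orient_swap y x c
        linarith
      rcases lt_or_gt_of_ne (h.gp y hy z hz hyz) with h2 | h2
      · rw [orient_swap_right, neg_lt_zero] at h2
        obtain ⟨e, he', h3, h4, -⟩ := h.exists_hull hz hy (scz.symm.trans scy) h2
        rw [he, Finset.mem_singleton] at he'
        subst he'
        simp at h4
      · have o2 := hlast y (mem_cone.2 ⟨hy, sac.orient_trans scy hac hcy, h2⟩)
          (by rintro rfl; simp at hcy)
        have hb := orient_bary p x y c c z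
        have := orient_rot p c z
        simp only [orient_self_mid] at hb
        nlinarith [mul_pos hcy (neg_pos.2 o1), mul_pos hxc (neg_pos.2 o2),
          mul_pos hcz (neg_pos.2 hbey)]
    · obtain ⟨e, he', h3, -⟩ := h.exists_hull hx ha (sxc.trans sac.symm) h1
      rw [he, Finset.mem_singleton] at he'
      subst he'
      exact h3 h1
  obtain ⟨-, h1, h2⟩ := mem_cone.1 hj
  exact ⟨j, hX, h1, (sac.symm.trans (sac.of_cone hac h1 h2)).symm.orient_trans scy h2 hcy⟩

lemma First.starWeight_le {k p a z c : Pt} {V : Finset Pt} (h : LocalGP k p V)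
    (hV : (rightOf k p V).Nonempty) (hV' : (rightOf (-k) p V).Nonempty)
    (he : hull k p V = {(a, z)}) (hc : First V p a z c) {s m : ℕ}
    (hs : (cone V p a z).card = s) (hm : (cone V p a c).card = m) :
    starWeight k p V ≤ 8 * (2 ^ s * (4 - 3 / 5 * s + 6 / 5 * (1 / 2) ^ (m + 1))) := by
  obtain ⟨T, hT, hcT, hf⟩ := exists_front hV hV'
  have he' : (a, z) ∈ hull k p V := he ▸ Finset.mem_singleton_self (a, z)
  obtain ⟨⟨ha, hz⟩, -, haz, -⟩ := mem_hull_iff.1 he'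
  obtain ⟨hcV, hac, hcz⟩ := mem_cone.1 hc.1
  have hbey := hull_beyond he' hc.1
  have hcard := h.card_eq hV hV'
  rw [he, Finset.sum_singleton, Finset.card_singleton, hs] at hcard
  rw [he, Finset.card_singleton] at hcT
  have hJ : insert c (cone V p a c) ⊆ V :=
    Finset.insert_subset hcV (Finset.filter_subset _ _)
  have hJc : (insert c (cone V p a c)).card = m + 1 := by
    rw [Finset.card_insert_of_notMem (by simp [mem_cone]), hm]
  have := starWeight_le_of_front_insert hT hf hcV
    (fun hcT => hf c hcT a ha z hz (mem_hull_iff.1 he').2.1 haz hac hcz hbey) hJ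
    (fun X _ ⟨j, hj, hX⟩ => First.tightAt h he hc (Finset.mem_insert.1 hj) hX)
  rw [hJc, hcard, hcT] at this
  refine this.trans_eq ?_
  push_cast
  rw [pow_add]
  ring

lemma two_pow_le (m : ℕ) : (2 : ℝ) ^ m * (4 - 3 / 5 * m) ≤ 32 := by
  by_cases h : 7 ≤ m
  · have : (7 : ℝ) ≤ m := by exact_mod_cast h
    have : (2 : ℝ) ^ m * (4 - 3 / 5 * m) ≤ 0 :=
      mul_nonpos_of_nonneg_of_nonpos (by positivity) (by linarith)
    linarith
  · interval_cases m <;> norm_num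

lemma sum_two_pow_first_le {s m : ℕ} (h : m + 1 ≤ s) :
    (2 : ℝ) ^ s * (4 - 3 / 5 * s + 6 / 5 * (1 / 2) ^ (m + 1)) +
      2 ^ (m + 1) * (4 - 3 / 5 * (m + 1 : ℕ) + 6 / 5 * (1 / 2) ^ (m + 1)) + 46 / 5 ≤ 652 / 8 := by
  by_cases h8 : 8 ≤ s
  · have h8' : (8 : ℝ) ≤ s := by exact_mod_cast h8
    have h1 : ((1 : ℝ) / 2) ^ (m + 1) ≤ 1 / 2 := by
      rw [pow_succ]
      have : ((1 : ℝ) / 2) ^ m ≤ 1 := pow_le_one₀ (by norm_num) (by norm_num)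
      linarith
    have h2 : (2 : ℝ) ^ s * (4 - 3 / 5 * s + 6 / 5 * (1 / 2) ^ (m + 1)) ≤ 0 :=
      mul_nonpos_of_nonneg_of_nonpos (by positivity) (by linarith)
    have h3 := two_pow_le (m + 1)
    have h4 : (2 : ℝ) ^ (m + 1) * (1 / 2) ^ (m + 1) = 1 := by
      rw [← mul_pow]; norm_num
    nlinarith
  · have hs : s < 8 := by omega
    have hm : m < 7 := by omega
    interval_cases s <;> interval_cases m <;> first | omega | norm_num

/-- The only hull edge around `p` is `(a, z)`, and its first chord ends in `c`. -/
structure HasChord (k p : Pt) (S : Finset Pt) (a z c : Pt) (H : Finset (Sym2 Pt)) : Prop where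
  pg : PG (S.erase p) H
  hull_eq : hull k p (vis S H p) = {(a, z)}
  first : First (vis S H p) p a z c

lemma First.pos {k p a z c : Pt} {V : Finset Pt} (he : (a, z) ∈ hull k p V)
    (hc : First V p a z c) : (c ∈ V ∧ 0 < orient p a c ∧ 0 < orient p c z) ∧
      0 < orient p a z ∧ Same k p a c ∧ Same k p c z ∧ orient a z c < 0 := by
  obtain ⟨-, hs, haz, -⟩ := mem_hull_iff.1 he
  have h := mem_cone.1 hc.1
  have sac := hs.of_cone haz h.2.1 h.2.2
  exact ⟨h, haz, sac, sac.symm.trans hs, hull_beyond he hc.1⟩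

lemma First.cone_sub {k p a z c w : Pt} {V : Finset Pt} (he : (a, z) ∈ hull k p V)
    (hc : First V p a z c) (h1 : 0 < orient p c w) (h2 : 0 < orient p w z) :
    0 < orient p a w := by
  obtain ⟨⟨-, hac, hcz⟩, haz, sac, scz, hbey⟩ := hc.pos he
  exact sac.orient_trans (scz.of_cone hcz h1 h2) hac h1

lemma HasChord.mem_hull {k p a z c : Pt} {S : Finset Pt} {H : Finset (Sym2 Pt)}
    (h : HasChord k p S a z c H) : (a, z) ∈ hull k p (vis S H p) :=
  h.hull_eq ▸ Finset.mem_singleton_self (a, z)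

lemma HasChord.erase_chord {k p a z c : Pt} {S : Finset Pt} {H : Finset (Sym2 Pt)}
    (h : HasChord k p S a z c H) (hI : Interior k p S) :
    HasChord k p S a z c (H.erase s(c, z)) := by
  have hsub : vis S H p ⊆ vis S (H.erase s(c, z)) p := vis_mono (Finset.erase_subset _ _) p
  obtain ⟨⟨hcV, hac, hcz⟩, haz, sac, scz, hbey⟩ := h.first.pos h.mem_hull
  refine ⟨h.pg.mono_right (Finset.erase_subset _ _), ?_, ?_, ?_⟩
  · rw [← h.hull_eq]
    refine (hI.localGP _).hull_eq_of_beyond hsub h.mem_hull fun w hw hw' => ?_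
    obtain ⟨h1, h2, h3⟩ := (cr_chord_iff hcz).1 (cr_of_mem_vis_erase hw hw')
    refine ⟨h.first.cone_sub h.mem_hull h1 h2, h2, ?_⟩
    have hb := orient_bary p c z w a z
    have := orient_rot p a z
    have := orient_self_right a z
    by_contra! hn
    nlinarith [mul_pos (neg_pos.2 h3) haz, mul_pos h2 (neg_pos.2 hbey), mul_nonneg hcz.le hn]
  · exact mem_cone.2 ⟨hsub hcV, hac, hcz⟩
  · intro w hw hwc
    obtain ⟨hw, h1, h2⟩ := mem_cone.1 hw
    by_cases hw' : w ∈ vis S H p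
    · exact h.first.2 w (mem_cone.2 ⟨hw', h1, h2⟩) hwc
    · exact ((cr_chord_iff hcz).1 (cr_of_mem_vis_erase hw hw')).2.2

lemma HasChord.mem_ends {k p a z c : Pt} {S : Finset Pt} {H : Finset (Sym2 Pt)}
    (h : HasChord k p S a z c H) : a ∈ vis S (insert s(c, z) H) p ∧
      z ∈ vis S (insert s(c, z) H) p ∧ c ∈ vis S (insert s(c, z) H) p := by
  obtain ⟨⟨hcV, hac, hcz⟩, haz, sac, scz, hbey⟩ := h.first.pos h.mem_hull
  obtain ⟨⟨ha, hz⟩, -⟩ := mem_hull_iff.1 h.mem_hull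
  refine ⟨mem_vis_insert.2 ⟨ha, fun hcr => ?_⟩, mem_vis_insert.2 ⟨hz, fun h => h.fst_ne.2.2.2 rfl⟩,
    mem_vis_insert.2 ⟨hcV, fun h => h.fst_ne.2.2.1 rfl⟩⟩
  have := ((cr_chord_iff hcz).1 hcr).1
  rw [orient_swap_right] at this
  linarith

lemma HasChord.insert_chord {k p a z c : Pt} {S : Finset Pt} {H : Finset (Sym2 Pt)}
    (h : HasChord k p S a z c H) (hI : Interior k p S) :
    HasChord k p S a z c (insert s(c, z) H) := by
  have hsub : vis S (insert s(c, z) H) p ⊆ vis S H p := vis_mono (Finset.subset_insert _ _) p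
  obtain ⟨⟨hcV, hac, hcz⟩, haz, sac, scz, hbey⟩ := h.first.pos h.mem_hull
  obtain ⟨ma, mz, mc⟩ := h.mem_ends
  refine ⟨h.pg.insert_chord hI.gp hI.mem hcV (hsub mz) hcz ?_, ?_, ?_, ?_⟩
  · intro w hw
    obtain ⟨hw, h1, h2⟩ := mem_cone.1 hw
    exact h.first.2 w (mem_cone.2 ⟨hw, h.first.cone_sub h.mem_hull h1 h2, h2⟩)
      (by rintro rfl; simp at h1)
  · rw [← h.hull_eq]
    refine (hI.localGP _).hull_subset hsub fun e he => ?_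
    rw [h.hull_eq, Finset.mem_singleton] at he
    subst he
    exact ⟨ma, mz⟩
  · exact mem_cone.2 ⟨mc, hac, hcz⟩
  · intro w hw
    obtain ⟨hw, h1, h2⟩ := mem_cone.1 hw
    exact h.first.2 w (mem_cone.2 ⟨hsub hw, h1, h2⟩)

lemma HasChord.cone_insert_right {k p a z c : Pt} {S : Finset Pt} {H : Finset (Sym2 Pt)}
    (h : HasChord k p S a z c H) :
    cone (vis S (insert s(c, z) H) p) p a c = cone (vis S H p) p a c := by
  obtain ⟨⟨hcV, hac, hcz⟩, -⟩ := h.first.pos h.mem_hull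
  ext w
  rw [mem_cone, mem_cone, mem_vis_insert]
  refine ⟨fun h => ⟨h.1.1, h.2⟩, fun h => ⟨⟨h.1, fun hcr => ?_⟩, h.2⟩⟩
  have := ((cr_chord_iff hcz).1 hcr).1
  rw [orient_swap_right] at this
  linarith [h.2.2]

lemma HasChord.insert_subset {k p a z c : Pt} {S : Finset Pt} {H : Finset (Sym2 Pt)}
    (h : HasChord k p S a z c H) :
    insert c (cone (vis S H p) p a c) ⊆ cone (vis S H p) p a z := by
  obtain ⟨⟨hcV, hac, hcz⟩, haz, sac, scz, hbey⟩ := h.first.pos h.mem_hull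
  refine Finset.insert_subset h.first.1 fun w hw => ?_
  obtain ⟨hw, h1, h2⟩ := mem_cone.1 hw
  exact mem_cone.2 ⟨hw, h1, (sac.symm.trans (sac.of_cone hac h1 h2)).symm.orient_trans scz h2 hcz⟩

lemma HasChord.cone_eq {k p a z c : Pt} {S : Finset Pt} {H : Finset (Sym2 Pt)}
    (h : HasChord k p S a z c H) (hI : Interior k p S) :
    cone (vis S (insert s(c, z) H) p) p a z = insert c (cone (vis S H p) p a c) := by
  obtain ⟨⟨hcV, hac, hcz⟩, -⟩ := h.first.pos h.mem_hull
  apply Finset.Subset.antisymm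
  · intro w hw
    obtain ⟨hw, h1, h2⟩ := mem_cone.1 hw
    obtain ⟨hw, hcr⟩ := mem_vis_insert.1 hw
    by_cases hwc : w = c
    · exact hwc ▸ Finset.mem_insert_self _ _
    refine Finset.mem_insert_of_mem (mem_cone.2 ⟨hw, h1, ?_⟩)
    rcases lt_or_gt_of_ne ((hI.localGP H).gp w hw c hcV hwc) with h3 | h3
    · rw [orient_swap_right, neg_lt_zero] at h3
      exact absurd ((cr_chord_iff hcz).2
        ⟨h3, h2, h.first.2 w (mem_cone.2 ⟨hw, h1, h2⟩) hwc⟩) hcr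
    · exact h3
  · rw [← h.cone_insert_right]
    exact (h.insert_chord hI).insert_subset

lemma Interior.starWeight_le_of_cone_empty {k p a z : Pt} {S : Finset Pt} (hI : Interior k p S)
    {G : Finset (Sym2 Pt)} (hG : PG (S.erase p) G) (he : hull k p (vis S G p) = {(a, z)})
    (hc : cone (vis S G p) p a z = ∅) : starWeight k p (vis S G p) ≤ 184 / 5 := by
  have h1 := hI.starWeight_le hG
  have h2 := hI.card_vis hG
  rw [he, Finset.sum_singleton, Finset.card_singleton, hc, Finset.card_empty] at h2
  rw [he, Finset.card_singleton, h2] at h1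
  norm_num at h1
  linarith

lemma Interior.starWeight_insert_le {k p a z : Pt} {S : Finset Pt} (hI : Interior k p S)
    {G : Finset (Sym2 Pt)} (hG : PG (S.erase p) G) (he : hull k p (vis S G p) = {(a, z)}) :
    starWeight k p (vis S (insert s(a, z) G) p) ≤ 184 / 5 := by
  have he' : (a, z) ∈ hull k p (vis S G p) := he ▸ Finset.mem_singleton_self (a, z)
  exact hI.starWeight_le_of_cone_empty (hI.insert_hull hG he') ((hI.hull_insert he').trans he)
    (cone_insert_self he')

lemma HasChord.sum_starWeight {k p a z c : Pt} {S : Finset Pt} {H : Finset (Sym2 Pt)}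
    (h : HasChord k p S a z c H) (hI : Interior k p S) :
    starWeight k p (vis S H p) + starWeight k p (vis S (insert s(c, z) H) p) +
      (starWeight k p (vis S (insert s(a, z) H) p) +
        starWeight k p (vis S (insert s(a, z) (insert s(c, z) H)) p)) ≤ 4 * 163 := by
  have h' := h.insert_chord hI
  have h1 := First.starWeight_le (hI.localGP H) (hI.right_nonempty h.pg) (hI.left_nonempty h.pg)
    h.hull_eq h.first rfl rfl
  have hcc : (insert c (cone (vis S H p) p a c)).card = (cone (vis S H p) p a c).card + 1 :=
    Finset.card_insert_of_notMem (by simp [mem_cone])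
  have h2 := First.starWeight_le (hI.localGP _) (hI.right_nonempty h'.pg) (hI.left_nonempty h'.pg)
    h'.hull_eq h'.first (by rw [h.cone_eq hI, hcc]) (by rw [h.cone_insert_right])
  have h3 := hI.starWeight_insert_le h.pg h.hull_eq
  have h4 := hI.starWeight_insert_le h'.pg h'.hull_eq
  have h5 := sum_two_pow_first_le (hcc ▸ Finset.card_le_card h.insert_subset)
  linarith

lemma sum_le_of_toggle {α : Type*} [DecidableEq α] {A : Finset (Finset α)} {f : Finset α → ℝ}
    {P : Finset α → Finset α} {B : ℝ}
    (h1 : ∀ G ∈ A, ∀ D ⊆ P G, G \ P G ∪ D ∈ A ∧ P (G \ P G ∪ D) = P G)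
    (h2 : ∀ G ∈ A, ∑ D ∈ (P G).powerset, f (G \ P G ∪ D) ≤ 2 ^ (P G).card * B) :
    ∑ G ∈ A, f G ≤ A.card * B := by
  let R : Finset α → Finset (Finset α) := fun G => (P G).powerset.image fun D => G \ P G ∪ D
  have hself : ∀ G, G ∈ R G := fun G => Finset.mem_image.2
    ⟨G ∩ P G, Finset.mem_powerset.2 Finset.inter_subset_right, Finset.sdiff_union_inter G (P G)⟩
  have hsd : ∀ G, ∀ D ⊆ P G, (G \ P G ∪ D) \ P G = G \ P G := by
    intro G D hD
    ext e
    have := @hD e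
    simp only [Finset.mem_sdiff, Finset.mem_union]
    tauto
  have hR : ∀ G ∈ A, ∀ G' ∈ R G, G' ∈ A ∧ R G' = R G := by
    intro G hG G' hG'
    obtain ⟨D, hD, rfl⟩ := Finset.mem_image.1 hG'
    rw [Finset.mem_powerset] at hD
    refine ⟨(h1 G hG D hD).1, ?_⟩
    simp only [R, (h1 G hG D hD).2, hsd G D hD]
  have hinj : ∀ G, Set.InjOn (fun D => G \ P G ∪ D) (P G).powerset := by
    intro G D hD D' hD' h
    rw [Finset.mem_coe, Finset.mem_powerset] at hD hD'
    ext e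
    have h3 := @hD e
    have h4 := @hD' e
    have h5 := Finset.ext_iff.1 h e
    simp only [Finset.mem_sdiff, Finset.mem_union] at h5
    tauto
  have hfib : ∀ G ∈ A, A.filter (fun G' => R G' = R G) = R G := by
    intro G hG
    ext G'
    rw [Finset.mem_filter]
    exact ⟨fun h => h.2 ▸ hself G', fun h => hR G hG G' h⟩
  have hblock : ∀ b ∈ A.image R, ∑ G ∈ A with R G = b, f G ≤ (A.filter fun G => R G = b).card * B := by
    intro b hb
    obtain ⟨G, hG, rfl⟩ := Finset.mem_image.1 hb
    rw [hfib G hG, Finset.sum_image (hinj G), Finset.card_image_of_injOn (hinj G),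
      Finset.card_powerset]
    exact_mod_cast h2 G hG
  calc ∑ G ∈ A, f G = ∑ b ∈ A.image R, ∑ G ∈ A with R G = b, f G :=
        (Finset.sum_fiberwise_of_maps_to (fun G hG => Finset.mem_image_of_mem R hG) f).symm
    _ ≤ ∑ b ∈ A.image R, ((A.filter fun G => R G = b).card : ℝ) * B := Finset.sum_le_sum hblock
    _ = A.card * B := by
        rw [← Finset.sum_mul, ← Nat.cast_sum,
          ← Finset.card_eq_sum_card_fiberwise (fun G hG => Finset.mem_image_of_mem R hG)]

lemma sum_powerset_pair {α : Type*} [DecidableEq α] (f : Finset α → ℝ) {H : Finset α} {a b : α}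
    (h : a ≠ b) : ∑ D ∈ ({a, b} : Finset α).powerset, f (H ∪ D) =
      f H + f (insert b H) + (f (insert a H) + f (insert a (insert b H))) := by
  rw [Finset.sum_powerset_insert (by simpa using h), ← insert_empty_eq b,
    Finset.sum_powerset_insert (by simp), Finset.sum_powerset_insert (by simp)]
  simp [Finset.union_insert]

lemma union_of_subset_pair {α : Type*} [DecidableEq α] {H D : Finset α} {a b : α}
    (hD : D ⊆ {a, b}) : (H ∪ D = H ∨ H ∪ D = insert a H) ∨
      (H ∪ D = insert b H ∨ H ∪ D = insert a (insert b H)) := by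
  by_cases ha : a ∈ D <;> by_cases hb : b ∈ D
  · exact Or.inr (Or.inr (by grind))
  · exact Or.inl (Or.inr (by grind))
  · exact Or.inr (Or.inl (by grind))
  · exact Or.inl (Or.inl (by grind))

/-- The plane graphs on `S` without `p` that have `n` hull edges around `p`. -/
def hullClass (k p : Pt) (S : Finset Pt) (n : ℕ) : Finset (Finset (Sym2 Pt)) :=
  (planeGraphs (S.erase p)).filter fun G => (hull k p (vis S G p)).card = n

lemma Interior.mem_hullClass {k p : Pt} {S : Finset Pt} (hI : Interior k p S)
    {G : Finset (Sym2 Pt)} {n : ℕ} : G ∈ hullClass k p S n ↔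
      PG (S.erase p) G ∧ (hull k p (vis S G p)).card = n := by
  rw [hullClass, Finset.mem_filter, mem_planeGraphs (hI.gp.mono (S.erase_subset p))]

lemma sym2_mk_ne {p x y x' y' : Pt} (h : (x, y) ≠ (x', y')) (h1 : 0 < orient p x y)
    (h2 : 0 < orient p x' y') : s(x, y) ≠ s(x', y') := by
  intro he
  rcases Sym2.eq_iff.1 he with ⟨rfl, rfl⟩ | ⟨rfl, rfl⟩
  · exact h rfl
  · rw [orient_swap_right] at h2
    linarith

lemma sdiff_pair {α : Type*} [DecidableEq α] (G : Finset α) (a b : α) :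
    G \ {a, b} = (G.erase a).erase b := by
  ext e
  simp only [Finset.mem_sdiff, Finset.mem_insert, Finset.mem_singleton, Finset.mem_erase]
  tauto

lemma Interior.sum_hullClass_two {k p : Pt} {S : Finset Pt} (hI : Interior k p S) :
    ∑ G ∈ hullClass k p S 2, starWeight k p (vis S G p) ≤ (hullClass k p S 2).card * 163 := by
  let P : Finset (Sym2 Pt) → Finset (Sym2 Pt) := fun G =>
    (hull k p (vis S G p)).image fun e => s(e.1, e.2)
  have hP : ∀ {G e f}, hull k p (vis S G p) = {e, f} → P G = {s(e.1, e.2), s(f.1, f.2)} := by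
    intro G e f h
    simp [P, h, Finset.image_insert]
  have hdata : ∀ G ∈ hullClass k p S 2, ∃ e f, e ≠ f ∧ s(e.1, e.2) ≠ s(f.1, f.2) ∧
      P G = {s(e.1, e.2), s(f.1, f.2)} ∧ PG (S.erase p) (G \ P G) ∧
      hull k p (vis S (G \ P G) p) = {e, f} := by
    intro G hG
    obtain ⟨hG, hc⟩ := hI.mem_hullClass.1 hG
    obtain ⟨e, f, hne, he⟩ := Finset.card_eq_two.1 hc
    have me : e ∈ hull k p (vis S G p) := by simp [he]
    have mf : f ∈ hull k p (vis S G p) := by simp [he]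
    refine ⟨e, f, hne, sym2_mk_ne hne (hull_end me).2.2.1 (hull_end mf).2.2.1, hP he,
      hG.mono_right Finset.sdiff_subset, ?_⟩
    have h1 := hI.hull_erase me
    have h2 := hI.hull_erase (h1.symm ▸ mf)
    rw [hP he, sdiff_pair, h2, h1, he]
  have hins : ∀ {H e f}, PG (S.erase p) H → hull k p (vis S H p) = {e, f} →
      (PG (S.erase p) (insert s(e.1, e.2) H) ∧
        hull k p (vis S (insert s(e.1, e.2) H) p) = {e, f}) ∧
      (PG (S.erase p) (insert s(f.1, f.2) H) ∧
        hull k p (vis S (insert s(f.1, f.2) H) p) = {e, f}) := by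
    intro H e f hH he
    have me : e ∈ hull k p (vis S H p) := by simp [he]
    have mf : f ∈ hull k p (vis S H p) := by simp [he]
    exact ⟨⟨hI.insert_hull hH me, (hI.hull_insert me).trans he⟩,
      ⟨hI.insert_hull hH mf, (hI.hull_insert mf).trans he⟩⟩
  refine sum_le_of_toggle (P := P) ?_ ?_
  · intro G hG D hD
    obtain ⟨e, f, hne, hne', hPG, hH, hh⟩ := hdata G hG
    generalize G \ P G = H at hH hh ⊢
    rw [hPG] at hD ⊢
    have : PG (S.erase p) (H ∪ D) ∧ hull k p (vis S (H ∪ D) p) = {e, f} := by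
      have he := (hins hH hh).1
      have hf := (hins hH hh).2
      rcases union_of_subset_pair (H := H) hD with (h | h) | (h | h) <;> rw [h]
      · exact ⟨hH, hh⟩
      · exact he
      · exact hf
      · exact (hins hf.1 hf.2).1
    refine ⟨hI.mem_hullClass.2 ⟨this.1, ?_⟩, hP this.2⟩
    rw [this.2, Finset.card_pair hne]
  · intro G hG
    obtain ⟨e, f, hne, hne', hPG, hH, hh⟩ := hdata G hG
    generalize G \ P G = H at hH hh ⊢
    rw [hPG, sum_powerset_pair (fun G => starWeight k p (vis S G p)) hne', Finset.card_pair hne']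
    have := hI.sum_starWeight_two hH hne hh
    linarith

/-- The hull edge around `p`, if it is unique, together with the chord below it. -/
def chordEdges (k p : Pt) (S : Finset Pt) (G : Finset (Sym2 Pt)) : Finset (Sym2 Pt) :=
  (hull k p (vis S G p)).biUnion fun e => insert s(e.1, e.2)
    ((S.filter (First (vis S (G.erase s(e.1, e.2)) p) p e.1 e.2)).image fun c => s(c, e.2))

lemma First.sym2_ne {k p a z c : Pt} {V : Finset Pt} (he : (a, z) ∈ hull k p V)
    (hc : First V p a z c) : s(a, z) ≠ s(c, z) := by
  obtain ⟨⟨-, hac, hcz⟩, haz, -⟩ := hc.pos he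
  refine sym2_mk_ne ?_ haz hcz
  intro h
  rw [show a = c from (Prod.ext_iff.1 h).1] at hac
  simp at hac

lemma chordEdges_of_first {k p a z c : Pt} {S : Finset Pt} {G : Finset (Sym2 Pt)}
    (he : hull k p (vis S G p) = {(a, z)}) (hc : First (vis S (G.erase s(a, z)) p) p a z c) :
    chordEdges k p S G = {s(a, z), s(c, z)} := by
  have : S.filter (First (vis S (G.erase s(a, z)) p) p a z) = {c} := by
    ext d
    rw [Finset.mem_filter, Finset.mem_singleton]
    refine ⟨fun h => hc.unique h.2, ?_⟩
    rintro rfl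
    exact ⟨(mem_vis.1 (mem_cone.1 hc.1).1).1, hc⟩
  rw [chordEdges, he, Finset.singleton_biUnion, this, Finset.image_singleton]

lemma chordEdges_of_cone_empty {k p a z : Pt} {S : Finset Pt} {G : Finset (Sym2 Pt)}
    (he : hull k p (vis S G p) = {(a, z)}) (hc : cone (vis S (G.erase s(a, z)) p) p a z = ∅) :
    chordEdges k p S G = {s(a, z)} := by
  have : S.filter (First (vis S (G.erase s(a, z)) p) p a z) = ∅ := by
    rw [Finset.filter_eq_empty_iff]
    intro d _ hd
    have := hd.1
    simp [hc] at this
  rw [chordEdges, he, Finset.singleton_biUnion, this, Finset.image_empty, insert_empty_eq]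

lemma HasChord.chordEdges_eq {k p a z c : Pt} {S : Finset Pt} {H G : Finset (Sym2 Pt)}
    (h : HasChord k p S a z c H) (hI : Interior k p S) (hO : s(a, z) ∉ H)
    (hG : G = H ∨ G = insert s(a, z) H) :
    G ∈ hullClass k p S 1 ∧ chordEdges k p S G = {s(a, z), s(c, z)} := by
  have hE : G.erase s(a, z) = H := by
    rcases hG with rfl | rfl
    · exact Finset.erase_eq_of_notMem hO
    · exact Finset.erase_insert hO
  have : PG (S.erase p) G ∧ hull k p (vis S G p) = {(a, z)} := by
    rcases hG with rfl | rfl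
    · exact ⟨h.pg, h.hull_eq⟩
    · exact ⟨hI.insert_hull h.pg h.mem_hull, (hI.hull_insert h.mem_hull).trans h.hull_eq⟩
  refine ⟨hI.mem_hullClass.2 ⟨this.1, by rw [this.2, Finset.card_singleton]⟩,
    chordEdges_of_first this.2 (hE ▸ h.first)⟩

lemma Interior.exists_chord {k p : Pt} {S : Finset Pt} (hI : Interior k p S)
    {G : Finset (Sym2 Pt)} (hG : G ∈ hullClass k p S 1) :
    (∃ a z, chordEdges k p S G = {s(a, z)} ∧ PG (S.erase p) (G.erase s(a, z)) ∧
      hull k p (vis S (G.erase s(a, z)) p) = {(a, z)} ∧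
      cone (vis S (G.erase s(a, z)) p) p a z = ∅) ∨
    ∃ a z c, chordEdges k p S G = {s(a, z), s(c, z)} ∧
      HasChord k p S a z c ((G.erase s(a, z)).erase s(c, z)) := by
  obtain ⟨hG, hc⟩ := hI.mem_hullClass.1 hG
  obtain ⟨⟨a, z⟩, he⟩ := Finset.card_eq_one.1 hc
  have hE := (hI.hull_erase (he ▸ Finset.mem_singleton_self (a, z))).trans he
  have hPG := hG.mono_right (G.erase_subset s(a, z))
  rcases (cone (vis S (G.erase s(a, z)) p) p a z).eq_empty_or_nonempty with hem | hne
  · exact Or.inl ⟨a, z, chordEdges_of_cone_empty he hem, hPG, hE, hem⟩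
  · obtain ⟨c, hc⟩ := (hI.localGP _).exists_first (hE ▸ Finset.mem_singleton_self (a, z)) hne
    exact Or.inr ⟨a, z, c, chordEdges_of_first he hc,
      HasChord.erase_chord ⟨hPG, hE, hc⟩ hI⟩

lemma Interior.sum_hullClass_one {k p : Pt} {S : Finset Pt} (hI : Interior k p S) :
    ∑ G ∈ hullClass k p S 1, starWeight k p (vis S G p) ≤ (hullClass k p S 1).card * 163 := by
  refine sum_le_of_toggle (P := chordEdges k p S) ?_ ?_
  · intro G hG D hD
    rcases hI.exists_chord hG with ⟨a, z, hP, hH, he, hc⟩ | ⟨a, z, c, hP, hH⟩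
    · rw [hP] at hD ⊢
      rw [Finset.sdiff_singleton_eq_erase]
      have he' : (a, z) ∈ hull k p (vis S (G.erase s(a, z)) p) := by simp [he]
      have hO : s(a, z) ∉ G.erase s(a, z) := Finset.notMem_erase _ _
      generalize G.erase s(a, z) = H at hH he hc he' hO
      rcases Finset.subset_singleton_iff.1 hD with rfl | rfl
      · rw [Finset.union_empty]
        refine ⟨hI.mem_hullClass.2 ⟨hH, by rw [he, Finset.card_singleton]⟩,
          chordEdges_of_cone_empty he ?_⟩
        rwa [Finset.erase_eq_of_notMem hO]
      · rw [Finset.union_comm, ← Finset.insert_eq]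
        have he2 := (hI.hull_insert he').trans he
        refine ⟨hI.mem_hullClass.2 ⟨hI.insert_hull hH he', by rw [he2, Finset.card_singleton]⟩,
          chordEdges_of_cone_empty he2 ?_⟩
        rwa [Finset.erase_insert hO]
    · rw [hP, sdiff_pair]
      rw [hP, Finset.pair_comm] at hD
      have hne := hH.first.sym2_ne hH.mem_hull
      have hO : s(a, z) ∉ (G.erase s(a, z)).erase s(c, z) := by simp
      generalize (G.erase s(a, z)).erase s(c, z) = H at hH hO
      have hO' : s(a, z) ∉ insert s(c, z) H := by
        rw [Finset.mem_insert]
        exact not_or.2 ⟨hne, hO⟩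
      rcases union_of_subset_pair (H := H) hD with (h | h) | (h | h) <;> rw [h]
      · exact hH.chordEdges_eq hI hO (Or.inl rfl)
      · exact (hH.insert_chord hI).chordEdges_eq hI hO' (Or.inl rfl)
      · exact hH.chordEdges_eq hI hO (Or.inr rfl)
      · rw [Finset.insert_comm]
        exact (hH.insert_chord hI).chordEdges_eq hI hO' (Or.inr rfl)
  · intro G hG
    rcases hI.exists_chord hG with ⟨a, z, hP, hH, he, hc⟩ | ⟨a, z, c, hP, hH⟩
    · rw [hP, Finset.sdiff_singleton_eq_erase, ← insert_empty_eq, Finset.sum_powerset_insert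
        (by simp)]
      have h1 := hI.starWeight_le_of_cone_empty hH he hc
      have h2 := hI.starWeight_insert_le hH he
      simp only [Finset.powerset_empty, Finset.sum_singleton, Finset.union_empty,
        insert_empty_eq, Finset.card_singleton, Finset.union_insert]
      linarith
    · have hne := hH.first.sym2_ne hH.mem_hull
      rw [hP, sdiff_pair, sum_powerset_pair (fun G => starWeight k p (vis S G p)) hne,
        Finset.card_pair hne]
      have := hH.sum_starWeight hI
      linarith

lemma Interior.sum_starWeight {k p : Pt} {S : Finset Pt} (hI : Interior k p S) :
    ∑ G ∈ planeGraphs (S.erase p), starWeight k p (vis S G p) ≤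
      (planeGraphs (S.erase p)).card * 163 := by
  have hpt : ∀ n, n ≠ 1 → n ≠ 2 → ∑ G ∈ hullClass k p S n, starWeight k p (vis S G p) ≤
      (hullClass k p S n).card * 163 := by
    intro n h1 h2
    rw [← nsmul_eq_mul]
    refine Finset.sum_le_card_nsmul _ _ _ fun G hG => ?_
    obtain ⟨hG, hc⟩ := hI.mem_hullClass.1 hG
    by_cases h0 : n = 0
    · exact hI.starWeight_le_of_card_eq_zero hG (hc.trans h0)
    · exact hI.starWeight_le_of_three_le hG (by omega)
  set A := planeGraphs (S.erase p) with hA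
  let g : Finset (Sym2 Pt) → ℕ := fun G => (hull k p (vis S G p)).card
  have hmap : ∀ G ∈ A, g G ∈ A.image g := fun G hG => Finset.mem_image_of_mem g hG
  rw [← Finset.sum_fiberwise_of_maps_to hmap, Finset.card_eq_sum_card_fiberwise hmap,
    Nat.cast_sum, Finset.sum_mul]
  refine Finset.sum_le_sum fun n _ => ?_
  by_cases h1 : n = 1
  · subst h1
    exact hI.sum_hullClass_one
  · by_cases h2 : n = 2
    · subst h2
      exact hI.sum_hullClass_two
    · exact hpt n h1 h2

/-- The number of tight visible points of `p`. -/
def tightCount (k : Pt) (S : Finset Pt) (G : Finset (Sym2 Pt)) (p : Pt) : ℕ :=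
  ((vis S G p).filter (Tight k S G p)).card

lemma sum_tight_right_le (k : Pt) (S : Finset Pt) (G : Finset (Sym2 Pt)) :
    ∑ p ∈ S, ((vis S G p).filter fun w => Tight k S G p w ∧ lin k p < lin k w).card ≤
      (tightPairs k S G).card := by
  have hmap : ∀ e ∈ tightPairs k S G, e.1 ∈ S := fun e he =>
    (Finset.mem_product.1 (Finset.mem_filter.1 he).1).1
  rw [Finset.card_eq_sum_card_fiberwise hmap]
  refine Finset.sum_le_sum fun p hp => ?_
  refine Finset.card_le_card_of_injOn (fun w => (p, w)) ?_ (fun w _ w' _ h => (Prod.ext_iff.1 h).2)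
  intro w hw
  obtain ⟨hw, ht, hl⟩ := Finset.mem_filter.1 hw
  exact Finset.mem_filter.2 ⟨Finset.mem_filter.2
    ⟨Finset.mem_product.2 ⟨hp, (mem_vis.1 hw).1⟩, hl, hw, ht⟩, rfl⟩

lemma PG.card_tightPairs_le {S : Finset Pt} (hS : OrientGP S) {G : Finset (Sym2 Pt)} (hG : PG S G)
    {k : Pt} (hk : ∀ a ∈ S, ∀ b ∈ S, lin k a = lin k b → a = b) :
    (tightPairs k S G).card ≤ 3 * S.card := by
  refine card_le_of_noncrossing hS hk ?_ fun p u q v h h' => hG.tightPairs_not_cr hS hk h h'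
  intro p u h
  obtain ⟨h, hl, -⟩ := Finset.mem_filter.1 h
  exact ⟨(Finset.mem_product.1 h).1, (Finset.mem_product.1 h).2, hl⟩

lemma PG.sum_tightCount_le {S : Finset Pt} (hS : OrientGP S) {G : Finset (Sym2 Pt)} (hG : PG S G)
    {k : Pt} (hk : ∀ a ∈ S, ∀ b ∈ S, lin k a = lin k b → a = b) :
    ∑ p ∈ S, tightCount k S G p ≤ 6 * S.card := by
  have hk' : ∀ a ∈ S, ∀ b ∈ S, lin (-k) a = lin (-k) b → a = b := by
    intro a ha b hb h
    rw [lin_neg, lin_neg] at h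
    exact hk a ha b hb (neg_injective h)
  have h1 := (sum_tight_right_le k S G).trans (hG.card_tightPairs_le hS hk)
  have h2 := (sum_tight_right_le (-k) S G).trans (hG.card_tightPairs_le hS hk')
  have h3 : ∑ p ∈ S, tightCount k S G p ≤
      ∑ p ∈ S, (((vis S G p).filter fun w => Tight k S G p w ∧ lin k p < lin k w).card +
        ((vis S G p).filter fun w => Tight (-k) S G p w ∧ lin (-k) p < lin (-k) w).card) := by
    refine Finset.sum_le_sum fun p hp => ?_
    refine (Finset.card_le_card ?_).trans (Finset.card_union_le _ _)
    intro w hw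
    obtain ⟨hw, ht⟩ := Finset.mem_filter.1 hw
    rw [Finset.mem_union, Finset.mem_filter, Finset.mem_filter, tight_neg, lin_neg, lin_neg,
      neg_lt_neg_iff]
    rcases lt_trichotomy (lin k p) (lin k w) with h | h | h
    · exact Or.inl ⟨hw, ht, h⟩
    · exact absurd (hk p hp w (mem_vis.1 hw).1 h) (mem_vis.1 hw).2.1.symm
    · exact Or.inr ⟨hw, ht, h⟩
  rw [Finset.sum_add_distrib] at h3
  omega

/-- The graph `G` together with the star at `p` with leaves `X`. -/
def addStar (p : Pt) (G : Finset (Sym2 Pt)) (X : Finset Pt) : Finset (Sym2 Pt) :=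
  G ∪ X.image fun x => s(p, x)

lemma mem_addStar {p : Pt} {G : Finset (Sym2 Pt)} {X : Finset Pt} {e : Sym2 Pt} :
    e ∈ addStar p G X ↔ e ∈ G ∨ ∃ x ∈ X, s(p, x) = e := by simp [addStar]

lemma PG.notMem_of_erase {p : Pt} {S : Finset Pt} {G : Finset (Sym2 Pt)} (hG : PG (S.erase p) G)
    {e : Sym2 Pt} (he : e ∈ G) : p ∉ e := by
  induction e with
  | _ a b =>
    intro hp
    have := (hG.mem he).2
    rcases Sym2.mem_iff.1 hp with rfl | rfl <;> simp at this

lemma PG.mk_mem_addStar {p v : Pt} {S : Finset Pt} {G : Finset (Sym2 Pt)} (hG : PG (S.erase p) G)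
    {X : Finset Pt} : s(p, v) ∈ addStar p G X ↔ v ∈ X := by
  rw [mem_addStar]
  constructor
  · rintro (h | ⟨x, hx, h⟩)
    · exact absurd (Sym2.mem_mk_left p v) (hG.notMem_of_erase h)
    · rwa [← Sym2.congr_right.1 h]
  · exact fun h => Or.inr ⟨v, h, rfl⟩

lemma PG.addStar {p : Pt} {S : Finset Pt} (hp : p ∈ S) {G : Finset (Sym2 Pt)}
    (hG : PG (S.erase p) G) {X : Finset Pt} (hX : X ⊆ vis S G p) : PG S (addStar p G X) where
  mem := by
    intro a b hab
    rcases mem_addStar.1 hab with h | ⟨x, hx, h⟩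
    · exact (hG.mono_left (S.erase_subset p)).mem h
    · have hx := mem_vis.1 (hX hx)
      rcases Sym2.eq_iff.1 h with ⟨rfl, rfl⟩ | ⟨rfl, rfl⟩
      · exact ⟨hx.2.1.symm, hp, hx.1⟩
      · exact ⟨hx.2.1, hx.1, hp⟩
  not_cr := by
    have key : ∀ x ∈ X, ∀ c d, s(c, d) ∈ G → ∀ a b, s(p, x) = s(a, b) → ¬ Cr a b c d := by
      intro x hx c d hcd a b h hcr
      have hx := (mem_vis.1 (hX hx)).2.2 c d hcd
      rcases Sym2.eq_iff.1 h with ⟨rfl, rfl⟩ | ⟨rfl, rfl⟩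
      · exact hx hcr
      · exact hx hcr.swap_left
    intro a b c d hab hcd hcr
    rcases mem_addStar.1 hab with h1 | ⟨x, hx, h1⟩ <;>
      rcases mem_addStar.1 hcd with h2 | ⟨y, hy, h2⟩
    · exact hG.not_cr h1 h2 hcr
    · exact key y hy a b h1 c d h2 hcr.symm
    · exact key x hx c d h2 a b h1 hcr
    · obtain ⟨n1, n2, n3, n4⟩ := hcr.fst_ne
      rcases Sym2.eq_iff.1 h1 with ⟨rfl, rfl⟩ | ⟨rfl, rfl⟩ <;>
        rcases Sym2.eq_iff.1 h2 with ⟨rfl, rfl⟩ | ⟨rfl, rfl⟩ <;> simp at n1 n2 n3 n4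

lemma sum_planeGraphs {S : Finset Pt} (hS : OrientGP S) {p : Pt} (hp : p ∈ S)
    (F : Finset (Sym2 Pt) → ℝ) : ∑ G ∈ planeGraphs S, F G =
      ∑ G ∈ planeGraphs (S.erase p), ∑ X ∈ (vis S G p).powerset, F (addStar p G X) := by
  have hS' := hS.mono (S.erase_subset p)
  rw [Finset.sum_sigma']
  symm
  refine Finset.sum_bij' (fun a _ => addStar p a.1 a.2)
    (fun G _ => ⟨G.filter fun e => p ∉ e, S.filter fun x => s(p, x) ∈ G⟩) ?_ ?_ ?_ ?_ ?_
  · rintro ⟨G, X⟩ h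
    rw [Finset.mem_sigma, mem_planeGraphs hS', Finset.mem_powerset] at h
    exact (mem_planeGraphs hS).2 (h.1.addStar hp h.2)
  · intro G hG
    rw [mem_planeGraphs hS] at hG
    rw [Finset.mem_sigma, mem_planeGraphs hS', Finset.mem_powerset]
    refine ⟨⟨?_, fun h1 h2 => hG.not_cr (Finset.mem_filter.1 h1).1 (Finset.mem_filter.1 h2).1⟩, ?_⟩
    · intro a b hab
      obtain ⟨hab, hn⟩ := Finset.mem_filter.1 hab
      rw [Sym2.mem_iff, not_or] at hn
      obtain ⟨h1, h2, h3⟩ := hG.mem hab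
      exact ⟨h1, Finset.mem_erase.2 ⟨hn.1 ∘ Eq.symm, h2⟩, Finset.mem_erase.2 ⟨hn.2 ∘ Eq.symm, h3⟩⟩
    · intro x hx
      obtain ⟨hx, hpx⟩ := Finset.mem_filter.1 hx
      exact mem_vis.2 ⟨hx, (hG.mem hpx).1.symm, fun a b hab =>
        hG.not_cr hpx (Finset.mem_filter.1 hab).1⟩
  · rintro ⟨G, X⟩ h
    rw [Finset.mem_sigma, mem_planeGraphs hS', Finset.mem_powerset] at h
    obtain ⟨hG, hX⟩ := h
    have e1 : (addStar p G X).filter (fun e => p ∉ e) = G := by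
      ext e
      rw [Finset.mem_filter, mem_addStar]
      constructor
      · rintro ⟨h | ⟨x, -, rfl⟩, hn⟩
        · exact h
        · exact absurd (Sym2.mem_mk_left p x) hn
      · exact fun h => ⟨Or.inl h, hG.notMem_of_erase h⟩
    have e2 : S.filter (fun x => s(p, x) ∈ addStar p G X) = X := by
      ext x
      rw [Finset.mem_filter, hG.mk_mem_addStar]
      exact ⟨fun h => h.2, fun h => ⟨(mem_vis.1 (hX h)).1, h⟩⟩
    simp only [e1, e2]
  · intro G hG
    rw [mem_planeGraphs hS] at hG
    ext e
    induction e with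
    | _ a b =>
      simp only [mem_addStar, Finset.mem_filter]
      constructor
      · rintro (h | ⟨x, ⟨-, hx⟩, h⟩)
        · exact h.1
        · rwa [← h]
      · intro h
        obtain ⟨-, ha, hb⟩ := hG.mem h
        by_cases hp : p ∈ s(a, b)
        · rcases Sym2.mem_iff.1 hp with rfl | rfl
          · exact Or.inr ⟨b, ⟨hb, h⟩, rfl⟩
          · exact Or.inr ⟨a, ⟨ha, Sym2.eq_swap ▸ h⟩, Sym2.eq_swap⟩
        · exact Or.inl ⟨h, hp⟩
  · intro a _
    rfl

lemma PG.vis_addStar {p : Pt} {S : Finset Pt} {G : Finset (Sym2 Pt)} (X : Finset Pt) :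
    vis S (_root_.addStar p G X) p = vis S G p := by
  ext w
  simp only [mem_vis, mem_addStar]
  refine and_congr_right fun _ => and_congr_right fun _ => ⟨fun h a b hab => h a b (Or.inl hab), ?_⟩
  rintro h a b (hab | ⟨x, -, hab⟩)
  · exact h a b hab
  · intro hcr
    obtain ⟨n1, n2, -⟩ := hcr.fst_ne
    rcases Sym2.eq_iff.1 hab with ⟨rfl, rfl⟩ | ⟨rfl, rfl⟩
    · exact n1 rfl
    · exact n2 rfl

lemma Interior.sum_weight {k p : Pt} {S : Finset Pt} (hI : Interior k p S) :
    ∑ G ∈ planeGraphs S, (1 + 6 / 5 * (6 - (tightCount k S G p : ℝ))) ≤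
      (planeGraphs (S.erase p)).card * 163 := by
  rw [sum_planeGraphs hI.gp hI.mem]
  refine le_trans (Finset.sum_le_sum fun G hG => ?_) hI.sum_starWeight
  rw [mem_planeGraphs (hI.gp.mono (S.erase_subset p))] at hG
  refine (Finset.sum_congr rfl fun X _ => ?_).le
  have : (vis S G p).filter (Tight k S (addStar p G X) p) =
      (vis S G p).filter (TightAt k p (vis S G p) X) := by
    refine Finset.filter_congr fun w _ => ?_
    simp only [Tight, TightAt, PG.vis_addStar, hG.mk_mem_addStar]
  rw [tightCount, PG.vis_addStar, this]

lemma sum_card_planeGraphs {S : Finset Pt} (hS : OrientGP S) {k : Pt}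
    (hk : ∀ a ∈ S, ∀ b ∈ S, lin k a = lin k b → a = b) (hc : 17 ≤ S.card) :
    ((planeGraphs S).card : ℝ) * (S.card - 82 / 5) ≤
      ∑ p ∈ S, ((planeGraphs (S.erase p)).card : ℝ) * 163 := by
  have hne : S.Nonempty := Finset.card_pos.1 (by omega)
  obtain ⟨l, hl, hmin⟩ := S.exists_min_image (lin k) hne
  obtain ⟨r, hr, hmax⟩ := S.exists_max_image (lin k) hne
  set S' := (S.erase l).erase r with hS'
  have hsub : S' ⊆ S := (Finset.erase_subset _ _).trans (Finset.erase_subset _ _)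
  have hcard : (S.card : ℝ) ≤ S'.card + 2 := by
    have h1 := Finset.pred_card_le_card_erase (s := S) (a := l)
    have h2 := Finset.pred_card_le_card_erase (s := S.erase l) (a := r)
    rw [← hS'] at h2
    have : S.card ≤ S'.card + 2 := by omega
    exact_mod_cast this
  have hI : ∀ p ∈ S', Interior k p S := by
    intro p hp
    obtain ⟨h1, h2, hp⟩ : p ≠ r ∧ p ≠ l ∧ p ∈ S := by simpa [hS'] using hp
    refine ⟨hS, hp, fun a ha h => hk a ha p hp h, ⟨r, hr, ?_⟩, ⟨l, hl, ?_⟩⟩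
    · exact lt_of_le_of_ne (hmax p hp) fun h => h1 (hk p hp r hr h)
    · exact lt_of_le_of_ne (hmin p hp) fun h => h2 (hk l hl p hp h).symm
  calc ((planeGraphs S).card : ℝ) * (S.card - 82 / 5)
      = ∑ G ∈ planeGraphs S, ((S.card : ℝ) - 82 / 5) := by rw [Finset.sum_const, nsmul_eq_mul]
    _ ≤ ∑ G ∈ planeGraphs S, ∑ p ∈ S', (1 + 6 / 5 * (6 - (tightCount k S G p : ℝ))) := by
        refine Finset.sum_le_sum fun G hG => ?_
        have h1 := ((mem_planeGraphs hS).1 hG).sum_tightCount_le hS hk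
        have h2 := (Finset.sum_le_sum_of_subset (f := tightCount k S G) hsub).trans h1
        have h3 : ∑ p ∈ S', (tightCount k S G p : ℝ) ≤ 6 * S.card := by exact_mod_cast h2
        rw [Finset.sum_add_distrib, ← Finset.mul_sum, Finset.sum_sub_distrib, Finset.sum_const,
          Finset.sum_const, nsmul_eq_mul, nsmul_eq_mul]
        linarith
    _ = ∑ p ∈ S', ∑ G ∈ planeGraphs S, (1 + 6 / 5 * (6 - (tightCount k S G p : ℝ))) :=
        Finset.sum_comm
    _ ≤ ∑ p ∈ S', ((planeGraphs (S.erase p)).card : ℝ) * 163 :=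
        Finset.sum_le_sum fun p hp => (hI p hp).sum_weight
    _ ≤ ∑ p ∈ S, ((planeGraphs (S.erase p)).card : ℝ) * 163 :=
        Finset.sum_le_sum_of_subset_of_nonneg hsub fun p _ _ => by positivity

lemma exists_lin_injOn (S : Finset Pt) : ∃ k, ∀ a ∈ S, ∀ b ∈ S, lin k a = lin k b → a = b := by
  obtain ⟨t, ht⟩ := Infinite.exists_notMem_finset
    ((S ×ˢ S).image fun e => -(e.1.1 - e.2.1) / (e.1.2 - e.2.2))
  refine ⟨(1, t), fun a ha b hb h => ?_⟩
  simp only [lin, one_mul] at h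
  have h2 : a.2 = b.2 := by
    by_contra hne
    refine ht (Finset.mem_image.2 ⟨(a, b), Finset.mem_product.2 ⟨ha, hb⟩, ?_⟩)
    rw [div_eq_iff (sub_ne_zero.2 hne)]
    linarith
  rw [h2] at h
  exact Prod.ext (by linarith) h2

lemma card_planeGraphs_le (S : Finset Pt) :
    (planeGraphs S).card ≤ 2 ^ (S.card + 1).choose 2 := by
  rw [← Finset.card_sym2, ← Finset.card_powerset]
  exact Finset.card_le_card (Finset.filter_subset _ _)

theorem exists_card_planeGraphs_le : ∃ C : ℝ, ∀ S : Finset Pt, OrientGP S →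
    ((planeGraphs S).card : ℝ) ≤ C * 186.46 ^ S.card := by
  have aux : ∀ l : ℕ, ∃ m, ∀ n < l, (n + 1).choose 2 ≤ m :=
    fun l => ⟨l.choose 2, fun n hn => Nat.choose_le_choose 2 hn⟩
  obtain ⟨m, hm⟩ := aux 200
  refine ⟨2 ^ m, fun S hS => ?_⟩
  obtain ⟨k, hk⟩ := exists_lin_injOn S
  induction h : S.card generalizing S with
  | zero =>
    have h1 := card_planeGraphs_le S
    rw [h] at h1
    have h2 : (planeGraphs S).card ≤ 2 ^ m := h1.trans (Nat.one_le_two_pow)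
    rw [pow_zero, mul_one]
    exact_mod_cast h2
  | succ n ih =>
    by_cases hn : n + 1 < 200
    · have h1 := card_planeGraphs_le S
      rw [h] at h1
      have h2 : (planeGraphs S).card ≤ 2 ^ m := h1.trans
        (Nat.pow_le_pow_right two_pos (hm _ hn))
      have h3 : ((planeGraphs S).card : ℝ) ≤ 2 ^ m := by exact_mod_cast h2
      exact h3.trans (le_mul_of_one_le_right (by positivity) (one_le_pow₀ (by norm_num)))
    · have h1 := sum_card_planeGraphs hS hk (by omega)
      have h2 : ∑ p ∈ S, ((planeGraphs (S.erase p)).card : ℝ) * 163 ≤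
          ∑ p ∈ S, 2 ^ m * 186.46 ^ n * 163 := by
        refine Finset.sum_le_sum fun p hp => mul_le_mul_of_nonneg_right ?_ (by norm_num)
        refine ih _ (hS.mono (S.erase_subset p)) (fun a ha b hb => hk a (Finset.mem_of_mem_erase ha)
          b (Finset.mem_of_mem_erase hb)) ?_
        rw [Finset.card_erase_of_mem hp, h, Nat.add_sub_cancel]
      rw [Finset.sum_const, nsmul_eq_mul] at h2
      have hN : (200 : ℝ) ≤ S.card := by rw [h]; exact_mod_cast not_lt.1 hn
      have hB : (0 : ℝ) ≤ 2 ^ m * 186.46 ^ n := by positivity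
      rw [pow_succ, ← mul_assoc]
      generalize (2 : ℝ) ^ m * 186.46 ^ n = B at *
      generalize (S.card : ℝ) = N at *
      generalize ((planeGraphs S).card : ℝ) = g at *
      by_contra! hg
      nlinarith [mul_lt_mul_of_pos_right hg (show (0 : ℝ) < N - 82 / 5 by linarith),
        mul_nonneg hB (show (0 : ℝ) ≤ N - 200 by linarith)]

/-- Corollary 2.13. The number of connected plane graphs on any
set `S` of `N` points in general position is `O*(186.46^N)`. -/
theorem stmt11 :
    ∃ P : Polynomial ℝ,
      ∀ (S : Finset Pt) (N : ℕ), S.card = N → GenPos S →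
        ((connPlaneGraphs S).card : ℝ) ≤ P.eval (N : ℝ) * 186.46 ^ N := by
  obtain ⟨C, hC⟩ := exists_card_planeGraphs_le
  refine ⟨Polynomial.C C, ?_⟩
  rintro S N rfl hS
  rw [Polynomial.eval_C]
  refine le_trans ?_ (hC S hS.orientGP)
  exact_mod_cast Finset.card_le_card (Finset.filter_subset _ _)
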